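/- arXiv:1903.09337 — 2 statements merged into one kernel-verified Lean document; each statement's English description precedes it below -/
import Mathlib

section
/- Let (Ω,𝒜,T,μ,ℱ,‖·‖,χ) fulfill Property 𝔇 and assume μ(χ>x)=L(x)/x^α for all x>0, where L is slowly varying and 0<α<1. Let (b_n) be a sequence of natural numbers tending to infinity with b_n=o(n), and assume that at least one ψ-mixing coefficient of the sequence (χ∘T^{n-1})_{n∈ℕ} is strictly less than one. Then, with d_n := (α/(1-α))·n^{1/α}·b_n^{1-1/α}·ℓ^#((n/b_n)^{1/α}), convergence in mean holds: lim_{n→∞} ∫ |S_n^{b_n}χ/d_n − 1| dμ = 0. -/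
open MeasureTheory Filter Topology ENNReal

noncomputable section

/-- Birkhoff sum `S_n χ = ∑_{k=1}^n χ ∘ T^{k-1}`. -/
def birkhoffSumN {Ω : Type*} (T : Ω → Ω) (χ : Ω → ℝ) (n : ℕ) (ω : Ω) : ℝ :=
  ∑ k ∈ Finset.range n, χ (T^[k] ω)

/-- Trimmed sum `S_n^b χ`: the sum of the `n - b` smallest values among
`χ(ω), χ(Tω), …, χ(T^{n-1}ω)`. -/
def trimmedSumN {Ω : Type*} (T : Ω → Ω) (χ : Ω → ℝ) (n b : ℕ) (ω : Ω) : ℝ :=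
  (((((List.range n).map fun k => χ (T^[k] ω))).mergeSort (fun a b => a ≤ b)).take (n - b)).sum

/-- Truncated sum `T_n^f χ = ∑_{k=1}^n (χ·1_{χ ≤ f}) ∘ T^{k-1}`. -/
def truncSumN {Ω : Type*} (T : Ω → Ω) (χ : Ω → ℝ) (n : ℕ) (f : ℝ) (ω : Ω) : ℝ :=
  ∑ k ∈ Finset.range n, if χ (T^[k] ω) ≤ f then χ (T^[k] ω) else 0

/-- A function `L` is slowly varying if `L(cx)/L(x) → 1` as `x → ∞`, for every `c > 0`. -/
def SlowlyVarying (L : ℝ → ℝ) : Prop :=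
  ∀ c : ℝ, 0 < c → Tendsto (fun x => L (c * x) / L x) atTop (𝓝 1)

/-- `ls` is a de Bruijn conjugate of the slowly varying function `Lt`. -/
def IsDeBruijnConjugate (Lt ls : ℝ → ℝ) : Prop :=
  SlowlyVarying ls ∧
  Tendsto (fun x => Lt x * ls (x * Lt x)) atTop (𝓝 1) ∧
  Tendsto (fun x => ls x * Lt (x * ls x)) atTop (𝓝 1)

/-- The measure of dependence `ψ(ℬ,𝒞)` between two sub-σ-fields. -/
def psiDep {Ω : Type*} [MeasurableSpace Ω] (μ : Measure Ω)
    (B C : MeasurableSpace Ω) : ℝ≥0∞ :=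
  ⨆ (b : Set Ω) (c : Set Ω) (_ : MeasurableSet[B] b) (_ : MeasurableSet[C] c)
    (_ : 0 < μ b) (_ : 0 < μ c),
    ENNReal.ofReal |(μ (b ∩ c)).toReal / ((μ b).toReal * (μ c).toReal) - 1|

/-- The σ-field generated by `X_k = χ ∘ T^{k-1}` for `J ≤ k ≤ L`. -/
def sigmaIcc {Ω : Type*} [MeasurableSpace Ω] (T : Ω → Ω) (χ : Ω → ℝ) (J L : ℕ) :
    MeasurableSpace Ω :=
  ⨆ k ∈ Set.Icc J L, MeasurableSpace.comap (fun ω => χ (T^[k - 1] ω)) inferInstance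

/-- The σ-field generated by `X_k = χ ∘ T^{k-1}` for `k ≥ J`. -/
def sigmaIci {Ω : Type*} [MeasurableSpace Ω] (T : Ω → Ω) (χ : Ω → ℝ) (J : ℕ) :
    MeasurableSpace Ω :=
  ⨆ k ∈ Set.Ici J, MeasurableSpace.comap (fun ω => χ (T^[k - 1] ω)) inferInstance

/-- The `n`-th ψ-mixing coefficient of the sequence `(χ ∘ T^{k-1})_{k ≥ 1}`. -/
def psiCoeff {Ω : Type*} [MeasurableSpace Ω] (μ : Measure Ω) (T : Ω → Ω) (χ : Ω → ℝ)
    (n : ℕ) : ℝ≥0∞ :=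
  ⨆ (k : ℕ) (_ : 1 ≤ k), psiDep μ (sigmaIcc T χ 1 k) (sigmaIci T χ (k + n))

/-- A bounded operator `U` has a spectral gap: `U = λ·P + N` with `P` a one-dimensional
projection, `ρ(N) < |λ|`, and `PN = NP = 0`. -/
def HasSpectralGap {F : Type*} [NormedAddCommGroup F] [NormedSpace ℝ F] [CompleteSpace F]
    (U : F →L[ℝ] F) : Prop :=
  ∃ (lam : ℝ) (P N : F →L[ℝ] F),
    U = lam • P + N ∧ P.comp P = P ∧
    Module.finrank ℝ (LinearMap.range (P : F →ₗ[ℝ] F)) = 1 ∧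
    spectralRadius ℝ N < ENNReal.ofReal |lam| ∧
    P.comp N = 0 ∧ N.comp P = 0

/-- Property ℭ: `μ` is a `T`-invariant mixing probability measure, `ℱ` (realized as a Banach
algebra `F` of measurable functions via the injective algebra homomorphism `ι`) contains the
constants, dominates the sup norm, and the transfer operator restricts to a bounded operator
on `F` with a spectral gap. -/
structure PropertyC {Ω : Type*} [MeasurableSpace Ω] (T : Ω → Ω) (μ : Measure Ω)
    {F : Type*} [NormedRing F] [NormedAlgebra ℝ F] [CompleteSpace F]
    (ι : F →ₐ[ℝ] Ω → ℝ) : Prop where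
  prob : IsProbabilityMeasure μ
  invariant : MeasurePreserving T μ μ
  mixing : ∀ A B : Set Ω, MeasurableSet A → MeasurableSet B →
    Tendsto (fun n => μ (A ∩ T^[n] ⁻¹' B)) atTop (𝓝 (μ A * μ B))
  inj : Function.Injective ι
  measurable_mem : ∀ f : F, Measurable (ι f)
  norm_ge_sup : ∀ (f : F) (ω : Ω), |ι f ω| ≤ ‖f‖
  transfer : ∃ That : F →L[ℝ] F,
    (∀ (f : F) (g : Ω → ℝ), Measurable g → (∃ C, ∀ ω, |g ω| ≤ C) →
      ∫ ω, ι (That f) ω * g ω ∂μ = ∫ ω, ι f ω * g (T ω) ∂μ) ∧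
    HasSpectralGap That

/-- Property 𝔇: Property ℭ together with the norm control on truncations of the
nonnegative observable `χ`. -/
structure PropertyD {Ω : Type*} [MeasurableSpace Ω] (T : Ω → Ω) (μ : Measure Ω)
    {F : Type*} [NormedRing F] [NormedAlgebra ℝ F] [CompleteSpace F]
    (ι : F →ₐ[ℝ] Ω → ℝ) (χ : Ω → ℝ) extends PropertyC T μ ι : Prop where
  chi_nonneg : ∀ ω, 0 ≤ χ ω
  chi_meas : Measurable χ
  norm_bound : ∃ K₁ > (0 : ℝ), ∀ ℓ : ℝ, 0 ≤ ℓ →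
    (∃ f : F, ι f = (fun ω => if χ ω ≤ ℓ then χ ω else 0) ∧ ‖f‖ ≤ K₁ * ℓ) ∧
    (∃ g : F, ι g = (fun ω => if ℓ < χ ω then (1 : ℝ) else 0) ∧ ‖g‖ ≤ K₁)

/-- The distribution function `F(x) = μ(χ ≤ x)`. -/
def distF {Ω : Type*} [MeasurableSpace Ω] (μ : Measure Ω) (χ : Ω → ℝ) (x : ℝ) : ℝ :=
  (μ {ω | χ ω ≤ x}).toReal

/-- Generalized inverse `F^←(y) = inf {x | F(x) ≥ y}`. -/
def genInv (F : ℝ → ℝ) (y : ℝ) : ℝ := sInf {x : ℝ | y ≤ F x}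

/-- `g_n = F^←(1 - (b_n - ζ_n)/n)` where `ζ_n = b_n^{2/3}`. -/
def gSeq {Ω : Type*} [MeasurableSpace Ω] (μ : Measure Ω) (χ : Ω → ℝ) (b : ℕ → ℕ)
    (n : ℕ) : ℝ :=
  genInv (distF μ χ) (1 - ((b n : ℝ) - (b n : ℝ) ^ ((2 : ℝ) / 3)) / n)

/-- The norming sequence `d_n = (α/(1-α))·n^{1/α}·b_n^{1-1/α}·ℓ^#((n/b_n)^{1/α})`. -/
def dSeq (α : ℝ) (ls : ℝ → ℝ) (b : ℕ → ℕ) (n : ℕ) : ℝ :=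
  α / (1 - α) * (n : ℝ) ^ (1 / α) * (b n : ℝ) ^ (1 - 1 / α) *
    ls (((n : ℝ) / (b n : ℝ)) ^ (1 / α))

end


lemma aux_lintegral_le_of_sub {Ω : Type*} {m m0 : MeasurableSpace Ω} (hm : m ≤ m0)
    (ν μ : @Measure Ω m0) (c : ℝ≥0∞)
    (h : ∀ D, MeasurableSet[m] D → ν D ≤ c * μ D) (f : Ω → ℝ≥0∞) (hf : Measurable[m] f) :
    ∫⁻ ω, f ω ∂ν ≤ c * ∫⁻ ω, f ω ∂μ := by
  rw [← lintegral_trim hm hf, ← lintegral_trim hm hf, ← smul_eq_mul,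
    ← lintegral_smul_measure]
  refine lintegral_mono' ?_ le_rfl
  refine Measure.le_iff.2 fun s hs => ?_
  rw [trim_measurableSet_eq hm hs, Measure.smul_apply, trim_measurableSet_eq hm hs]
  exact h s hs

section sigma
variable {Ω : Type*} [MeasurableSpace Ω] {T : Ω → Ω} {χ : Ω → ℝ}

lemma aux_sigmaIci_le (hT : Measurable T) (hχ : Measurable χ) (J : ℕ) :
    sigmaIci T χ J ≤ ‹MeasurableSpace Ω› := by
  refine iSup₂_le fun k _ => ?_
  exact (hχ.comp (hT.iterate _)).comap_le

lemma aux_sigmaIcc_le_Ici (J J' K : ℕ) (h : J' ≤ J) : sigmaIcc T χ J K ≤ sigmaIci T χ J' := by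
  refine iSup₂_le fun k hk => ?_
  exact le_iSup₂_of_le k (Set.mem_Ici.2 (h.trans hk.1)) le_rfl

lemma aux_sigmaIcc_le (hT : Measurable T) (hχ : Measurable χ) (J K : ℕ) :
    sigmaIcc T χ J K ≤ ‹MeasurableSpace Ω› :=
  (aux_sigmaIcc_le_Ici J J K le_rfl).trans (aux_sigmaIci_le hT hχ J)

lemma aux_sigmaIcc_mono {J K J' K' : ℕ} (h : J' ≤ J) (h' : K ≤ K') :
    sigmaIcc T χ J K ≤ sigmaIcc T χ J' K' := by
  refine iSup₂_le fun k hk => ?_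
  exact le_iSup₂_of_le k ⟨h.trans hk.1, hk.2.trans h'⟩ le_rfl

lemma aux_sigmaIcc_preimage {J K : ℕ} (s : ℕ) (hJ : 1 ≤ J) {B : Set Ω}
    (hB : MeasurableSet[sigmaIcc T χ J K] B) :
    MeasurableSet[sigmaIcc T χ (J + s) (K + s)] (T^[s] ⁻¹' B) := by
  have : sigmaIcc T χ J K ≤ MeasurableSpace.map (T^[s]) (sigmaIcc T χ (J + s) (K + s)) := by
    refine iSup₂_le fun k hk => ?_
    rw [← MeasurableSpace.comap_le_iff_le_map, MeasurableSpace.comap_comp]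
    have hk1 : 1 ≤ k := hJ.trans hk.1
    refine le_iSup₂_of_le (k + s) ⟨by have := hk.1; omega, by have := hk.2; omega⟩ ?_
    apply le_of_eq
    congr 1
    funext ω
    simp only [Function.comp]
    rw [← Function.iterate_add_apply]
    congr 2
    omega
  exact this B hB

lemma aux_sigmaIcc_A (t : ℕ) (x : ℝ) :
    MeasurableSet[sigmaIcc T χ (t + 1) (t + 1)] {ω | x < χ (T^[t] ω)} := by
  have h : MeasurableSpace.comap (fun ω => χ (T^[t + 1 - 1] ω)) inferInstance
      ≤ sigmaIcc T χ (t + 1) (t + 1) := le_iSup₂_of_le (t + 1) ⟨le_rfl, le_rfl⟩ le_rfl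
  exact h _ ⟨Set.Ioi x, measurableSet_Ioi, rfl⟩

lemma aux_psi {μ : Measure Ω} [IsProbabilityMeasure μ] {r : ℕ} (h : psiCoeff μ T χ r < 1)
    {k : ℕ} (hk : 1 ≤ k) {B C : Set Ω} (hB : MeasurableSet[sigmaIcc T χ 1 k] B)
    (hC : MeasurableSet[sigmaIci T χ (k + r)] C) : μ (B ∩ C) ≤ 2 * μ B * μ C := by
  rcases eq_or_ne (μ B) 0 with hB0 | hB0
  · rw [measure_mono_null Set.inter_subset_left hB0]; exact zero_le
  rcases eq_or_ne (μ C) 0 with hC0 | hC0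
  · rw [measure_mono_null Set.inter_subset_right hC0]; exact zero_le
  have h1 : ENNReal.ofReal |(μ (B ∩ C)).toReal / ((μ B).toReal * (μ C).toReal) - 1|
      ≤ psiCoeff μ T χ r := by
    refine le_trans ?_ (le_iSup₂ (f := fun (k : ℕ) (_ : 1 ≤ k) =>
      psiDep μ (sigmaIcc T χ 1 k) (sigmaIci T χ (k + r))) k hk)
    unfold psiDep
    refine le_iSup_of_le B (le_iSup_of_le C (le_iSup_of_le hB (le_iSup_of_le hC
      (le_iSup_of_le (pos_iff_ne_zero.2 hB0) (le_iSup_of_le (pos_iff_ne_zero.2 hC0) le_rfl)))))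
  have h2 := h1.trans_lt h
  rw [ENNReal.ofReal_lt_one] at h2
  have h3 := (abs_lt.1 h2).2
  have hb : 0 < (μ B).toReal := ENNReal.toReal_pos hB0 (measure_ne_top _ _)
  have hc : 0 < (μ C).toReal := ENNReal.toReal_pos hC0 (measure_ne_top _ _)
  have h4 : (μ (B ∩ C)).toReal / ((μ B).toReal * (μ C).toReal) < 2 := by linarith
  rw [div_lt_iff₀ (by positivity)] at h4
  have h5 : (μ (B ∩ C)).toReal ≤ (2 * μ B * μ C).toReal := by
    simp only [ENNReal.toReal_mul, ENNReal.toReal_ofNat]; linarith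
  exact (ENNReal.toReal_le_toReal (measure_ne_top _ _)
    (ENNReal.mul_ne_top (ENNReal.mul_ne_top (by simp) (measure_ne_top _ _))
      (measure_ne_top _ _))).1 h5

end sigma

section decor
variable {Ω : Type*} [MeasurableSpace Ω] {T : Ω → Ω} {μ : Measure Ω} [IsProbabilityMeasure μ]

/-- centred indicator -/
noncomputable def auxG (T : Ω → Ω) (μ : Measure Ω) (D : Set Ω) (s : ℕ) (ω : Ω) : ℝ :=
  (T^[s] ⁻¹' D).indicator (fun _ => (1 : ℝ)) ω - μ.real D

lemma auxG_abs (D : Set Ω) (s : ℕ) (ω : Ω) : |auxG T μ D s ω| ≤ 1 := by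
  unfold auxG
  have h0 : 0 ≤ μ.real D := measureReal_nonneg
  have h1 : μ.real D ≤ 1 := measureReal_le_one
  by_cases h : ω ∈ T^[s] ⁻¹' D <;> simp only [h, Set.indicator_of_mem, not_false_iff,
    Set.indicator_of_notMem] <;> rw [abs_le] <;> constructor <;> linarith

lemma auxG_meas {Ω : Type*} {T : Ω → Ω} {m m0 : MeasurableSpace Ω} {μ : Measure Ω} (D : Set Ω) (s : ℕ)
    (h : MeasurableSet[m] (T^[s] ⁻¹' D)) : Measurable[m] (auxG T μ D s) := by
  unfold auxG
  exact Measurable.sub_const (Measurable.indicator measurable_const h) _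

lemma auxG_integrable (hT : MeasurePreserving T μ μ) {D : Set Ω} (hD : MeasurableSet D) (s : ℕ) :
    Integrable (auxG T μ D s) μ := by
  refine Integrable.of_bound (auxG_meas D s ((hT.measurable.iterate s) hD)).aestronglyMeasurable 1
    (Filter.Eventually.of_forall fun ω => by simpa using auxG_abs D s ω)

lemma auxG_cov (hT : MeasurePreserving T μ μ) {D : Set Ω} (hD : MeasurableSet D) (s k : ℕ) :
    ∫ ω, auxG T μ D s ω * auxG T μ D (s + k) ω ∂μ
      = μ.real (D ∩ T^[k] ⁻¹' D) - μ.real D * μ.real D := by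
  have hms : ∀ s, MeasurableSet (T^[s] ⁻¹' D) := fun s => (hT.measurable.iterate s) hD
  have hpr : ∀ s, μ.real (T^[s] ⁻¹' D) = μ.real D := fun s => by
    rw [measureReal_def, (hT.iterate s).measure_preimage hD.nullMeasurableSet, measureReal_def]
  have hint : ∀ A : Set Ω, MeasurableSet A → Integrable (A.indicator (fun _ => (1 : ℝ))) μ :=
    fun A hA => (integrable_const _).indicator hA
  have h1 : ∀ ω, auxG T μ D s ω * auxG T μ D (s + k) ω =
      (T^[s] ⁻¹' (D ∩ T^[k] ⁻¹' D)).indicator (fun _ => (1 : ℝ)) ω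
      - μ.real D * (T^[s] ⁻¹' D).indicator (fun _ => (1 : ℝ)) ω
      - μ.real D * (T^[s + k] ⁻¹' D).indicator (fun _ => (1 : ℝ)) ω + μ.real D * μ.real D := by
    intro ω
    have e : T^[s] ⁻¹' (D ∩ T^[k] ⁻¹' D) = T^[s] ⁻¹' D ∩ T^[s + k] ⁻¹' D := by
      ext ω
      simp only [Set.mem_preimage, Set.mem_inter_iff]
      rw [← Function.iterate_add_apply, add_comm k s]
    rw [e]
    unfold auxG
    by_cases ha : ω ∈ T^[s] ⁻¹' D <;> by_cases hb : ω ∈ T^[s + k] ⁻¹' D <;>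
      simp [Set.indicator, ha, hb, -Set.mem_preimage] <;> ring
  simp_rw [h1]
  have hm2 : MeasurableSet (T^[s] ⁻¹' (D ∩ T^[k] ⁻¹' D)) :=
    (hT.measurable.iterate s) (hD.inter (hms k))
  rw [integral_add, integral_sub, integral_sub, integral_const_mul, integral_const_mul,
    integral_indicator hm2, integral_indicator (hms s), integral_indicator (hms (s+k))]
  · simp only [integral_const, smul_eq_mul, mul_one, measureReal_restrict_apply_univ, hpr,
      probReal_univ, one_mul]
    have : μ.real (T^[s] ⁻¹' (D ∩ T^[k] ⁻¹' D)) = μ.real (D ∩ T^[k] ⁻¹' D) := by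
      rw [measureReal_def, (hT.iterate s).measure_preimage (hD.inter (hms k)).nullMeasurableSet,
        measureReal_def]
    rw [this]
    ring
  · exact hint _ hm2
  · exact (hint _ (hms _)).const_mul _
  · exact (hint _ hm2).sub ((hint _ (hms _)).const_mul _)
  · exact (hint _ (hms _)).const_mul _
  · exact ((hint _ hm2).sub ((hint _ (hms _)).const_mul _)).sub ((hint _ (hms _)).const_mul _)
  · exact integrable_const _

lemma aux_decor (hT : MeasurePreserving T μ μ)
    (hmix : ∀ A B : Set Ω, MeasurableSet A → MeasurableSet B →
      Tendsto (fun n => μ (A ∩ T^[n] ⁻¹' B)) atTop (𝓝 (μ A * μ B)))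
    {D : Set Ω} (hD : MeasurableSet D) {η : ℝ} (hη : 0 < η) :
    ∃ Q₀ I₀ : ℕ, ∀ Q ≥ Q₀, ∀ I ≥ I₀, ∀ s₀ : ℕ, ∀ θ : ℕ → ℝ, (∀ j, |θ j| ≤ 1) →
      ∫ ω, |∑ j ∈ Finset.range I, θ j * auxG T μ D (s₀ + j * Q) ω| ∂μ ≤ I * η := by
  have h1 : Tendsto (fun n => μ.real (D ∩ T^[n] ⁻¹' D) - μ.real D * μ.real D) atTop (𝓝 0) := by
    have := (ENNReal.tendsto_toReal (ENNReal.mul_ne_top (measure_ne_top μ D)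
      (measure_ne_top μ D))).comp (hmix D D hD hD)
    rw [ENNReal.toReal_mul] at this
    simpa [measureReal_def] using this.sub_const (μ.real D * μ.real D)
  have h2 : ∀ᶠ n in atTop, |μ.real (D ∩ T^[n] ⁻¹' D) - μ.real D * μ.real D| < η ^ 2 / 2 := by
    have := (tendsto_order.1 (by simpa using h1.abs)).2 (η ^ 2 / 2) (by positivity)
    exact this
  obtain ⟨Q₀, hQ₀⟩ := eventually_atTop.1 h2
  obtain ⟨I₀, hI₀⟩ := exists_nat_gt (2 / η ^ 2)
  refine ⟨max Q₀ 1, I₀, fun Q hQ I hI s₀ θ hθ => ?_⟩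
  have hQ1 : 1 ≤ Q := (le_max_right _ _).trans hQ
  have hQQ : Q₀ ≤ Q := (le_max_left _ _).trans hQ
  set H : Ω → ℝ := fun ω => ∑ j ∈ Finset.range I, θ j * auxG T μ D (s₀ + j * Q) ω with hH
  have hGm : ∀ s, Measurable (auxG T μ D s) := fun s =>
    auxG_meas D s ((hT.measurable.iterate s) hD)
  have hHm : Measurable H := by
    rw [hH]
    exact Finset.measurable_sum _ fun j _ => (hGm _).const_mul _
  have hHb : ∀ ω, |H ω| ≤ I := by
    intro ω
    refine (Finset.abs_sum_le_sum_abs _ _).trans ?_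
    calc _ ≤ ∑ j ∈ Finset.range I, (1 : ℝ) := by
          refine Finset.sum_le_sum fun j _ => ?_
          rw [abs_mul]
          exact mul_le_one₀ (hθ j) (abs_nonneg _) (auxG_abs _ _ _)
      _ = I := by simp
  have hcov : ∀ i j, |∫ ω, auxG T μ D (s₀ + i * Q) ω * auxG T μ D (s₀ + j * Q) ω ∂μ|
      ≤ (if i = j then 1 else 0) + η ^ 2 / 2 := by
    have key : ∀ i j, i < j → |∫ ω, auxG T μ D (s₀ + i * Q) ω * auxG T μ D (s₀ + j * Q) ω ∂μ|
      ≤ η ^ 2 / 2 := by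
      intro i j hij
      obtain ⟨k, rfl⟩ := Nat.exists_eq_add_of_lt hij
      have : s₀ + (i + k + 1) * Q = (s₀ + i * Q) + (k + 1) * Q := by ring
      rw [this, auxG_cov hT hD]
      exact (hQ₀ _ (by nlinarith)).le
    intro i j
    rcases lt_trichotomy i j with h | h | h
    · simpa [h.ne] using key i j h
    · subst h
      simp only [if_true]
      have : |∫ ω, auxG T μ D (s₀ + i * Q) ω * auxG T μ D (s₀ + i * Q) ω ∂μ| ≤ 1 := by
        refine (abs_integral_le_integral_abs).trans ?_
        calc _ ≤ ∫ ω, (1:ℝ) ∂μ := by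
              refine integral_mono_of_nonneg (Filter.Eventually.of_forall fun _ => abs_nonneg _)
                (integrable_const _) (Filter.Eventually.of_forall fun ω => ?_)
              simp only [abs_mul]
              exact mul_le_one₀ (auxG_abs _ _ _) (abs_nonneg _) (auxG_abs _ _ _)
          _ = 1 := by simp
      have : 0 < η ^ 2 / 2 := by positivity
      linarith
    · have := key j i h
      simp_rw [mul_comm] at this ⊢
      simpa [h.ne'] using this
  have hsq : ∫ ω, H ω ^ 2 ∂μ ≤ (I * η) ^ 2 := by
    have hint : ∀ i j, Integrable (fun ω => auxG T μ D (s₀ + i * Q) ω * auxG T μ D (s₀ + j * Q) ω) μ := by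
      intro i j
      refine Integrable.of_bound ((hGm _).mul (hGm _)).aestronglyMeasurable 1
        (Filter.Eventually.of_forall fun ω => ?_)
      rw [Real.norm_eq_abs, abs_mul]
      exact mul_le_one₀ (auxG_abs _ _ _) (abs_nonneg _) (auxG_abs _ _ _)
    have e : ∀ ω, H ω ^ 2 = ∑ i ∈ Finset.range I, ∑ j ∈ Finset.range I, (θ i * θ j) *
        (auxG T μ D (s₀ + i * Q) ω * auxG T μ D (s₀ + j * Q) ω) := by
      intro ω
      rw [hH, sq]
      simp only
      rw [Finset.sum_mul_sum]
      refine Finset.sum_congr rfl fun i _ => Finset.sum_congr rfl fun j _ => by ring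
    simp_rw [e]
    rw [integral_finsetSum _ fun i _ => integrable_finsetSum _ fun j _ => (hint i j).const_mul _]
    calc _ ≤ ∑ i ∈ Finset.range I, ∑ j ∈ Finset.range I, ((if i = j then 1 else 0) + η ^ 2 / 2) := by
          refine Finset.sum_le_sum fun i _ => ?_
          rw [integral_finsetSum _ fun j _ => (hint i j).const_mul _]
          refine Finset.sum_le_sum fun j _ => ?_
          rw [integral_const_mul]
          refine (le_abs_self _).trans ?_
          rw [abs_mul, abs_mul]
          refine le_trans ?_ (hcov i j)
          exact mul_le_of_le_one_left (abs_nonneg _) (mul_le_one₀ (hθ i) (abs_nonneg _) (hθ j))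
      _ ≤ I + I * I * (η ^ 2 / 2) := by
          simp only [Finset.sum_add_distrib, Finset.sum_ite_eq, Finset.sum_const, Finset.card_range,
            nsmul_eq_mul, Finset.mem_range]
          refine add_le_add ?_ (by rw [mul_assoc])
          · calc _ ≤ ∑ i ∈ Finset.range I, (1:ℝ) := by
                  refine Finset.sum_le_sum fun i _ => by split_ifs <;> norm_num
              _ = I := by simp
      _ ≤ _ := by
          have hI' : 2 / η ^ 2 < I := hI₀.trans_le (by exact_mod_cast hI)
          rw [div_lt_iff₀ (by positivity)] at hI'
          have : (0:ℝ) ≤ I := Nat.cast_nonneg _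
          nlinarith
  have hH2 : Integrable (fun ω => H ω ^ 2) μ := by
    refine Integrable.of_bound (hHm.pow_const 2).aestronglyMeasurable ((I:ℝ)^2)
        (Filter.Eventually.of_forall fun ω => ?_)
    rw [Real.norm_eq_abs, abs_pow]
    exact pow_le_pow_left₀ (abs_nonneg _) (hHb ω) 2
  have hH1 : Integrable (fun ω => |H ω|) μ := by
    refine Integrable.of_bound (hHm.abs).aestronglyMeasurable (I:ℝ)
        (Filter.Eventually.of_forall fun ω => ?_)
    simpa using hHb ω
  -- Jensen by hand
  set a := ∫ ω, |H ω| ∂μ with ha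
  have ha0 : 0 ≤ a := integral_nonneg fun _ => abs_nonneg _
  have : 0 ≤ ∫ ω, (|H ω| - a) ^ 2 ∂μ := integral_nonneg fun _ => sq_nonneg _
  have e2 : ∀ ω, (|H ω| - a) ^ 2 = H ω ^ 2 - (2 * a) * |H ω| + a ^ 2 := by
    intro ω; rw [sub_sq, sq_abs]; ring
  simp_rw [e2] at this
  have hH3 : Integrable (fun ω => H ω ^ 2 - 2 * a * |H ω|) μ := hH2.sub (hH1.const_mul _)
  rw [integral_add hH3 (integrable_const _),
    integral_sub hH2 (hH1.const_mul _), integral_const_mul] at this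
  simp only [integral_const, smul_eq_mul, probReal_univ, one_mul] at this
  rw [← ha] at this
  refine abs_le_of_sq_le_sq' (by nlinarith : a ^ 2 ≤ (I * η) ^ 2) (by positivity) |>.2

lemma aux_decor2 {Ω : Type*} {m m0 : MeasurableSpace Ω} {T : Ω → Ω} {μ : Measure Ω}
    [IsProbabilityMeasure μ] (hT : MeasurePreserving T μ μ)
    (hm : m ≤ m0) (ν : Measure Ω) [IsFiniteMeasure ν] (c : ℝ) (hc : 0 ≤ c)
    (hν : ∀ D, MeasurableSet[m] D → ν D ≤ ENNReal.ofReal c * μ D)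
    {D : Set Ω} (hD : MeasurableSet D) {η : ℝ} {s₀ Q I : ℕ}
    (hDm : ∀ j < I, MeasurableSet[m] (T^[s₀ + j * Q] ⁻¹' D))
    (h : ∀ θ : ℕ → ℝ, (∀ j, |θ j| ≤ 1) →
      ∫ ω, |∑ j ∈ Finset.range I, θ j * auxG T μ D (s₀ + j * Q) ω| ∂μ ≤ I * η) :
    ∑ j ∈ Finset.range I, |ν.real (T^[s₀ + j * Q] ⁻¹' D) - μ.real D * ν.real Set.univ|
      ≤ c * (I * η) := by
  have hGint : ∀ s, Integrable (auxG T μ D s) ν := by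
    intro s
    refine Integrable.of_bound (auxG_meas D s ((hT.measurable.iterate s) hD)).aestronglyMeasurable 1
      (Filter.Eventually.of_forall fun ω => by simpa using auxG_abs D s ω)
  have hGi : ∀ s, ∫ ω, auxG T μ D s ω ∂ν = ν.real (T^[s] ⁻¹' D) - μ.real D * ν.real Set.univ := by
    intro s
    have hms : MeasurableSet (T^[s] ⁻¹' D) := (hT.measurable.iterate s) hD
    unfold auxG
    rw [integral_sub ((integrable_const _).indicator hms) (integrable_const _),
      integral_indicator hms]
    simp [mul_comm]
  set θ : ℕ → ℝ := fun j => SignType.sign (ν.real (T^[s₀ + j * Q] ⁻¹' D) - μ.real D * ν.real Set.univ)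
  have hθ : ∀ j, |θ j| ≤ 1 := by
    intro j
    simp only [θ]
    generalize SignType.sign (ν.real (T^[s₀ + j * Q] ⁻¹' D) - μ.real D * ν.real Set.univ) = σ
    cases σ <;> simp
  set H : Ω → ℝ := fun ω => ∑ j ∈ Finset.range I, θ j * auxG T μ D (s₀ + j * Q) ω with hH
  have hHm : Measurable[m] H := by
    rw [hH]
    refine Finset.measurable_sum _ fun j hj => ?_
    exact (auxG_meas D _ (hDm j (Finset.mem_range.1 hj))).const_mul _
  have e1 : ∑ j ∈ Finset.range I, |ν.real (T^[s₀ + j * Q] ⁻¹' D) - μ.real D * ν.real Set.univ|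
      = ∫ ω, H ω ∂ν := by
    rw [hH, integral_finsetSum _ fun j _ => (hGint _).const_mul _]
    refine Finset.sum_congr rfl fun j _ => ?_
    rw [integral_const_mul, hGi]
    exact (sign_mul_self _).symm
  rw [e1]
  have hHm0 : Measurable H := hHm.mono hm le_rfl
  have e2 : ∫⁻ ω, ENNReal.ofReal |H ω| ∂ν ≤ ENNReal.ofReal c * ∫⁻ ω, ENNReal.ofReal |H ω| ∂μ :=
    aux_lintegral_le_of_sub hm ν μ _ hν _ (by
      have : Measurable[m] (fun ω => |H ω|) := by
        exact measurable_abs.comp hHm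
      exact ENNReal.measurable_ofReal.comp this)
  have hHμ : Integrable (fun ω => |H ω|) μ := by
    apply Integrable.abs
    exact integrable_finsetSum _ fun j _ => (auxG_integrable hT hD _).const_mul _
  calc ∫ ω, H ω ∂ν ≤ ∫ ω, |H ω| ∂ν := (le_abs_self _).trans abs_integral_le_integral_abs
    _ = (∫⁻ ω, ENNReal.ofReal |H ω| ∂ν).toReal :=
      integral_eq_lintegral_of_nonneg_ae (Filter.Eventually.of_forall fun _ => abs_nonneg _)
        hHm0.abs.aestronglyMeasurable
    _ ≤ (ENNReal.ofReal c * ∫⁻ ω, ENNReal.ofReal |H ω| ∂μ).toReal := by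
      refine ENNReal.toReal_mono ?_ e2
      refine ENNReal.mul_ne_top ENNReal.ofReal_ne_top ?_
      exact (hHμ.lintegral_lt_top).ne
    _ = c * ∫ ω, |H ω| ∂μ := by
      rw [ENNReal.toReal_mul, ENNReal.toReal_ofReal hc,
        integral_eq_lintegral_of_nonneg_ae (Filter.Eventually.of_forall fun _ => abs_nonneg _)
        hHm0.abs.aestronglyMeasurable]
    _ ≤ _ := mul_le_mul_of_nonneg_left (h θ hθ) hc

end decor

section bradley
variable {Ω : Type*} [MeasurableSpace Ω] {T : Ω → Ω} {χ : Ω → ℝ} {μ : Measure Ω}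
  [IsProbabilityMeasure μ]

lemma aux_psi_real {r : ℕ} (h : psiCoeff μ T χ r < 1)
    {k : ℕ} (hk : 1 ≤ k) {B C : Set Ω} (hB : MeasurableSet[sigmaIcc T χ 1 k] B)
    (hC : MeasurableSet[sigmaIci T χ (k + r)] C) :
    μ.real (B ∩ C) ≤ 2 * μ.real B * μ.real C := by
  have := ENNReal.toReal_mono (ENNReal.mul_ne_top (ENNReal.mul_ne_top (by simp)
    (measure_ne_top _ _)) (measure_ne_top _ _)) (aux_psi h hk hB hC)
  simpa [ENNReal.toReal_mul, measureReal_def] using this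

lemma aux_sup {r : ℕ} (h : psiCoeff μ T χ r < 1) :
    ∃ S : ℝ, 1 ≤ S ∧ S ≤ 2 ∧
      (∀ (k K : ℕ) (B C : Set Ω), 1 ≤ k → MeasurableSet[sigmaIcc T χ 1 k] B →
        MeasurableSet[sigmaIcc T χ (k + r) K] C →
        μ.real (B ∩ C) ≤ S * (μ.real B * μ.real C)) ∧
      (∀ S' < S, ∃ (k K : ℕ) (B C : Set Ω), 1 ≤ k ∧ MeasurableSet[sigmaIcc T χ 1 k] B ∧
        MeasurableSet[sigmaIcc T χ (k + r) K] C ∧ 0 < μ.real B ∧ 0 < μ.real C ∧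
        S' * (μ.real B * μ.real C) < μ.real (B ∩ C)) := by
  set 𝒮 : Set ℝ := {q | ∃ (k K : ℕ) (B C : Set Ω), 1 ≤ k ∧ MeasurableSet[sigmaIcc T χ 1 k] B ∧
        MeasurableSet[sigmaIcc T χ (k + r) K] C ∧ 0 < μ.real B ∧ 0 < μ.real C ∧
        q = μ.real (B ∩ C) / (μ.real B * μ.real C)} with h𝒮
  have hle : ∀ q ∈ 𝒮, q ≤ 2 := by
    rintro q ⟨k, K, B, C, hk, hB, hC, hB0, hC0, rfl⟩
    rw [div_le_iff₀ (by positivity), ← mul_assoc]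
    exact aux_psi_real h hk hB (aux_sigmaIcc_le_Ici _ _ _ le_rfl C hC)
  have h1 : (1 : ℝ) ∈ 𝒮 := by
    refine ⟨1, 1, Set.univ, Set.univ, le_rfl, MeasurableSet.univ, MeasurableSet.univ, ?_, ?_, ?_⟩
      <;> simp
  have hbdd : BddAbove 𝒮 := ⟨2, hle⟩
  refine ⟨sSup 𝒮, le_csSup hbdd h1, csSup_le ⟨1, h1⟩ hle, ?_, ?_⟩
  · intro k K B C hk hB hC
    rcases eq_or_lt_of_le (measureReal_nonneg (μ := μ) (s := B)) with hB0 | hB0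
    · have : μ.real (B ∩ C) ≤ μ.real B := measureReal_mono Set.inter_subset_left
      rw [← hB0] at this ⊢
      simpa using this
    rcases eq_or_lt_of_le (measureReal_nonneg (μ := μ) (s := C)) with hC0 | hC0
    · have : μ.real (B ∩ C) ≤ μ.real C := measureReal_mono Set.inter_subset_right
      rw [← hC0] at this ⊢
      simpa using this
    rw [← div_le_iff₀ (by positivity)]
    exact le_csSup hbdd ⟨k, K, B, C, hk, hB, hC, hB0, hC0, rfl⟩
  · intro S' hS'
    obtain ⟨q, ⟨k, K, B, C, hk, hB, hC, hB0, hC0, rfl⟩, hq⟩ := exists_lt_of_lt_csSup ⟨1, h1⟩ hS'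
    rw [lt_div_iff₀ (by positivity)] at hq
    exact ⟨k, K, B, C, hk, hB, hC, hB0, hC0, hq⟩

set_option maxHeartbeats 1000000 in
lemma aux_bradley (hT : MeasurePreserving T μ μ) (hχ : Measurable χ)
    (hmix : ∀ A B : Set Ω, MeasurableSet A → MeasurableSet B →
      Tendsto (fun n => μ (A ∩ T^[n] ⁻¹' B)) atTop (𝓝 (μ A * μ B)))
    {r : ℕ} (h : psiCoeff μ T χ r < 1) {ε : ℝ} (hε : 0 < ε) :
    ∃ R : ℕ, ∀ t ≥ R, ∀ x : ℝ, μ.real ({ω | x < χ ω} ∩ {ω | x < χ (T^[t] ω)})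
      ≤ (1 + ε) * μ.real {ω | x < χ ω} ^ 2 := by
  obtain ⟨S, hS1, hS2, hSle, hSex⟩ := aux_sup h
  obtain ⟨k, K, B, C, hk, hB, hC, hB0, hC0, hBC⟩ := hSex (S / (1 + ε / 2))
    (div_lt_self (by linarith) (by linarith))
  have hsle := fun J K => aux_sigmaIcc_le hT.measurable hχ J K
  have hB' := hsle _ _ B hB
  have hC' := hsle _ _ C hC
  set β := μ.real B with hβ
  set c := μ.real C with hc
  have hβ1 : β ≤ 1 := measureReal_le_one
  have hc1 : c ≤ 1 := measureReal_le_one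
  set e : ℝ := β * c * (ε / 2) / (1 + ε / 2) / 7 with he
  have he0 : 0 < e := by positivity
  have he1 : e ≤ 1 := by
    rw [he, div_div, div_le_iff₀ (by positivity)]
    have : β * c ≤ 1 := mul_le_one₀ hβ1 hC0.le hc1
    nlinarith
  have hη : 0 < e / 8 := by positivity
  obtain ⟨Q1, I1, h1⟩ := aux_decor hT hmix hB' hη
  obtain ⟨Q2, I2, h2⟩ := aux_decor hT hmix hC' hη
  obtain ⟨Q3, I3, h3⟩ := aux_decor hT hmix (hB'.inter hC') hη
  set Q := Q1 + Q2 + Q3 with hQ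
  set I := I1 + I2 + I3 + 1 with hI
  have h1 := h1 Q (by omega) I (by omega) r
  have h2 := h2 Q (by omega) I (by omega) r
  have h3 := h3 Q (by omega) I (by omega) r
  refine ⟨r + I * Q + K + k + r + 1, fun t ht x => ?_⟩
  set A : Set Ω := {ω | x < χ ω} with hA
  set At : Set Ω := {ω | x < χ (T^[t] ω)} with hAt
  have hAm : MeasurableSet[sigmaIcc T χ 1 1] A := aux_sigmaIcc_A 0 x
  have hAtm : MeasurableSet[sigmaIcc T χ (t + 1) (t + 1)] At := aux_sigmaIcc_A t x
  have hA' := hsle _ _ A hAm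
  have hAt' := hsle _ _ At hAtm
  have hpAt : μ At = μ A := (hT.iterate t).measure_preimage hA'.nullMeasurableSet
  have hpAtr : μ.real At = μ.real A := by rw [measureReal_def, hpAt, measureReal_def]
  set p := μ.real A with hp
  rcases eq_or_lt_of_le (measureReal_nonneg (μ := μ) (s := A)) with hp0 | hp0
  · have : μ.real (A ∩ At) ≤ μ.real A := measureReal_mono Set.inter_subset_left
    rw [← hp0] at this
    exact this.trans (by positivity)
  change 0 < p at hp0
  have hmle := hsle (r + 1) (t + 1 - r)
  have hpA : μ A = ENNReal.ofReal p := by rw [hp, ofReal_measureReal]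
  have hmIcc : sigmaIcc T χ (r + 1) (t + 1 - r) ≤ sigmaIcc T χ 1 (t + 1 - r) := aux_sigmaIcc_mono (by omega) le_rfl
  have n1 : ∀ D, MeasurableSet[sigmaIcc T χ (r + 1) (t + 1 - r)] D → μ.restrict A D ≤ ENNReal.ofReal (2 * p) * μ D := by
    intro D hD
    rw [Measure.restrict_apply (hmle D hD), Set.inter_comm, ENNReal.ofReal_mul (by norm_num),
      ← hpA]
    simpa using aux_psi h le_rfl hAm (aux_sigmaIcc_le_Ici _ _ _ (by omega) D hD)
  have n2' : ∀ D, MeasurableSet[sigmaIcc T χ 1 (t + 1 - r)] D →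
      μ (D ∩ At) ≤ ENNReal.ofReal (2 * p) * μ D := by
    intro D hD
    have := aux_psi h (k := t + 1 - r) (by omega) hD
      (aux_sigmaIcc_le_Ici _ _ _ (by omega) At hAtm)
    rw [ENNReal.ofReal_mul (by norm_num), ← hpA, ← hpAt]
    refine this.trans (le_of_eq ?_)
    simp; ring
  have n2 : ∀ D, MeasurableSet[sigmaIcc T χ (r + 1) (t + 1 - r)] D → μ.restrict At D ≤ ENNReal.ofReal (2 * p) * μ D := by
    intro D hD
    rw [Measure.restrict_apply (hmle D hD)]
    exact n2' D (hmIcc D hD)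
  have n3 : ∀ D, MeasurableSet[sigmaIcc T χ (r + 1) (t + 1 - r)] D → μ.restrict (A ∩ At) D
      ≤ ENNReal.ofReal (2 * p * (2 * p)) * μ D := by
    intro D hD
    rw [Measure.restrict_apply (hmle D hD), ← Set.inter_assoc, ENNReal.ofReal_mul (by positivity),
      mul_assoc]
    refine (n2' (D ∩ A) ?_).trans ?_
    · exact MeasurableSet.inter (hmIcc D hD)
        (aux_sigmaIcc_mono le_rfl (by omega) A hAm)
    · gcongr
      have := n1 D hD
      rwa [Measure.restrict_apply (hmle D hD)] at this
  have hjQ : ∀ j < I, j * Q ≤ I * Q := fun j hj => Nat.mul_le_mul_right _ hj.le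
  have mB : ∀ j < I, MeasurableSet[sigmaIcc T χ (r + 1) (t + 1 - r)] (T^[r + j * Q] ⁻¹' B) := fun j hj =>
    aux_sigmaIcc_mono (by omega) (by have := hjQ j hj; omega) _
      (aux_sigmaIcc_preimage (r + j * Q) le_rfl hB)
  have mC : ∀ j < I, MeasurableSet[sigmaIcc T χ (r + 1) (t + 1 - r)] (T^[r + j * Q] ⁻¹' C) := fun j hj =>
    aux_sigmaIcc_mono (by omega) (by have := hjQ j hj; omega) _
      (aux_sigmaIcc_preimage (r + j * Q) (by omega) hC)
  have s1 := aux_decor2 hT hmle (μ.restrict A) (2 * p) (by positivity) n1 hB' mB h1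
  have s2 := aux_decor2 hT hmle (μ.restrict At) (2 * p) (by positivity) n2 hC' mC h2
  have s3 := aux_decor2 hT hmle (μ.restrict (A ∩ At)) (2 * p * (2 * p)) (by positivity) n3
    (hB'.inter hC') (fun j hj => by
      rw [Set.preimage_inter]; exact MeasurableSet.inter (mB j hj) (mC j hj)) h3
  simp only [measureReal_restrict_apply_univ, hpAtr, ← hp, ← hβ, ← hc] at s1 s2 s3
  set E1 := fun j => |(μ.restrict A).real (T^[r + j * Q] ⁻¹' B) - β * p| with hE1
  set E2 := fun j => |(μ.restrict At).real (T^[r + j * Q] ⁻¹' C) - c * p| with hE2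
  set E3 := fun j => |(μ.restrict (A ∩ At)).real (T^[r + j * Q] ⁻¹' (B ∩ C))
    - μ.real (B ∩ C) * μ.real (A ∩ At)| with hE3
  have hsum : ∑ j ∈ Finset.range I, (p * E1 j + p * E2 j + E3 j)
      ≤ ∑ j ∈ Finset.range I, p ^ 2 * e := by
    rw [Finset.sum_add_distrib, Finset.sum_add_distrib, ← Finset.mul_sum, ← Finset.mul_sum]
    simp only [Finset.sum_const, Finset.card_range, nsmul_eq_mul]
    have t1 := mul_le_mul_of_nonneg_left s1 hp0.le
    have t2 := mul_le_mul_of_nonneg_left s2 hp0.le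
    calc _ ≤ _ := add_le_add (add_le_add t1 t2) s3
      _ = I * (p ^ 2 * e) := by ring
  obtain ⟨j, hj, hjle⟩ := Finset.exists_le_of_sum_le (by rw [Finset.nonempty_range_iff]; omega) hsum
  rw [Finset.mem_range] at hj
  have z1 : 0 ≤ E1 j := abs_nonneg _
  have z2 : 0 ≤ E2 j := abs_nonneg _
  have z3 : 0 ≤ E3 j := abs_nonneg _
  have y1 : E1 j ≤ p * e := by nlinarith [mul_nonneg hp0.le z2, mul_nonneg hp0.le z1]
  have y2 : E2 j ≤ p * e := by nlinarith [mul_nonneg hp0.le z2, mul_nonneg hp0.le z1]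
  have y3 : E3 j ≤ p ^ 2 * e := by nlinarith [mul_nonneg hp0.le z2, mul_nonneg hp0.le z1]
  have y1 := (abs_le.1 y1).2
  have y2 := (abs_le.1 y2).2
  have y3 := (abs_le.1 y3).1
  set s := r + j * Q with hs
  have hsm : ∀ D, MeasurableSet[sigmaIcc T χ (r + 1) (t + 1 - r)] D → MeasurableSet D := fun D hD => hmle D hD
  rw [measureReal_restrict_apply (hsm _ (mB j hj))] at y1
  rw [measureReal_restrict_apply (hsm _ (mC j hj))] at y2
  rw [Set.preimage_inter, measureReal_restrict_apply ((hsm _ (mB j hj)).inter (hsm _ (mC j hj)))] at y3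
  have hS := hSle (k + s) (t + 1) (T^[s] ⁻¹' B ∩ A) (T^[s] ⁻¹' C ∩ At) (by omega)
    (MeasurableSet.inter (aux_sigmaIcc_mono (by omega) le_rfl _ (aux_sigmaIcc_preimage s le_rfl hB))
      (aux_sigmaIcc_mono le_rfl (by omega) A hAm))
    (MeasurableSet.inter (aux_sigmaIcc_mono (by omega) (by have := hjQ j hj; omega) _
      (aux_sigmaIcc_preimage s (by omega) hC))
      (aux_sigmaIcc_mono (by have := hjQ j hj; omega) le_rfl At hAtm))
  have eset : (T^[s] ⁻¹' B ∩ A) ∩ (T^[s] ⁻¹' C ∩ At) = T^[s] ⁻¹' B ∩ T^[s] ⁻¹' C ∩ (A ∩ At) := by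
    ext ω; simp only [Set.mem_inter_iff]; tauto
  rw [eset] at hS
  set P1 := μ.real (T^[s] ⁻¹' B ∩ A)
  set P2 := μ.real (T^[s] ⁻¹' C ∩ At)
  set G := μ.real (T^[s] ⁻¹' B ∩ T^[s] ⁻¹' C ∩ (A ∩ At))
  have w1 : P1 ≤ p * (β + e) := by linarith
  have w2 : P2 ≤ p * (c + e) := by linarith
  have w3 : μ.real (B ∩ C) * μ.real (A ∩ At) ≤ S * (p * (β + e) * (p * (c + e))) + p ^ 2 * e := by
    have : P1 * P2 ≤ (p * (β + e) * (p * (c + e))) :=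
      mul_le_mul w1 w2 measureReal_nonneg (by positivity)
    have := mul_le_mul_of_nonneg_left this (zero_le_one.trans hS1)
    linarith
  have w4 : S * (p * (β + e) * (p * (c + e))) + p ^ 2 * e ≤ p ^ 2 * (S * (β * c) + 7 * e) := by
    have : S * ((β + e) * (c + e)) + e ≤ S * (β * c) + 7 * e := by
      have a1 : S * (β * e) ≤ 2 * (1 * e) := by gcongr
      have a2 : S * (e * c) ≤ 2 * (e * 1) := by gcongr
      have a3 : S * (e * e) ≤ 2 * (e * 1) := by gcongr
      nlinarith
    calc _ = p ^ 2 * (S * ((β + e) * (c + e)) + e) := by ring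
      _ ≤ _ := by gcongr
  have w5 : S * (β * c) + 7 * e ≤ S * (β * c) * ((1 + ε) / (1 + ε / 2)) := by
    have : 7 * e = β * c * ((ε / 2) / (1 + ε / 2)) := by rw [he]; field_simp
    rw [this]
    have h' : (1 + ε) / (1 + ε / 2) = 1 + (ε / 2) / (1 + ε / 2) := by field_simp; ring
    rw [h', mul_add, mul_one]
    refine add_le_add le_rfl (mul_le_mul_of_nonneg_right ?_ (by positivity))
    exact le_mul_of_one_le_left (by positivity) hS1
  have w6 : S / (1 + ε / 2) * (β * c) * μ.real (A ∩ At) ≤ μ.real (B ∩ C) * μ.real (A ∩ At) :=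
    mul_le_mul_of_nonneg_right hBC.le measureReal_nonneg
  have w7 : S / (1 + ε / 2) * (β * c) * μ.real (A ∩ At)
      ≤ S / (1 + ε / 2) * (β * c) * ((1 + ε) * p ^ 2) := by
    calc _ ≤ p ^ 2 * (S * (β * c) + 7 * e) := w6.trans (w3.trans w4)
      _ ≤ p ^ 2 * (S * (β * c) * ((1 + ε) / (1 + ε / 2))) := by gcongr
      _ = _ := by ring
  exact le_of_mul_le_mul_left w7 (by positivity)

end bradley

section counts
variable {Ω : Type*} [MeasurableSpace Ω] {T : Ω → Ω} {χ : Ω → ℝ} {μ : Measure Ω}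

/-- number of exceedances of level `x` -/
noncomputable def auxN (T : Ω → Ω) (χ : Ω → ℝ) (n : ℕ) (x : ℝ) (ω : Ω) : ℕ :=
  ∑ k ∈ Finset.range n, if x < χ (T^[k] ω) then 1 else 0

/-- exceedances along an arithmetic progression -/
noncomputable def auxM (T : Ω → Ω) (χ : Ω → ℝ) (r i n : ℕ) (x : ℝ) (ω : Ω) : ℕ :=
  ∑ j ∈ Finset.range n, if x < χ (T^[r + (r * j + i)] ω) then 1 else 0

lemma auxM_meas {r : ℕ} (hr : 1 ≤ r) (i n : ℕ) (x : ℝ) :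
    Measurable[sigmaIcc T χ 1 (r * n + i + 1)] (auxM T χ r i n x) := by
  unfold auxM
  refine Finset.measurable_sum _ fun j hj => ?_
  rw [Finset.mem_range] at hj
  refine Measurable.ite ?_ measurable_const measurable_const
  refine aux_sigmaIcc_mono (by omega) ?_ _ (aux_sigmaIcc_A (r + (r * j + i)) x)
  have : r * (j + 1) ≤ r * n := Nat.mul_le_mul_left _ hj
  rw [mul_add] at this
  omega

lemma aux_choose_moment [IsProbabilityMeasure μ] (hT : MeasurePreserving T μ μ)
    (hχ : Measurable χ) {r : ℕ} (hr : 1 ≤ r)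
    (h : psiCoeff μ T χ r < 1) (i : ℕ) (x : ℝ) (n m : ℕ) :
    ∫⁻ ω, ((Nat.choose (auxM T χ r i n x ω) m : ℕ) : ℝ≥0∞) ∂μ
      ≤ (Nat.choose n m : ℕ) * (2 * μ {ω | x < χ ω}) ^ m := by
  induction n generalizing m with
  | zero =>
    cases m with
    | zero => simp
    | succ m => simp [auxM]
  | succ n ih =>
    cases m with
    | zero => simp
    | succ m =>
      set A' : Set Ω := {ω | x < χ (T^[r + (r * n + i)] ω)} with hA'
      have hA'm : MeasurableSet[sigmaIcc T χ (r + (r * n + i) + 1) (r + (r * n + i) + 1)] A' :=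
        aux_sigmaIcc_A _ x
      have hA'm0 := aux_sigmaIcc_le hT.measurable hχ _ _ A' hA'm
      have hA'p : μ A' = μ {ω | x < χ ω} :=
        (hT.iterate _).measure_preimage (measurableSet_lt measurable_const hχ).nullMeasurableSet
      have hsle := aux_sigmaIcc_le hT.measurable hχ 1 (r * n + i + 1)
      have hMm : ∀ q : ℕ, Measurable[sigmaIcc T χ 1 (r * n + i + 1)]
          (fun ω => ((Nat.choose (auxM T χ r i n x ω) q : ℕ) : ℝ≥0∞)) := fun q =>
        (measurable_from_nat (f := fun a : ℕ => ((Nat.choose a q : ℕ) : ℝ≥0∞))).comp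
          (auxM_meas hr i n x)
      have e : ∀ ω, ((Nat.choose (auxM T χ r i (n + 1) x ω) (m + 1) : ℕ) : ℝ≥0∞)
          = ((Nat.choose (auxM T χ r i n x ω) (m + 1) : ℕ) : ℝ≥0∞)
            + A'.indicator (fun ω => ((Nat.choose (auxM T χ r i n x ω) m : ℕ) : ℝ≥0∞)) ω := by
        intro ω
        have : auxM T χ r i (n + 1) x ω = auxM T χ r i n x ω
          + if x < χ (T^[r + (r * n + i)] ω) then 1 else 0 := by
          unfold auxM; rw [Finset.sum_range_succ]
        rw [this]
        by_cases hω : x < χ (T^[r + (r * n + i)] ω)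
        · have hω' : ω ∈ A' := hω
          rw [Set.indicator_of_mem hω', if_pos hω, Nat.choose_succ_succ]
          push_cast
          ring
        · have hω' : ω ∉ A' := hω
          rw [Set.indicator_of_notMem hω', if_neg hω]
          simp
      simp_rw [e]
      rw [lintegral_add_left ((hMm _).mono hsle le_rfl), lintegral_indicator hA'm0]
      have key : ∫⁻ ω in A', ((Nat.choose (auxM T χ r i n x ω) m : ℕ) : ℝ≥0∞) ∂μ
          ≤ (2 * μ {ω | x < χ ω}) *
            ∫⁻ ω, ((Nat.choose (auxM T χ r i n x ω) m : ℕ) : ℝ≥0∞) ∂μ := by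
        refine aux_lintegral_le_of_sub hsle _ _ _ (fun D hD => ?_) _ (hMm m)
        rw [Measure.restrict_apply (hsle D hD), ← hA'p]
        have := aux_psi h (by omega) hD (aux_sigmaIcc_le_Ici _ _ _ (by omega) A' hA'm)
        refine this.trans (le_of_eq (by ring))
      calc _ ≤ (Nat.choose n (m + 1) : ℕ) * (2 * μ {ω | x < χ ω}) ^ (m + 1) +
            (2 * μ {ω | x < χ ω}) * ((Nat.choose n m : ℕ) * (2 * μ {ω | x < χ ω}) ^ m) := by
            gcongr
            · exact ih (m + 1)
            · exact key.trans (by gcongr; exact ih m)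
        _ = _ := by
            rw [Nat.choose_succ_succ]
            push_cast
            ring

lemma aux_N_le_M {r : ℕ} (hr : 1 ≤ r) (n : ℕ) (x : ℝ) (ω : Ω) :
    auxN T χ n x (T^[r] ω) ≤ ∑ i ∈ Finset.range r, auxM T χ r i n x ω := by
  unfold auxN auxM
  rw [← Finset.sum_product']
  set f : ℕ × ℕ → ℕ := fun q => if x < χ (T^[r + (r * q.2 + q.1)] ω) then 1 else 0 with hf
  have hinj : Set.InjOn (fun k : ℕ => (k % r, k / r)) (Finset.range n : Set ℕ) := by
    intro a _ b _ hab
    simp only [Prod.mk.injEq] at hab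
    rw [← Nat.div_add_mod a r, ← Nat.div_add_mod b r, hab.1, hab.2]
  calc _ = ∑ k ∈ Finset.range n, f (k % r, k / r) := by
        refine Finset.sum_congr rfl fun k _ => ?_
        simp only [hf]
        rw [Nat.div_add_mod, ← Function.iterate_add_apply, add_comm r k]
    _ = ∑ q ∈ (Finset.range n).image (fun k : ℕ => (k % r, k / r)), f q :=
        (Finset.sum_image hinj).symm
    _ ≤ _ := by
        refine Finset.sum_le_sum_of_subset ?_
        intro q hq
        obtain ⟨k, hk, rfl⟩ := Finset.mem_image.1 hq
        rw [Finset.mem_range] at hk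
        simp only [Finset.mem_product, Finset.mem_range]
        exact ⟨Nat.mod_lt _ hr, (Nat.div_le_self k r).trans_lt hk⟩

lemma aux_choose_bound (M m : ℕ) (hm : 1 ≤ m) (b' : ℝ) (hb : 2 * m ≤ b') :
    (M : ℝ) - b' ≤ 2 ^ m * m.factorial * (Nat.choose M m : ℕ) / b' ^ (m - 1) := by
  have hm' : (1 : ℝ) ≤ m := by exact_mod_cast hm
  have hb0 : 0 < b' := by linarith
  rcases le_or_gt (M : ℝ) b' with h | h
  · have : 0 ≤ 2 ^ m * m.factorial * (Nat.choose M m : ℕ) / b' ^ (m - 1) := by positivity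
    linarith
  have h2 : (2 * m : ℝ) ≤ M := hb.trans h.le
  have h3 : 2 * m ≤ M := by exact_mod_cast h2
  have h4 : ((M : ℝ) / 2) ^ m ≤ m.factorial * (Nat.choose M m : ℕ) := by
    have := Nat.pow_sub_le_descFactorial M m
    rw [Nat.descFactorial_eq_factorial_mul_choose] at this
    have h5 : ((M + 1 - m : ℕ) : ℝ) ^ m ≤ m.factorial * (Nat.choose M m : ℕ) := by exact_mod_cast this
    refine le_trans ?_ h5
    refine pow_le_pow_left₀ (by positivity) ?_ m
    rw [Nat.cast_sub (by omega)]
    push_cast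
    linarith
  have h6 : (M : ℝ) * b' ^ (m - 1) ≤ (M : ℝ) ^ m := by
    calc _ ≤ (M : ℝ) * M ^ (m - 1) := by gcongr
      _ = M ^ m := by rw [← pow_succ', Nat.sub_add_cancel hm]
  rw [le_div_iff₀ (by positivity)]
  calc ((M : ℝ) - b') * b' ^ (m - 1) ≤ M * b' ^ (m - 1) := by gcongr; linarith
    _ ≤ M ^ m := h6
    _ = 2 ^ m * (M / 2 : ℝ) ^ m := by rw [div_pow]; field_simp
    _ ≤ 2 ^ m * (m.factorial * (Nat.choose M m : ℕ)) := by gcongr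
    _ = _ := by ring

lemma auxN_meas (hT : Measurable T) (hχ : Measurable χ) (n : ℕ) (x : ℝ) :
    Measurable (auxN T χ n x) := by
  unfold auxN
  refine Finset.measurable_sum _ fun j _ => ?_
  exact Measurable.ite (measurableSet_lt measurable_const (hχ.comp (hT.iterate j)))
    measurable_const measurable_const

lemma aux_moment [IsProbabilityMeasure μ] (hT : MeasurePreserving T μ μ)
    (hχ : Measurable χ) {r : ℕ} (hr : 1 ≤ r)
    (h : psiCoeff μ T χ r < 1) (m : ℕ) (hm : 1 ≤ m) :
    ∃ K : ℝ, 0 ≤ K ∧ ∀ (n b : ℕ) (x : ℝ), 2 * m * r ≤ b →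
      ∫⁻ ω, ENNReal.ofReal (((auxN T χ n x ω - b : ℕ) : ℝ) / b) ∂μ
        ≤ ENNReal.ofReal (K * (n * μ.real {ω | x < χ ω} / b) ^ m) := by
  refine ⟨r * (2 ^ m * m.factorial * r ^ (m - 1)) * 2 ^ m, by positivity, fun n b x hb => ?_⟩
  set p := μ.real {ω | x < χ ω} with hp
  have hr' : (1 : ℝ) ≤ r := by exact_mod_cast hr
  have hb0 : 0 < b := by
    have : 0 < 2 * m * r := by positivity
    omega
  have hb0' : (0 : ℝ) < b := by exact_mod_cast hb0
  have hmeas : Measurable (fun ω => ENNReal.ofReal (((auxN T χ n x ω - b : ℕ) : ℝ) / b)) :=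
    (measurable_from_nat (f := fun a : ℕ => ENNReal.ofReal (((a - b : ℕ) : ℝ) / b))).comp
      (auxN_meas hT.measurable hχ n x)
  rw [← (hT.iterate r).lintegral_comp hmeas]
  set c : ℝ := 2 ^ m * m.factorial * r ^ (m - 1) / b ^ m with hc
  have hc0 : 0 ≤ c := by positivity
  have hpt : ∀ ω, ENNReal.ofReal (((auxN T χ n x (T^[r] ω) - b : ℕ) : ℝ) / b)
      ≤ ∑ i ∈ Finset.range r, ENNReal.ofReal c * ((Nat.choose (auxM T χ r i n x ω) m : ℕ) : ℝ≥0∞) := by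
    intro ω
    have e : ∑ i ∈ Finset.range r, ENNReal.ofReal c * ((Nat.choose (auxM T χ r i n x ω) m : ℕ) : ℝ≥0∞)
        = ENNReal.ofReal (∑ i ∈ Finset.range r, c * ((Nat.choose (auxM T χ r i n x ω) m : ℕ) : ℝ)) := by
      rw [ENNReal.ofReal_sum_of_nonneg (fun i _ => by positivity)]
      refine Finset.sum_congr rfl fun i _ => ?_
      rw [ENNReal.ofReal_mul hc0, ENNReal.ofReal_natCast]
    rw [e]
    refine ENNReal.ofReal_le_ofReal ?_
    rcases le_total (auxN T χ n x (T^[r] ω)) b with hNb | hNb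
    · rw [Nat.sub_eq_zero_of_le hNb]
      simp only [Nat.cast_zero, zero_div]
      positivity
    rw [Nat.cast_sub hNb]
    have hle : ((auxN T χ n x (T^[r] ω) : ℕ) : ℝ) ≤ ∑ i ∈ Finset.range r, (auxM T χ r i n x ω : ℝ) := by
      exact_mod_cast aux_N_le_M hr n x ω
    have hbr : (2 * m : ℝ) ≤ b / r := by
      rw [le_div_iff₀ (by positivity)]
      exact_mod_cast hb
    have hs : ∑ i ∈ Finset.range r, ((auxM T χ r i n x ω : ℝ) - b / r)
        ≤ ∑ i ∈ Finset.range r, 2 ^ m * m.factorial *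
          (Nat.choose (auxM T χ r i n x ω) m : ℕ) / (b / r : ℝ) ^ (m - 1) :=
      Finset.sum_le_sum fun i _ => aux_choose_bound _ m hm _ hbr
    rw [Finset.sum_sub_distrib] at hs
    simp only [Finset.sum_const, Finset.card_range, nsmul_eq_mul] at hs
    rw [mul_div_cancel₀ _ (by positivity : (r : ℝ) ≠ 0)] at hs
    rw [div_le_iff₀ hb0', Finset.sum_mul]
    refine (by linarith : _ ≤ _).trans (hs.trans (le_of_eq ?_))
    refine Finset.sum_congr rfl fun i _ => ?_
    rw [hc, div_pow]
    obtain ⟨q, rfl⟩ : ∃ q, m = q + 1 := ⟨m - 1, by omega⟩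
    simp only [Nat.add_sub_cancel]
    rw [pow_succ (b : ℝ)]
    field_simp
  refine (lintegral_mono hpt).trans ?_
  have hMm : ∀ i, Measurable (fun ω => ENNReal.ofReal c * ((Nat.choose (auxM T χ r i n x ω) m : ℕ) : ℝ≥0∞)) := by
    intro i
    refine Measurable.const_mul ?_ _
    exact (measurable_from_nat (f := fun a : ℕ => ((Nat.choose a m : ℕ) : ℝ≥0∞))).comp
          ((auxM_meas hr i n x).mono (aux_sigmaIcc_le hT.measurable hχ _ _) le_rfl)
  rw [lintegral_finsetSum _ fun i _ => hMm i]
  calc _ ≤ ∑ i ∈ Finset.range r, ENNReal.ofReal (c * (n ^ m * (2 * p) ^ m)) := by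
        refine Finset.sum_le_sum fun i _ => ?_
        rw [lintegral_const_mul' _ _ ENNReal.ofReal_ne_top, ENNReal.ofReal_mul hc0]
        gcongr
        refine (aux_choose_moment hT hχ hr h i x n m).trans ?_
        rw [ENNReal.ofReal_mul (by positivity), ENNReal.ofReal_pow (by positivity),
          ENNReal.ofReal_pow (by positivity), ENNReal.ofReal_mul (by norm_num), hp,
          ofReal_measureReal, ENNReal.ofReal_natCast]
        simp only [ENNReal.ofReal_ofNat]
        gcongr
        exact_mod_cast Nat.choose_le_pow n m
    _ = ENNReal.ofReal (r * (c * (n ^ m * (2 * p) ^ m))) := by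
        simp only [Finset.sum_const, Finset.card_range, nsmul_eq_mul]
        rw [ENNReal.ofReal_mul (by positivity : (0:ℝ) ≤ r), ENNReal.ofReal_natCast]
    _ = _ := by
        congr 1
        rw [hc, div_pow, mul_pow, mul_pow]
        field_simp

lemma aux_var [IsProbabilityMeasure μ] (hT : MeasurePreserving T μ μ)
    (hχ : Measurable χ) {ε : ℝ} {R : ℕ}
    (hR : ∀ t ≥ R, ∀ x : ℝ, μ.real ({ω | x < χ ω} ∩ {ω | x < χ (T^[t] ω)})
      ≤ (1 + ε) * μ.real {ω | x < χ ω} ^ 2) (hε : 0 ≤ ε) (n : ℕ) (x : ℝ) :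
    (∫ ω, |(auxN T χ n x ω : ℝ) - n * μ.real {ω | x < χ ω}| ∂μ) ^ 2
      ≤ 2 * R * (n * μ.real {ω | x < χ ω}) + ε * (n * μ.real {ω | x < χ ω}) ^ 2 := by
  set A : Set Ω := {ω | x < χ ω} with hA
  have hAm : MeasurableSet A := measurableSet_lt measurable_const hχ
  set p := μ.real A with hp
  have hp0 : 0 ≤ p := measureReal_nonneg
  have e0 : ∀ ω, (auxN T χ n x ω : ℝ) - n * p = ∑ k ∈ Finset.range n, auxG T μ A k ω := by
    intro ω
    unfold auxN auxG
    rw [Finset.sum_sub_distrib]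
    simp only [Finset.sum_const, Finset.card_range, nsmul_eq_mul]
    push_cast
    congr 1
  simp_rw [e0]
  set H : Ω → ℝ := fun ω => ∑ k ∈ Finset.range n, auxG T μ A k ω with hH
  have hGm : ∀ s, Measurable (auxG T μ A s) := fun s =>
    auxG_meas A s ((hT.measurable.iterate s) hAm)
  have hcov : ∀ i j, ∫ ω, auxG T μ A i ω * auxG T μ A j ω ∂μ
      ≤ (if j ∈ Finset.Ico (i - R) (i + R) then p else 0) + ε * p ^ 2 := by
    have key : ∀ i t, ∫ ω, auxG T μ A i ω * auxG T μ A (i + t) ω ∂μ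
        ≤ (if t < R then p else 0) + ε * p ^ 2 := by
      intro i t
      rw [auxG_cov hT hAm]
      split_ifs with ht
      · have : μ.real (A ∩ T^[t] ⁻¹' A) ≤ p := measureReal_mono Set.inter_subset_left
        have : 0 ≤ ε * p ^ 2 := by positivity
        nlinarith
      · have : μ.real (A ∩ T^[t] ⁻¹' A) ≤ (1 + ε) * p ^ 2 := hR t (by omega) x
        rw [← hp]
        linarith
    intro i j
    rcases le_total i j with hij | hij
    · obtain ⟨t, rfl⟩ := Nat.exists_eq_add_of_le hij
      refine (key i t).trans ?_
      gcongr ?_ + _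
      split_ifs with h1 h2 <;> simp only [Finset.mem_Ico] at * <;> first | exact le_rfl | omega | exact hp0
    · obtain ⟨t, rfl⟩ := Nat.exists_eq_add_of_le hij
      simp_rw [mul_comm (auxG T μ A (j + t) _)]
      refine (key j t).trans ?_
      gcongr ?_ + _
      split_ifs with h1 h2 <;> simp only [Finset.mem_Ico] at * <;> first | exact le_rfl | exact hp0 | skip
      rcases Nat.eq_zero_or_pos R with h | h <;> omega
  have hsq : ∫ ω, H ω ^ 2 ∂μ ≤ 2 * R * (n * p) + ε * (n * p) ^ 2 := by
    have hint : ∀ i j, Integrable (fun ω => auxG T μ A i ω * auxG T μ A j ω) μ := by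
      intro i j
      refine Integrable.of_bound ((hGm _).mul (hGm _)).aestronglyMeasurable 1
        (Filter.Eventually.of_forall fun ω => ?_)
      rw [Real.norm_eq_abs, abs_mul]
      exact mul_le_one₀ (auxG_abs _ _ _) (abs_nonneg _) (auxG_abs _ _ _)
    have e : ∀ ω, H ω ^ 2 = ∑ i ∈ Finset.range n, ∑ j ∈ Finset.range n,
        (auxG T μ A i ω * auxG T μ A j ω) := by
      intro ω
      rw [hH, sq]
      simp only
      rw [Finset.sum_mul_sum]
    simp_rw [e]
    rw [integral_finsetSum _ fun i _ => integrable_finsetSum _ fun j _ => (hint i j)]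
    calc _ ≤ ∑ i ∈ Finset.range n, ∑ j ∈ Finset.range n,
          ((if j ∈ Finset.Ico (i - R) (i + R) then p else 0) + ε * p ^ 2) := by
          refine Finset.sum_le_sum fun i _ => ?_
          rw [integral_finsetSum _ fun j _ => (hint i j)]
          exact Finset.sum_le_sum fun j _ => hcov i j
      _ ≤ ∑ i ∈ Finset.range n, (2 * R * p + n * (ε * p ^ 2)) := by
          refine Finset.sum_le_sum fun i _ => ?_
          rw [Finset.sum_add_distrib]
          simp only [Finset.sum_const, Finset.card_range, nsmul_eq_mul]
          gcongr
          rw [← Finset.sum_filter, Finset.sum_const, nsmul_eq_mul]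
          gcongr
          have : ((Finset.range n).filter (fun j => j ∈ Finset.Ico (i - R) (i + R))).card
              ≤ (Finset.Ico (i - R) (i + R)).card :=
            Finset.card_le_card fun j hj => (Finset.mem_filter.1 hj).2
          rw [Nat.card_Ico] at this
          have h2 : ((Finset.range n).filter (fun j => j ∈ Finset.Ico (i - R) (i + R))).card
              ≤ 2 * R := by omega
          exact_mod_cast h2
      _ = _ := by
          simp only [Finset.sum_const, Finset.card_range, nsmul_eq_mul]
          ring
  have hHm : Measurable H := Finset.measurable_sum _ fun j _ => hGm _
  have hHb : ∀ ω, |H ω| ≤ n := by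
    intro ω
    refine (Finset.abs_sum_le_sum_abs _ _).trans ?_
    calc _ ≤ ∑ j ∈ Finset.range n, (1 : ℝ) := Finset.sum_le_sum fun j _ => auxG_abs _ _ _
      _ = n := by simp
  have hH2 : Integrable (fun ω => H ω ^ 2) μ := by
    refine Integrable.of_bound (hHm.pow_const 2).aestronglyMeasurable ((n:ℝ)^2)
        (Filter.Eventually.of_forall fun ω => ?_)
    rw [Real.norm_eq_abs, abs_pow]
    exact pow_le_pow_left₀ (abs_nonneg _) (hHb ω) 2
  have hH1 : Integrable (fun ω => |H ω|) μ := by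
    refine Integrable.of_bound (hHm.abs).aestronglyMeasurable (n:ℝ)
        (Filter.Eventually.of_forall fun ω => ?_)
    simpa using hHb ω
  set a := ∫ ω, |H ω| ∂μ with ha
  have ha0 : 0 ≤ a := integral_nonneg fun _ => abs_nonneg _
  have : 0 ≤ ∫ ω, (|H ω| - a) ^ 2 ∂μ := integral_nonneg fun _ => sq_nonneg _
  have e2 : ∀ ω, (|H ω| - a) ^ 2 = H ω ^ 2 - (2 * a) * |H ω| + a ^ 2 := by
    intro ω; rw [sub_sq, sq_abs]; ring
  simp_rw [e2] at this
  have hH3 : Integrable (fun ω => H ω ^ 2 - 2 * a * |H ω|) μ := hH2.sub (hH1.const_mul _)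
  rw [integral_add hH3 (integrable_const _),
    integral_sub hH2 (hH1.const_mul _), integral_const_mul] at this
  simp only [integral_const, smul_eq_mul, probReal_univ, one_mul] at this
  rw [← ha] at this
  nlinarith

end counts

section layer

lemma aux_countP_take (x : ℝ) (l : List ℝ) (hl : l.Pairwise (· ≤ ·)) (b : ℕ) :
    (l.take (l.length - b)).countP (fun a => decide (x < a))
      = l.countP (fun a => decide (x < a)) - b := by
  set m := l.length - b with hm
  have h1 : l.countP (fun a => decide (x < a)) = (l.take m).countP (fun a => decide (x < a))
      + (l.drop m).countP (fun a => decide (x < a)) := by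
    rw [← List.countP_append, List.take_append_drop]
  have h2 : (l.drop m).length = l.length - m := List.length_drop
  by_cases h0 : (l.take m).countP (fun a => decide (x < a)) = 0
  · have h3 : (l.drop m).countP (fun a => decide (x < a)) ≤ (l.drop m).length :=
      List.countP_le_length
    omega
  · have hpos : 0 < (l.take m).countP (fun a => decide (x < a)) := Nat.pos_of_ne_zero h0
    rw [List.countP_pos_iff] at hpos
    obtain ⟨a, ha, hxa⟩ := hpos
    have hxa' : x < a := by simpa using hxa
    have h4 : (l.drop m).countP (fun a => decide (x < a)) = (l.drop m).length := by
      rw [List.countP_eq_length]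
      intro c hc
      have hsplit : (l.take m ++ l.drop m).Pairwise (· ≤ ·) := by
        rw [List.take_append_drop]; exact hl
      have := (List.pairwise_append.1 hsplit).2.2 a ha c hc
      simpa using lt_of_lt_of_le hxa' this
    have h5 : 0 < m := by
      rcases Nat.eq_zero_or_pos m with h | h
      · rw [h] at ha; simp at ha
      · exact h
    omega

lemma aux_indicator_int (f : ℝ) (hf : 0 < f) (a : ℝ) (ha : 0 ≤ a) :
    IntegrableOn (fun u : ℝ => if f * u < a then (1:ℝ) else 0) (Set.Ioi 0) ∧
      ∫ u in Set.Ioi (0:ℝ), (if f * u < a then (1:ℝ) else 0) = a / f := by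
  have he : (fun u : ℝ => if f * u < a then (1:ℝ) else 0)
      = (Set.Iio (a / f)).indicator (fun _ => (1:ℝ)) := by
    funext u
    simp only [Set.indicator, Set.mem_Iio, lt_div_iff₀ hf, mul_comm]
  rw [he]
  have hr : (Set.Ioi (0:ℝ)) ∩ Set.Iio (a / f) = Set.Ioo 0 (a / f) := by
    ext; simp
  constructor
  · rw [IntegrableOn, integrable_indicator_iff measurableSet_Iio, IntegrableOn,
      Measure.restrict_restrict measurableSet_Iio, Set.inter_comm, hr]
    exact integrableOn_const (by simp)
  · rw [setIntegral_indicator measurableSet_Iio, hr]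
    simp [div_nonneg ha hf.le]

lemma aux_list_int (f : ℝ) (hf : 0 < f) (l : List ℝ) (hl : ∀ a ∈ l, 0 ≤ a) :
    IntegrableOn (fun u : ℝ => ((l.countP (fun a => decide (f * u < a)) : ℕ) : ℝ)) (Set.Ioi 0) ∧
      ∫ u in Set.Ioi (0:ℝ), ((l.countP (fun a => decide (f * u < a)) : ℕ) : ℝ) = l.sum / f := by
  induction l with
  | nil => simp
  | cons c l ih =>
    obtain ⟨i1, i2⟩ := ih (fun a ha => hl a (List.mem_cons_of_mem _ ha))
    obtain ⟨j1, j2⟩ := aux_indicator_int f hf c (hl c List.mem_cons_self)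
    have he : (fun u : ℝ => (((c :: l).countP (fun a => decide (f * u < a)) : ℕ) : ℝ))
        = fun u => ((l.countP (fun a => decide (f * u < a)) : ℕ) : ℝ)
          + (if f * u < c then (1:ℝ) else 0) := by
      funext u
      rw [List.countP_cons]
      push_cast
      simp
    rw [he]
    refine ⟨i1.add j1, ?_⟩
    rw [integral_add i1 j1, i2, j2, List.sum_cons]
    ring

lemma aux_layer {Ω : Type*} (T : Ω → Ω) (χ : Ω → ℝ) (h0 : ∀ ω, 0 ≤ χ ω) (n b : ℕ) (ω : Ω)
    (f : ℝ) (hf : 0 < f) :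
    IntegrableOn (fun u : ℝ => ((auxN T χ n (f * u) ω - b : ℕ) : ℝ)) (Set.Ioi 0) ∧
      ∫ u in Set.Ioi (0:ℝ), ((auxN T χ n (f * u) ω - b : ℕ) : ℝ) = trimmedSumN T χ n b ω / f := by
  set l0 := (List.range n).map fun k => χ (T^[k] ω) with hl0
  set l := l0.mergeSort (fun a b => a ≤ b) with hl
  have hperm : l.Perm l0 := List.mergeSort_perm _ _
  have hlen : l.length = n := by rw [hperm.length_eq, hl0]; simp
  have hsort : l.Pairwise (· ≤ ·) := List.pairwise_mergeSort' _ _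
  have hN : ∀ x, l.countP (fun a => decide (x < a)) = auxN T χ n x ω := by
    intro x
    rw [hperm.countP_eq, hl0, List.countP_map]
    unfold auxN
    rw [← Finset.card_filter]
    simp only [Finset.card, Finset.filter, Finset.range, Multiset.range]
    rw [Multiset.filter_coe, Multiset.coe_card, List.countP_eq_length_filter]
    rfl
  have hmem : ∀ a ∈ l.take (n - b), 0 ≤ a := by
    intro a ha
    have := hperm.mem_iff.1 (List.mem_of_mem_take ha)
    rw [hl0, List.mem_map] at this
    obtain ⟨k, -, rfl⟩ := this
    exact h0 _
  have key := aux_list_int f hf _ hmem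
  have he : ∀ u : ℝ, (l.take (n - b)).countP (fun a => decide (f * u < a))
      = auxN T χ n (f * u) ω - b := by
    intro u
    rw [← hN, ← aux_countP_take _ _ hsort b, hlen]
  simp only [he] at key
  exact key

end layer

section tails

variable {p L ls : ℝ → ℝ} {α : ℝ}

lemma aux_pos (hLpos : ∀ x : ℝ, 0 < x → 0 < L x) (hp : ∀ x : ℝ, 0 < x → p x = L x / x ^ α)
    {x : ℝ} (hx : 0 < x) : 0 < p x := by
  rw [hp x hx]; exact div_pos (hLpos x hx) (Real.rpow_pos_of_pos hx _)

lemma aux_reg (hL : SlowlyVarying L) (hLpos : ∀ x : ℝ, 0 < x → 0 < L x)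
    (hp : ∀ x : ℝ, 0 < x → p x = L x / x ^ α) {c : ℝ} (hc : 0 < c) :
    Tendsto (fun x => p (c * x) / p x) atTop (𝓝 (c ^ (-α))) := by
  have h := (hL c hc).mul_const (c ^ (-α))
  rw [one_mul] at h
  refine h.congr' ?_
  filter_upwards [eventually_gt_atTop (0:ℝ)] with x hx
  rw [hp x hx, hp (c * x) (mul_pos hc hx), Real.mul_rpow hc.le hx.le, Real.rpow_neg hc.le]
  have h1 := (hLpos x hx).ne'
  have h2 := (Real.rpow_pos_of_pos hx α).ne'
  have h3 := (Real.rpow_pos_of_pos hc α).ne'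
  field_simp

lemma aux_potter (hL : SlowlyVarying L) (hLpos : ∀ x : ℝ, 0 < x → 0 < L x)
    (hp : ∀ x : ℝ, 0 < x → p x = L x / x ^ α) (hα0 : 0 < α) (hα1 : α < 1)
    (hanti : Antitone p) (hp1 : ∀ x, p x ≤ 1) :
    ∃ x0 A : ℝ, 0 < x0 ∧ 0 < A ∧ ∀ x ≥ x0,
      (∀ u : ℝ, 1 ≤ u → p (u * x) ≤ A * u ^ (-(α / 2)) * p x) ∧
      (∀ u : ℝ, 0 < u → u ≤ 1 → p (u * x) ≤ A * u ^ (-((1 + α) / 2)) * p x) := by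
  have h2 := aux_reg hL hLpos hp (c := 2) (by norm_num)
  have hlt1 : (2:ℝ) ^ (-α) < 2 ^ (-(α / 2)) :=
    Real.rpow_lt_rpow_of_exponent_lt (by norm_num) (by linarith)
  have hlt2 : (2:ℝ) ^ (-((1 + α) / 2)) < 2 ^ (-α) :=
    Real.rpow_lt_rpow_of_exponent_lt (by norm_num) (by linarith)
  obtain ⟨x1, hx1⟩ := eventually_atTop.1
    ((h2.eventually (gt_mem_nhds hlt1)).and (h2.eventually (lt_mem_nhds hlt2)))
  set x0 := max x1 1 with hx0
  have hx0pos : 0 < x0 := lt_of_lt_of_le one_pos (le_max_right _ _)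
  have hpos : ∀ x, 0 < x → 0 < p x := fun x hx => aux_pos hLpos hp hx
  have hup : ∀ x ≥ x0, p (2 * x) ≤ 2 ^ (-(α / 2)) * p x := by
    intro x hx
    have hxp : 0 < x := lt_of_lt_of_le hx0pos hx
    exact ((div_lt_iff₀ (hpos x hxp)).1 (hx1 x ((le_max_left _ _).trans hx)).1).le
  have hdn : ∀ x ≥ x0, p x ≤ 2 ^ ((1 + α) / 2) * p (2 * x) := by
    intro x hx
    have hxp : 0 < x := lt_of_lt_of_le hx0pos hx
    have := ((lt_div_iff₀ (hpos x hxp)).1 (hx1 x ((le_max_left _ _).trans hx)).2).le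
    rw [Real.rpow_neg (by norm_num)] at this
    rwa [inv_mul_le_iff₀ (by positivity)] at this
  have hup' : ∀ k : ℕ, ∀ x ≥ x0, p (2 ^ k * x) ≤ ((2:ℝ) ^ k) ^ (-(α / 2)) * p x := by
    intro k
    induction k with
    | zero => intro x hx; simp
    | succ k ih =>
      intro x hx
      have hxp : 0 < x := lt_of_lt_of_le hx0pos hx
      have h1 := ih (2 * x) (by linarith)
      have h3 := hup x hx
      rw [pow_succ, mul_assoc, Real.mul_rpow (by positivity) (by norm_num), mul_assoc]
      exact h1.trans (mul_le_mul_of_nonneg_left h3 (by positivity))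
  have hdn' : ∀ k : ℕ, ∀ x ≥ x0, p x ≤ ((2:ℝ) ^ k) ^ ((1 + α) / 2) * p (2 ^ k * x) := by
    intro k
    induction k with
    | zero => intro x hx; simp
    | succ k ih =>
      intro x hx
      have hxp : 0 < x := lt_of_lt_of_le hx0pos hx
      have h1 := ih (2 * x) (by linarith)
      have h3 := hdn x hx
      have e1 : ((2:ℝ) ^ (k + 1)) ^ ((1 + α) / 2)
          = 2 ^ ((1 + α) / 2) * ((2:ℝ) ^ k) ^ ((1 + α) / 2) := by
        rw [pow_succ', Real.mul_rpow (by norm_num) (by positivity)]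
      have e2 : (2:ℝ) ^ (k + 1) * x = 2 ^ k * (2 * x) := by ring
      rw [e1, e2, mul_assoc]
      exact h3.trans (mul_le_mul_of_nonneg_left h1 (by positivity))
  have hdn2 : ∀ y ≥ x0, ∀ x ≥ y, p y ≤ (2 * (x / y)) ^ ((1 + α) / 2) * p x := by
    intro y hy x hx
    have hyp : 0 < y := lt_of_lt_of_le hx0pos hy
    have hxy : 1 ≤ x / y := by rw [le_div_iff₀ hyp]; linarith
    obtain ⟨k, hk1, hk2⟩ := exists_nat_pow_near hxy (by norm_num : (1:ℝ) < 2)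
    have h1 := hdn' (k + 1) y hy
    refine h1.trans ?_
    have h3 : p (2 ^ (k + 1) * y) ≤ p x := by
      apply hanti
      rw [div_lt_iff₀ hyp] at hk2
      exact hk2.le
    have h4 : ((2:ℝ) ^ (k + 1)) ^ ((1 + α) / 2) ≤ (2 * (x / y)) ^ ((1 + α) / 2) := by
      apply Real.rpow_le_rpow (by positivity) _ (by linarith)
      rw [pow_succ]; linarith
    exact mul_le_mul h4 h3 (hpos _ (by positivity)).le (by positivity)
  have hpx0 := hpos x0 hx0pos
  have hA : 2 ≤ 2 / p x0 := by
    rw [le_div_iff₀ hpx0]; linarith [hp1 x0]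
  refine ⟨x0, 2 / p x0, hx0pos, by positivity, fun x hx => ⟨fun u hu => ?_, fun u hu0 hu1 => ?_⟩⟩
  · have hxp : 0 < x := lt_of_lt_of_le hx0pos hx
    obtain ⟨k, hk1, hk2⟩ := exists_nat_pow_near hu (by norm_num : (1:ℝ) < 2)
    have h1 : p (u * x) ≤ p (2 ^ k * x) := hanti (by gcongr)
    have h3 : ((2:ℝ) ^ k) ^ (-(α / 2)) ≤ (u / 2) ^ (-(α / 2)) := by
      apply Real.rpow_le_rpow_of_nonpos (by positivity) _ (by linarith)
      rw [pow_succ] at hk2; linarith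
    have h4 : (u / 2) ^ (-(α / 2)) ≤ 2 / p x0 * u ^ (-(α / 2)) := by
      rw [Real.div_rpow (by linarith) (by norm_num), div_eq_mul_inv, ← Real.rpow_neg (by norm_num),
        neg_neg, mul_comm]
      refine mul_le_mul_of_nonneg_right (le_trans ?_ hA) (Real.rpow_nonneg (by linarith) _)
      calc (2:ℝ) ^ (α / 2) ≤ 2 ^ (1:ℝ) :=
            Real.rpow_le_rpow_of_exponent_le (by norm_num) (by linarith)
        _ = 2 := by simp
    exact h1.trans ((hup' k x hx).trans
      (mul_le_mul_of_nonneg_right (h3.trans h4) (hpos x hxp).le))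
  · have hxp : 0 < x := lt_of_lt_of_le hx0pos hx
    have hpow : ∀ y, 0 < y → y = u * x → (2 * (x / y)) ^ ((1 + α) / 2)
        ≤ 2 * u ^ (-((1 + α) / 2)) := by
      intro y hy hyu
      have : x / y = u⁻¹ := by rw [hyu]; field_simp
      rw [this, Real.mul_rpow (by norm_num) (by positivity), Real.inv_rpow hu0.le,
        Real.rpow_neg hu0.le]
      refine mul_le_mul_of_nonneg_right ?_ (by positivity)
      calc (2:ℝ) ^ ((1 + α) / 2) ≤ 2 ^ (1:ℝ) :=
            Real.rpow_le_rpow_of_exponent_le (by norm_num) (by linarith)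
        _ = 2 := by simp
    have hyx : u * x ≤ x := by nlinarith
    have hy0 : 0 < u * x := by positivity
    rcases le_total x0 (u * x) with h | h
    · refine (hdn2 _ h x hyx).trans (mul_le_mul_of_nonneg_right ?_ (hpos x hxp).le)
      refine (hpow _ hy0 rfl).trans (mul_le_mul_of_nonneg_right hA (by positivity))
    · have h1 := hdn2 x0 le_rfl x hx
      have h3 : (2 * (x / x0)) ^ ((1 + α) / 2) ≤ 2 * u ^ (-((1 + α) / 2)) := by
        refine le_trans ?_ (hpow _ hy0 rfl)
        apply Real.rpow_le_rpow (by positivity) _ (by linarith)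
        have : x / x0 ≤ x / (u * x) := by gcongr
        linarith
      have h4 : p x0 ≤ 2 * u ^ (-((1 + α) / 2)) * p x :=
        h1.trans (mul_le_mul_of_nonneg_right h3 (hpos x hxp).le)
      calc p (u * x) ≤ 1 := hp1 _
        _ = p x0 / p x0 := (div_self hpx0.ne').symm
        _ ≤ (2 * u ^ (-((1 + α) / 2)) * p x) / p x0 := by gcongr
        _ = _ := by ring

lemma aux_p_zero (hL : SlowlyVarying L) (hLpos : ∀ x : ℝ, 0 < x → 0 < L x)
    (hp : ∀ x : ℝ, 0 < x → p x = L x / x ^ α) (hα0 : 0 < α) (hα1 : α < 1)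
    (hanti : Antitone p) (hp1 : ∀ x, p x ≤ 1) : Tendsto p atTop (𝓝 0) := by
  obtain ⟨x0, A, hx0, hA, h⟩ := aux_potter hL hLpos hp hα0 hα1 hanti hp1
  have h1 : Tendsto (fun x : ℝ => A * (x / x0) ^ (-(α / 2)) * p x0) atTop (𝓝 0) := by
    have ht : Tendsto (fun x : ℝ => x / x0) atTop atTop := tendsto_id.atTop_div_const hx0
    have := ((tendsto_rpow_neg_atTop (by linarith : 0 < α / 2)).comp ht).const_mul A
    simpa using this.mul_const (p x0)
  refine tendsto_of_tendsto_of_tendsto_of_le_of_le' tendsto_const_nhds h1 ?_ ?_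
  · filter_upwards [eventually_gt_atTop (0:ℝ)] with x hx using (aux_pos hLpos hp hx).le
  · filter_upwards [eventually_ge_atTop x0] with x hx
    have := (h x0 le_rfl).1 (x / x0) (by rwa [le_div_iff₀ hx0, one_mul])
    rwa [div_mul_cancel₀ _ hx0.ne'] at this

lemma aux_ls_pos_step (hls : SlowlyVarying ls) :
    ∃ N : ℝ, 0 < N ∧ ∀ x ≥ N, 0 < ls x → ∀ y ≥ N, 0 < ls y := by
  obtain ⟨N0, hN0⟩ := eventually_atTop.1
    ((hls 2 (by norm_num)).eventually (lt_mem_nhds (zero_lt_one)))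
  set N := max N0 1
  have hNpos : 0 < N := lt_of_lt_of_le one_pos (le_max_right _ _)
  have hstep : ∀ x ≥ N, 0 < ls (2 * x) / ls x := fun x hx => hN0 x ((le_max_left _ _).trans hx)
  have hge : ∀ x ≥ N, ∀ k : ℕ, N ≤ 2 ^ k * x := by
    intro x hx k
    have : (1:ℝ) ≤ 2 ^ k := one_le_pow₀ (by norm_num)
    have hx0 : 0 < x := lt_of_lt_of_le hNpos hx
    nlinarith
  have hup : ∀ x ≥ N, 0 < ls x → ∀ k : ℕ, 0 < ls (2 ^ k * x) := by
    intro x hx h k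
    induction k with
    | zero => simpa using h
    | succ k ih =>
      have := hstep _ (hge x hx k)
      rw [pow_succ', mul_assoc]
      exact (div_pos_iff_of_pos_right ih).1 this
  have hdn : ∀ y ≥ N, ∀ k : ℕ, 0 < ls (2 ^ k * y) → 0 < ls y := by
    intro y hy k
    induction k with
    | zero => intro h; simpa using h
    | succ k ih =>
      intro h
      apply ih
      have := hstep _ (hge y hy k)
      rw [pow_succ', mul_assoc] at h
      exact (div_pos_iff_of_pos_left h).1 this
  refine ⟨N, hNpos, fun x hx h y hy => ?_⟩
  have hx0 : 0 < x := lt_of_lt_of_le hNpos hx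
  have hy0 : 0 < y := lt_of_lt_of_le hNpos hy
  have hc : 0 < y / x := by positivity
  have ht : Tendsto (fun k : ℕ => (2:ℝ) ^ k * x) atTop atTop :=
    (tendsto_pow_atTop_atTop_of_one_lt (by norm_num)).atTop_mul_const hx0
  obtain ⟨k, hk⟩ := (ht.eventually ((hls _ hc).eventually (lt_mem_nhds (zero_lt_one)))).exists
  have he : y / x * (2 ^ k * x) = 2 ^ k * y := by field_simp
  rw [he] at hk
  exact hdn y hy k ((div_pos_iff_of_pos_right (hup x hx h k)).1 hk)

lemma aux_p_rpow (hLpos : ∀ x : ℝ, 0 < x → 0 < L x)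
    (hp : ∀ x : ℝ, 0 < x → p x = L x / x ^ α) (hα0 : 0 < α) {x : ℝ} (hx : 0 < x) :
    p x ^ (-(1 / α)) = x * L x ^ (-(1 / α)) := by
  rw [hp x hx, Real.div_rpow (hLpos x hx).le (by positivity), ← Real.rpow_mul hx.le]
  have : α * -(1 / α) = -1 := by field_simp
  rw [this, Real.rpow_neg_one]
  field_simp

lemma aux_ls_pos (hL : SlowlyVarying L) (hLpos : ∀ x : ℝ, 0 < x → 0 < L x)
    (hp : ∀ x : ℝ, 0 < x → p x = L x / x ^ α) (hα0 : 0 < α) (hα1 : α < 1)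
    (hanti : Antitone p) (hp1 : ∀ x, p x ≤ 1)
    (hls : IsDeBruijnConjugate (fun x => L x ^ (-(1 / α))) ls) :
    ∀ᶠ x in atTop, 0 < ls x := by
  obtain ⟨N, hN0, hN⟩ := aux_ls_pos_step hls.1
  have h0 := aux_p_zero hL hLpos hp hα0 hα1 hanti hp1
  have h1 : Tendsto (fun x => x * L x ^ (-(1 / α))) atTop atTop := by
    have hw : Tendsto p atTop (𝓝[>] 0) := by
      rw [tendsto_nhdsWithin_iff]
      refine ⟨h0, ?_⟩
      filter_upwards [eventually_gt_atTop (0:ℝ)] with x hx using aux_pos hLpos hp hx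
    have hneg : -(1 / α) < 0 := by
      have : 0 < 1 / α := by positivity
      linarith
    have := (tendsto_rpow_neg_nhdsGT_zero hneg).comp hw
    refine this.congr' ?_
    filter_upwards [eventually_gt_atTop (0:ℝ)] with x hx
    exact aux_p_rpow hLpos hp hα0 hx
  obtain ⟨x, ⟨hx1, hx2⟩, hx3⟩ := (((hls.2.1.eventually (lt_mem_nhds zero_lt_one)).and
    (h1.eventually (eventually_ge_atTop N))).and (eventually_gt_atTop (0:ℝ))).exists
  have hLp : 0 < L x ^ (-(1 / α)) := Real.rpow_pos_of_pos (hLpos x hx3) _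
  have : 0 < ls (x * L x ^ (-(1 / α))) := (mul_pos_iff_of_pos_left hLp).1 hx1
  filter_upwards [eventually_ge_atTop N] with y hy using hN _ hx2 this y hy

lemma aux_f (hL : SlowlyVarying L) (hLpos : ∀ x : ℝ, 0 < x → 0 < L x)
    (hp : ∀ x : ℝ, 0 < x → p x = L x / x ^ α) (hα0 : 0 < α) (hα1 : α < 1)
    (hanti : Antitone p) (hp1 : ∀ x, p x ≤ 1)
    (hls : IsDeBruijnConjugate (fun x => L x ^ (-(1 / α))) ls) :
    Tendsto (fun x => x * ls x) atTop atTop ∧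
      Tendsto (fun x => p (x * ls x) * x ^ α) atTop (𝓝 1) := by
  have hpos := aux_ls_pos hL hLpos hp hα0 hα1 hanti hp1 hls
  have h1 : Tendsto (fun x => p (x * ls x) * x ^ α) atTop (𝓝 1) := by
    have := hls.2.2.rpow_const (p := -α) (Or.inl one_ne_zero)
    rw [Real.one_rpow] at this
    refine this.congr' ?_
    filter_upwards [hpos, eventually_gt_atTop (0:ℝ)] with x hx hx0
    have hf : 0 < x * ls x := mul_pos hx0 hx
    have h2 := aux_p_rpow hLpos hp hα0 hf
    have hpp := aux_pos hLpos hp hf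
    have h3 : ls x * L (x * ls x) ^ (-(1 / α)) = p (x * ls x) ^ (-(1 / α)) / x := by
      rw [h2]; field_simp
    rw [h3, Real.div_rpow (by positivity) hx0.le, ← Real.rpow_mul hpp.le]
    have : -(1 / α) * -α = 1 := by field_simp
    rw [this, Real.rpow_one, Real.rpow_neg hx0.le, div_inv_eq_mul]
  refine ⟨?_, h1⟩
  have h2 : Tendsto (fun x => p (x * ls x)) atTop (𝓝 0) := by
    have := h1.mul (tendsto_rpow_neg_atTop hα0)
    rw [one_mul] at this
    refine this.congr' ?_
    filter_upwards [eventually_gt_atTop (0:ℝ)] with x hx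
    rw [mul_assoc, ← Real.rpow_add hx]; simp
  refine tendsto_atTop.2 fun M => ?_
  have hM : 0 < p (max M 1) := aux_pos hLpos hp (lt_of_lt_of_le one_pos (le_max_right _ _))
  filter_upwards [h2.eventually (gt_mem_nhds hM)] with x hx
  by_contra hlt
  exact absurd (hanti ((not_le.1 hlt).le.trans (le_max_left M 1))) (not_le.2 hx)

end tails

section final

lemma aux_kappa {α : ℝ} (hα0 : 0 < α) (hα1 : α < 1) :
    IntegrableOn (fun u : ℝ => max (u ^ (-α) - 1) 0) (Set.Ioi 0) ∧
      ∫ u in Set.Ioi (0:ℝ), max (u ^ (-α) - 1) 0 = α / (1 - α) := by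
  have hi : IntervalIntegrable (fun u : ℝ => u ^ (-α) - 1) volume 0 1 :=
    (intervalIntegral.intervalIntegrable_rpow' (by linarith)).sub intervalIntegrable_const
  have hi' : IntegrableOn (fun u : ℝ => u ^ (-α) - 1) (Set.Ioc 0 1) := by
    rwa [intervalIntegrable_iff_integrableOn_Ioc_of_le zero_le_one] at hi
  have he : Set.EqOn (fun u : ℝ => max (u ^ (-α) - 1) 0)
      ((Set.Ioc (0:ℝ) 1).indicator (fun u : ℝ => u ^ (-α) - 1)) (Set.Ioi 0) := by
    intro u hu
    have hu0 : 0 < u := hu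
    by_cases h : u ≤ 1
    · rw [Set.indicator_of_mem (show u ∈ Set.Ioc (0:ℝ) 1 from ⟨hu0, h⟩)]
      have : 1 ≤ u ^ (-α) := Real.one_le_rpow_of_pos_of_le_one_of_nonpos hu0 h (by linarith)
      exact max_eq_left (by linarith)
    · rw [Set.indicator_of_notMem (fun hh : u ∈ Set.Ioc (0:ℝ) 1 => h hh.2)]
      have : u ^ (-α) ≤ 1 := Real.rpow_le_one_of_one_le_of_nonpos (not_le.1 h).le (by linarith)
      exact max_eq_right (by linarith)
  have hr : (Set.Ioi (0:ℝ)) ∩ Set.Ioc 0 1 = Set.Ioc 0 1 := by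
    ext x; simp only [Set.mem_inter_iff, Set.mem_Ioi, Set.mem_Ioc]; tauto
  constructor
  · rw [integrableOn_congr_fun he measurableSet_Ioi]
    exact (hi'.integrable_indicator measurableSet_Ioc).integrableOn
  · rw [setIntegral_congr_fun measurableSet_Ioi he, setIntegral_indicator measurableSet_Ioc, hr,
      ← intervalIntegral.integral_of_le zero_le_one,
      intervalIntegral.integral_sub (intervalIntegral.intervalIntegrable_rpow' (by linarith))
        intervalIntegrable_const, integral_rpow (Or.inl (by linarith))]
    have h1 : -α + 1 ≠ 0 := by linarith
    have h2 : 1 - α ≠ 0 := by linarith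
    rw [Real.one_rpow, Real.zero_rpow h1]
    simp
    field_simp
    ring

lemma aux_posdiff (N b : ℕ) (hb : 0 < b) (c : ℝ) :
    |((N - b : ℕ) : ℝ) / b - max (c - 1) 0| ≤ |(N : ℝ) / b - c| := by
  have hb' : (0:ℝ) < b := by exact_mod_cast hb
  have h : ((N - b : ℕ) : ℝ) / b = max ((N : ℝ) / b - 1) 0 := by
    rcases le_total N b with h | h
    · rw [Nat.sub_eq_zero_of_le h, max_eq_right]
      · simp
      · have : (N : ℝ) / b ≤ 1 := by rw [div_le_one hb']; exact_mod_cast h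
        linarith
    · rw [max_eq_left]
      · rw [Nat.cast_sub h]; field_simp
      · have : 1 ≤ (N : ℝ) / b := by rw [one_le_div hb']; exact_mod_cast h
        linarith
  rw [h]
  refine (abs_max_sub_max_le_abs _ _ _).trans (le_of_eq ?_)
  congr 1; ring

variable {Ω : Type*} [MeasurableSpace Ω] {T : Ω → Ω} {χ : Ω → ℝ} {μ : Measure Ω}

lemma aux_pointwise [IsProbabilityMeasure μ] (hT : MeasurePreserving T μ μ) (hχ : Measurable χ)
    (hbr : ∀ ε : ℝ, 0 < ε → ∃ R : ℕ, ∀ t ≥ R, ∀ x : ℝ,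
      μ.real ({ω | x < χ ω} ∩ {ω | x < χ (T^[t] ω)}) ≤ (1 + ε) * μ.real {ω | x < χ ω} ^ 2)
    (b : ℕ → ℕ) (hb : Tendsto b atTop atTop) (x : ℕ → ℝ) (c : ℝ)
    (hx : Tendsto (fun n : ℕ => n * μ.real {ω | x n < χ ω} / b n) atTop (𝓝 c)) :
    Tendsto (fun n => ∫⁻ ω, ENNReal.ofReal
      |((auxN T χ n (x n) ω - b n : ℕ) : ℝ) / b n - max (c - 1) 0| ∂μ) atTop (𝓝 0) := by
  set q : ℕ → ℝ := fun n => n * μ.real {ω | x n < χ ω} with hq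
  set e : ℕ → ℝ := fun n => (∫ ω, |(auxN T χ n (x n) ω : ℝ) - q n| ∂μ) / b n with he
  have hbR : Tendsto (fun n => (b n : ℝ)) atTop atTop := tendsto_natCast_atTop_atTop.comp hb
  have hbpos : ∀ᶠ n in atTop, 0 < b n := hb.eventually (eventually_gt_atTop 0)
  have he0 : ∀ n, 0 ≤ e n := fun n => div_nonneg (integral_nonneg fun _ => abs_nonneg _)
    (Nat.cast_nonneg _)
  have he2 : Tendsto (fun n => e n ^ 2) atTop (𝓝 0) := by
    refine tendsto_order.2 ⟨fun a ha => Eventually.of_forall fun n => lt_of_lt_of_le ha (sq_nonneg _),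
      fun δ hδ => ?_⟩
    have hc1 : 0 < 2 * (c ^ 2 + 1) := by positivity
    obtain ⟨R, hR⟩ := hbr (δ / (2 * (c ^ 2 + 1))) (by positivity)
    have hlim : Tendsto (fun n => 2 * R * (q n / b n) * (b n : ℝ)⁻¹
        + δ / (2 * (c ^ 2 + 1)) * (q n / b n) ^ 2) atTop
        (𝓝 (2 * R * c * 0 + δ / (2 * (c ^ 2 + 1)) * c ^ 2)) :=
      ((hx.const_mul _).mul (tendsto_inv_atTop_zero.comp hbR)).add ((hx.pow 2).const_mul _)
    have hlt : 2 * R * c * 0 + δ / (2 * (c ^ 2 + 1)) * c ^ 2 < δ := by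
      rw [mul_zero, zero_add, div_mul_eq_mul_div, div_lt_iff₀ hc1]
      nlinarith [sq_nonneg c]
    filter_upwards [hlim.eventually (gt_mem_nhds hlt), hbpos] with n hn hbn
    refine lt_of_le_of_lt ?_ hn
    have hb' : (0:ℝ) < b n := by exact_mod_cast hbn
    have := aux_var hT hχ hR (by positivity) n (x n)
    simp only [he, div_pow]
    calc _ ≤ (2 * R * q n + δ / (2 * (c ^ 2 + 1)) * q n ^ 2) / (b n : ℝ) ^ 2 := by
          gcongr
      _ = _ := by field_simp
  have he1 : Tendsto e atTop (𝓝 0) := by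
    have := he2.sqrt
    simp only [Real.sqrt_zero] at this
    exact this.congr fun n => Real.sqrt_sq (he0 n)
  have hlim : Tendsto (fun n => ENNReal.ofReal (e n + |q n / b n - c|)) atTop (𝓝 0) := by
    have h1 : Tendsto (fun n => |q n / b n - c|) atTop (𝓝 0) := by
      have := (hx.sub_const c).abs
      simpa using this
    have := ENNReal.tendsto_ofReal (he1.add h1)
    simpa using this
  refine tendsto_of_tendsto_of_tendsto_of_le_of_le' tendsto_const_nhds hlim
    (Eventually.of_forall fun _ => bot_le) ?_
  filter_upwards [hbpos] with n hbn
  have hb' : (0:ℝ) < b n := by exact_mod_cast hbn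
  have hNm : Measurable (fun ω => (auxN T χ n (x n) ω : ℝ)) :=
    measurable_from_top.comp (auxN_meas hT.measurable hχ n (x n))
  have hNb : ∀ ω, (auxN T χ n (x n) ω : ℝ) ≤ n := by
    intro ω
    have : auxN T χ n (x n) ω ≤ n := by
      unfold auxN
      refine (Finset.sum_le_card_nsmul _ _ 1 fun k _ => ?_).trans (by simp)
      split_ifs <;> simp
    exact_mod_cast this
  have hint : Integrable (fun ω => |(auxN T χ n (x n) ω : ℝ) - q n|) μ := by
    refine Integrable.abs (Integrable.sub ?_ (integrable_const _))
    refine Integrable.of_bound hNm.aestronglyMeasurable n (Eventually.of_forall fun ω => ?_)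
    rw [Real.norm_of_nonneg (Nat.cast_nonneg _)]; exact hNb ω
  calc ∫⁻ ω, ENNReal.ofReal |((auxN T χ n (x n) ω - b n : ℕ) : ℝ) / b n - max (c - 1) 0| ∂μ
      ≤ ∫⁻ ω, ENNReal.ofReal (|(auxN T χ n (x n) ω : ℝ) - q n| / b n + |q n / b n - c|) ∂μ := by
        refine lintegral_mono fun ω => ENNReal.ofReal_le_ofReal ?_
        refine (aux_posdiff _ _ hbn c).trans ?_
        have : (auxN T χ n (x n) ω : ℝ) / b n - c
            = ((auxN T χ n (x n) ω : ℝ) - q n) / b n + (q n / b n - c) := by ring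
        rw [this]
        refine (abs_add_le _ _).trans ?_
        rw [abs_div, abs_of_pos hb']
    _ = ENNReal.ofReal (e n + |q n / b n - c|) := by
        have hint2 : Integrable (fun ω => |(auxN T χ n (x n) ω : ℝ) - q n| / b n
            + |q n / b n - c|) μ := (hint.div_const _).add (integrable_const _)
        rw [← ofReal_integral_eq_lintegral_ofReal hint2
          (Eventually.of_forall fun ω => by positivity),
          integral_add (hint.div_const _) (integrable_const _), integral_div]
        simp [he]
    _ ≤ _ := le_rfl

lemma aux_joint (hT : Measurable T) (hχ : Measurable χ) (n b : ℕ) (f α : ℝ) :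
    Measurable (fun z : Ω × ℝ => ENNReal.ofReal
      |((auxN T χ n (f * z.2) z.1 - b : ℕ) : ℝ) / b - max (z.2 ^ (-α) - 1) 0|) := by
  have h1 : Measurable (fun z : Ω × ℝ => auxN T χ n (f * z.2) z.1) := by
    unfold auxN
    refine Finset.measurable_sum _ fun k _ => ?_
    refine Measurable.ite ?_ measurable_const measurable_const
    exact measurableSet_lt (measurable_snd.const_mul f)
      (hχ.comp ((hT.iterate k).comp measurable_fst))
  have h2 : Measurable (fun z : Ω × ℝ => ((auxN T χ n (f * z.2) z.1 - b : ℕ) : ℝ)) :=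
    (measurable_from_top (f := fun m : ℕ => ((m - b : ℕ) : ℝ))).comp h1
  have h3 : Measurable (fun z : Ω × ℝ => max (z.2 ^ (-α) - 1) 0) :=
    ((measurable_snd.pow_const (-α)).sub_const 1).max measurable_const
  exact ((h2.div_const _).sub h3).abs.ennreal_ofReal

lemma aux_core [IsProbabilityMeasure μ] (hT : MeasurePreserving T μ μ) (hχ : Measurable χ)
    (hbr : ∀ ε : ℝ, 0 < ε → ∃ R : ℕ, ∀ t ≥ R, ∀ x : ℝ,
      μ.real ({ω | x < χ ω} ∩ {ω | x < χ (T^[t] ω)}) ≤ (1 + ε) * μ.real {ω | x < χ ω} ^ 2)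
    {r : ℕ} (hr : 1 ≤ r) (hψ : psiCoeff μ T χ r < 1)
    {L : ℝ → ℝ} (hL : SlowlyVarying L) (hLpos : ∀ x : ℝ, 0 < x → 0 < L x)
    {α : ℝ} (hα0 : 0 < α) (hα1 : α < 1)
    (hp : ∀ x : ℝ, 0 < x → μ.real {ω | x < χ ω} = L x / x ^ α)
    (b : ℕ → ℕ) (hb : Tendsto b atTop atTop) (f : ℕ → ℝ) (hf : Tendsto f atTop atTop)
    (hfp : Tendsto (fun n : ℕ => n * μ.real {ω | f n < χ ω} / b n) atTop (𝓝 1)) :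
    Tendsto (fun n => ∫⁻ u in Set.Ioi (0:ℝ), ∫⁻ ω, ENNReal.ofReal
      |((auxN T χ n (f n * u) ω - b n : ℕ) : ℝ) / b n - max (u ^ (-α) - 1) 0| ∂μ) atTop (𝓝 0) := by
  set p : ℝ → ℝ := fun x => μ.real {ω | x < χ ω} with hpdef
  have hp' : ∀ x : ℝ, 0 < x → p x = L x / x ^ α := hp
  have hanti : Antitone p := fun x y hxy =>
    measureReal_mono (fun ω (h : y < χ ω) => lt_of_le_of_lt hxy h)
  have hp1 : ∀ x, p x ≤ 1 := fun x => measureReal_le_one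
  have hp0 : ∀ x, 0 ≤ p x := fun x => measureReal_nonneg
  obtain ⟨x0, A, hx0, hA, hpot⟩ := aux_potter hL hLpos hp' hα0 hα1 hanti hp1
  obtain ⟨m, hm⟩ := exists_nat_gt (2 / α)
  have hm0 : 1 ≤ m := by
    by_contra h
    have : m = 0 := by omega
    rw [this] at hm
    have : 0 < 2 / α := by positivity
    simp at hm; linarith
  obtain ⟨K1, hK1, hM1⟩ := aux_moment hT hχ hr hψ 1 le_rfl
  obtain ⟨K, hK, hM⟩ := aux_moment hT hχ hr hψ m hm0
  set B : ℝ → ℝ := fun u => if u ≤ 1 then K1 * (2 * A * u ^ (-((1 + α) / 2))) + u ^ (-α)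
    else K * (2 * A) ^ m * u ^ (-(α / 2) * m) with hB
  have hBint : IntegrableOn B (Set.Ioi 0) := by
    rw [← Set.Ioc_union_Ioi_eq_Ioi (zero_le_one (α := ℝ))]
    refine IntegrableOn.union ?_ ?_
    · have h1 : IntegrableOn (fun u : ℝ => K1 * (2 * A * u ^ (-((1 + α) / 2))) + u ^ (-α))
          (Set.Ioc 0 1) := by
        rw [← intervalIntegrable_iff_integrableOn_Ioc_of_le zero_le_one]
        exact (((intervalIntegral.intervalIntegrable_rpow' (by linarith)).const_mul _).const_mul
          _).add (intervalIntegral.intervalIntegrable_rpow' (by linarith))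
      refine h1.congr_fun (fun u hu => ?_) measurableSet_Ioc
      simp only [hB, if_pos hu.2]
    · have h1 : IntegrableOn (fun u : ℝ => K * (2 * A) ^ m * u ^ (-(α / 2) * m)) (Set.Ioi 1) := by
        refine (integrableOn_Ioi_rpow_of_lt ?_ one_pos).const_mul _
        rw [div_lt_iff₀ hα0] at hm
        linarith
      refine h1.congr_fun (fun u hu => ?_) measurableSet_Ioi
      simp only [hB, if_neg (not_le.2 (show (1:ℝ) < u from hu))]
  rw [show (0:ℝ≥0∞) = ∫⁻ u in Set.Ioi (0:ℝ), (0:ℝ≥0∞) by simp]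
  refine tendsto_lintegral_filter_of_dominated_convergence (fun u => ENNReal.ofReal (B u))
    (Eventually.of_forall fun n => ?_) ?_ ?_ ?_
  · exact (aux_joint hT.measurable hχ n (b n) (f n) α).lintegral_prod_left'
  · have hev1 : ∀ᶠ n : ℕ in atTop, (n:ℝ) * p (f n) / b n ≤ 2 :=
      (hfp.eventually (gt_mem_nhds one_lt_two)).mono fun n h => h.le
    filter_upwards [hev1, hf.eventually (eventually_ge_atTop x0),
      hb.eventually (eventually_ge_atTop (2 * m * r)), hb.eventually (eventually_ge_atTop (2 * 1 * r)),
      hb.eventually (eventually_gt_atTop 0)] with n h1 h2 h3 h4 h5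
    have hb' : (0:ℝ) < b n := by exact_mod_cast h5
    refine (ae_restrict_iff' measurableSet_Ioi).2 (Eventually.of_forall fun u hu => ?_)
    have hu0 : (0:ℝ) < u := hu
    have hscale : ∀ D : ℝ, 0 ≤ D → p (u * f n) ≤ D * p (f n) →
        (n:ℝ) * p (f n * u) / b n ≤ 2 * D := by
      intro D hD h
      rw [mul_comm (f n) u]
      calc (n:ℝ) * p (u * f n) / b n ≤ (n:ℝ) * (D * p (f n)) / b n := by gcongr
        _ = D * ((n:ℝ) * p (f n) / b n) := by ring
        _ ≤ D * 2 := by gcongr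
        _ = _ := by ring
    by_cases hu1 : u ≤ 1
    · have hs := hscale _ (by positivity) ((hpot _ h2).2 u hu0 hu1)
      simp only [hB, if_pos hu1]
      rw [ENNReal.ofReal_add (by positivity) (by positivity)]
      calc ∫⁻ ω, ENNReal.ofReal
            |((auxN T χ n (f n * u) ω - b n : ℕ) : ℝ) / b n - max (u ^ (-α) - 1) 0| ∂μ
          ≤ ∫⁻ ω, (ENNReal.ofReal (((auxN T χ n (f n * u) ω - b n : ℕ) : ℝ) / b n)
              + ENNReal.ofReal (u ^ (-α))) ∂μ := by
            refine lintegral_mono fun ω => ?_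
            rw [← ENNReal.ofReal_add (by positivity) (by positivity)]
            refine ENNReal.ofReal_le_ofReal ?_
            have hmax0 : 0 ≤ max (u ^ (-α) - 1) 0 := le_max_right _ _
            have hmax1 : max (u ^ (-α) - 1) 0 ≤ u ^ (-α) :=
              max_le (by linarith) (by positivity)
            have hN0 : 0 ≤ ((auxN T χ n (f n * u) ω - b n : ℕ) : ℝ) / b n := by positivity
            rw [abs_le]; constructor <;> linarith
        _ = (∫⁻ ω, ENNReal.ofReal (((auxN T χ n (f n * u) ω - b n : ℕ) : ℝ) / b n) ∂μ)
              + ENNReal.ofReal (u ^ (-α)) := by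
            rw [lintegral_add_right _ measurable_const]; simp
        _ ≤ _ := by
            gcongr
            refine (hM1 n (b n) (f n * u) (by simpa using h4)).trans
              (ENNReal.ofReal_le_ofReal ?_)
            rw [pow_one]
            refine mul_le_mul_of_nonneg_left (hs.trans (le_of_eq (by ring))) hK1
    · have hu1' : 1 ≤ u := (not_le.1 hu1).le
      have hs := hscale _ (by positivity) ((hpot _ h2).1 u hu1')
      simp only [hB, if_neg hu1]
      have hmax : max (u ^ (-α) - 1) 0 = 0 := by
        have : u ^ (-α) ≤ 1 := Real.rpow_le_one_of_one_le_of_nonpos hu1' (by linarith)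
        exact max_eq_right (by linarith)
      rw [hmax]
      have hsimp : ∀ ω, |((auxN T χ n (f n * u) ω - b n : ℕ) : ℝ) / b n - 0|
          = ((auxN T χ n (f n * u) ω - b n : ℕ) : ℝ) / b n := fun ω => by
        rw [sub_zero, abs_of_nonneg (by positivity)]
      simp only [hsimp]
      refine (hM n (b n) (f n * u) h3).trans (ENNReal.ofReal_le_ofReal ?_)
      have : K * (2 * A) ^ m * u ^ (-(α / 2) * m) = K * (2 * (A * u ^ (-(α / 2)))) ^ m := by
        rw [Real.rpow_mul hu0.le, Real.rpow_natCast, mul_assoc, ← mul_pow, mul_assoc]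
      rw [this]
      refine mul_le_mul_of_nonneg_left (pow_le_pow_left₀ ?_ hs m) hK
      exact div_nonneg (mul_nonneg (Nat.cast_nonneg _) (hp0 _)) hb'.le
  · rw [← ofReal_integral_eq_lintegral_ofReal hBint]
    · exact ENNReal.ofReal_ne_top
    · refine (ae_restrict_iff' measurableSet_Ioi).2 (Eventually.of_forall fun u hu => ?_)
      have hu0 : (0:ℝ) < u := hu
      simp only [hB, Pi.zero_apply]
      split_ifs <;> positivity
  · refine (ae_restrict_iff' measurableSet_Ioi).2 (Eventually.of_forall fun u hu => ?_)
    have hu0 : (0:ℝ) < u := hu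
    refine aux_pointwise hT hχ hbr b hb (fun n => f n * u) (u ^ (-α)) ?_
    have h1 := (aux_reg hL hLpos hp' hu0).comp hf
    have h2 := hfp.mul h1
    rw [one_mul] at h2
    refine h2.congr' ?_
    filter_upwards [hf.eventually (eventually_gt_atTop 0)] with n hn
    have hpn : 0 < p (f n) := aux_pos hLpos hp' hn
    change (n:ℝ) * p (f n) / b n * (p (u * f n) / p (f n)) = n * p (f n * u) / b n
    rw [mul_comm u]
    field_simp

end final

theorem mean_convergence_of_trimmed_sums
    {Ω : Type*} [MeasurableSpace Ω] (T : Ω → Ω) (μ : Measure Ω)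
    {F : Type*} [NormedRing F] [NormedAlgebra ℝ F] [CompleteSpace F]
    (ι : F →ₐ[ℝ] Ω → ℝ) (χ : Ω → ℝ)
    (hD : PropertyD T μ ι χ)
    (L : ℝ → ℝ) (hL : SlowlyVarying L) (hLpos : ∀ x : ℝ, 0 < x → 0 < L x)
    {α : ℝ} (hα0 : 0 < α) (hα1 : α < 1)
    (htail : ∀ x : ℝ, 0 < x → (μ {ω | x < χ ω}).toReal = L x / x ^ α)
    (b : ℕ → ℕ) (hb : Tendsto b atTop atTop)
    (hbo : Tendsto (fun n => (b n : ℝ) / (n : ℝ)) atTop (𝓝 0))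
    (hmix : ∃ r : ℕ, 1 ≤ r ∧ psiCoeff μ T χ r < 1)
    (ls : ℝ → ℝ) (hls : IsDeBruijnConjugate (fun x => L x ^ (-(1 / α))) ls)
    :
    Tendsto (fun n => ∫ ω, |trimmedSumN T χ n (b n) ω / dSeq α ls b n - 1| ∂μ)
      atTop (𝓝 0) := by
  have := hD.prob
  obtain ⟨r, hr, hψ⟩ := hmix
  have hT := hD.invariant
  have hχ := hD.chi_meas
  have hbr : ∀ ε : ℝ, 0 < ε → ∃ R : ℕ, ∀ t ≥ R, ∀ x : ℝ,
      μ.real ({ω | x < χ ω} ∩ {ω | x < χ (T^[t] ω)}) ≤ (1 + ε) * μ.real {ω | x < χ ω} ^ 2 :=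
    fun ε hε => aux_bradley hT hχ hD.mixing hψ hε
  have hp : ∀ x : ℝ, 0 < x → μ.real {ω | x < χ ω} = L x / x ^ α := htail
  have hanti : Antitone (fun x : ℝ => μ.real {ω | x < χ ω}) := fun x y hxy =>
    measureReal_mono (fun ω (h : y < χ ω) => lt_of_le_of_lt hxy h)
  obtain ⟨hf1, hf2⟩ := aux_f hL hLpos hp hα0 hα1 hanti (fun x => measureReal_le_one) hls
  have hbpos : ∀ᶠ n in atTop, 0 < b n := hb.eventually (eventually_gt_atTop 0)
  have hnb : Tendsto (fun n : ℕ => (n : ℝ) / b n) atTop atTop := by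
    have hw : Tendsto (fun n : ℕ => (b n : ℝ) / (n : ℝ)) atTop (𝓝[>] 0) := by
      rw [tendsto_nhdsWithin_iff]
      refine ⟨hbo, ?_⟩
      filter_upwards [hbpos, eventually_gt_atTop 0] with n h1 h2
      have h1' : (0:ℝ) < b n := by exact_mod_cast h1
      have h2' : (0:ℝ) < n := by exact_mod_cast h2
      exact div_pos h1' h2'
    refine (tendsto_inv_nhdsGT_zero.comp hw).congr fun n => ?_
    simp
  set X : ℕ → ℝ := fun n => ((n : ℝ) / b n) ^ (1 / α) with hX
  have hXt : Tendsto X atTop atTop := (tendsto_rpow_atTop (by positivity)).comp hnb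
  set f : ℕ → ℝ := fun n => X n * ls (X n) with hf
  have hft : Tendsto f atTop atTop := hf1.comp hXt
  have hfp : Tendsto (fun n : ℕ => n * μ.real {ω | f n < χ ω} / b n) atTop (𝓝 1) := by
    refine (hf2.comp hXt).congr fun n => ?_
    have : X n ^ α = (n : ℝ) / b n := by
      simp only [hX]
      rw [← Real.rpow_mul (by positivity)]
      have : 1 / α * α = 1 := by field_simp
      rw [this, Real.rpow_one]
    simp only [Function.comp_apply, this, hf]
    ring
  have hcore := aux_core hT hχ hbr hr hψ hL hLpos hα0 hα1 hp b hb f hft hfp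
  set κ : ℝ := α / (1 - α) with hκ
  have hκ0 : 0 < κ := div_pos hα0 (by linarith)
  obtain ⟨hk1, hk2⟩ := aux_kappa hα0 hα1
  set I : ℕ → ℝ≥0∞ := fun n => ∫⁻ u in Set.Ioi (0:ℝ), ∫⁻ ω, ENNReal.ofReal
      |((auxN T χ n (f n * u) ω - b n : ℕ) : ℝ) / b n - max (u ^ (-α) - 1) 0| ∂μ with hI
  have hlim : Tendsto (fun n => (ENNReal.ofReal κ⁻¹ * I n).toReal) atTop (𝓝 0) := by
    have h1 : Tendsto (fun n => ENNReal.ofReal κ⁻¹ * I n) atTop (𝓝 0) := by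
      have := ENNReal.Tendsto.const_mul (a := ENNReal.ofReal κ⁻¹) hcore
        (Or.inr ENNReal.ofReal_ne_top)
      simpa using this
    have := (ENNReal.tendsto_toReal (ENNReal.zero_ne_top)).comp h1
    rw [ENNReal.toReal_zero] at this
    exact this
  have hfin : ∀ᶠ n in atTop, I n < ∞ := hcore.eventually (gt_mem_nhds (by simp))
  refine tendsto_of_tendsto_of_tendsto_of_le_of_le' tendsto_const_nhds hlim
    (Eventually.of_forall fun _ => integral_nonneg fun _ => abs_nonneg _) ?_
  filter_upwards [hbpos, hft.eventually (eventually_gt_atTop 0), hfin, eventually_gt_atTop 0]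
    with n hbn hfn hIn hn
  have hb' : (0:ℝ) < b n := by exact_mod_cast hbn
  have hn' : (0:ℝ) < n := by exact_mod_cast hn
  have hd : dSeq α ls b n = κ * (b n * f n) := by
    simp only [dSeq, hf, hX, hκ]
    rw [Real.div_rpow hn'.le hb'.le, Real.rpow_sub hb', Real.rpow_one]
    ring
  have hpt : ∀ ω, ENNReal.ofReal |trimmedSumN T χ n (b n) ω / dSeq α ls b n - 1|
      ≤ ENNReal.ofReal κ⁻¹ * ∫⁻ u in Set.Ioi (0:ℝ), ENNReal.ofReal
        |((auxN T χ n (f n * u) ω - b n : ℕ) : ℝ) / b n - max (u ^ (-α) - 1) 0| := by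
    intro ω
    obtain ⟨j1, j2⟩ := aux_layer T χ hD.chi_nonneg n (b n) ω (f n) hfn
    have e1 : trimmedSumN T χ n (b n) ω / dSeq α ls b n - 1
        = κ⁻¹ * ∫ u in Set.Ioi (0:ℝ), (((auxN T χ n (f n * u) ω - b n : ℕ) : ℝ) / b n
          - max (u ^ (-α) - 1) 0) := by
      rw [integral_sub (j1.div_const _) hk1, integral_div, j2, hk2, hd, ← hκ]
      field_simp
    rw [e1, abs_mul, abs_of_pos (inv_pos.2 hκ0), ENNReal.ofReal_mul (inv_pos.2 hκ0).le]
    gcongr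
    rw [← Real.norm_eq_abs, ofReal_norm]
    refine (enorm_integral_le_lintegral_enorm _).trans (le_of_eq ?_)
    refine lintegral_congr fun u => ?_
    rw [← Real.norm_eq_abs, ofReal_norm]
  have hlint : ∫⁻ ω, ENNReal.ofReal |trimmedSumN T χ n (b n) ω / dSeq α ls b n - 1| ∂μ
      ≤ ENNReal.ofReal κ⁻¹ * I n := by
    refine (lintegral_mono hpt).trans ?_
    rw [lintegral_const_mul' _ _ ENNReal.ofReal_ne_top]
    refine mul_le_mul_right (le_of_eq ?_) _
    exact lintegral_lintegral_swap (aux_joint hT.measurable hχ n (b n) (f n) α).aemeasurable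
  have hne : ENNReal.ofReal κ⁻¹ * I n ≠ ∞ := ENNReal.mul_ne_top ENNReal.ofReal_ne_top hIn.ne
  refine le_trans ?_ (ENNReal.toReal_mono hne hlint)
  refine (le_abs_self _).trans ?_
  rw [← Real.norm_eq_abs]
  refine (norm_integral_le_lintegral_norm _).trans (le_of_eq ?_)
  simp
end

section
/- Let (Ω,𝒜,T,μ,ℱ,‖·‖,χ) fulfill Property 𝔇 and assume μ(χ>x)=L(x)/x^α for all x>0, where L is slowly varying and 0<α<1. Let (b_n) be a sequence of natural numbers tending to infinity with b_n=o(n), and assume that at least one ψ-mixing coefficient of the sequence (χ∘T^{n-1})_{n∈ℕ} is strictly less than one. Then ∫ S_n^{b_n}χ dμ ∼ d_n as n→∞, where d_n := (α/(1-α))·n^{1/α}·b_n^{1-1/α}·ℓ^#((n/b_n)^{1/α}). -/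
open MeasureTheory Filter Topology ENNReal

lemma list_take_countP (l : List ℝ) (hl : l.Pairwise (· ≤ ·)) (t : ℝ) (b : ℕ) :
    (l.take (l.length - b)).countP (fun x => decide (t < x)) =
      l.countP (fun x => decide (t < x)) - b := by
  induction l with
  | nil => simp
  | cons a l ih =>
    rw [List.pairwise_cons] at hl
    by_cases ha : t < a
    · have h1 : ∀ x ∈ (a :: l), t < x := by
        intro x hx
        rcases List.mem_cons.1 hx with rfl | hx
        · exact ha
        · exact ha.trans_le (hl.1 x hx)
      rw [List.countP_eq_length.2, List.countP_eq_length.2]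
      · simp
      · simpa using h1
      · intro x hx
        simpa using h1 x (List.mem_of_mem_take hx)
    · rw [List.countP_cons_of_neg (by simpa using ha)]
      by_cases hb : b ≤ l.length
      · have : (a :: l).length - b = (l.length - b) + 1 := by simp; omega
        rw [this, List.take_succ_cons, List.countP_cons_of_neg (by simpa using ha), ih hl.2]
      · have h0 : (a :: l).length - b = 0 := by simp; omega
        have := List.countP_le_length (p := fun x => decide (t < x)) (l := l)
        rw [h0]; simp; omega

lemma list_ofReal_sum (l : List ℝ) (hl : ∀ x ∈ l, 0 ≤ x) :
    ENNReal.ofReal l.sum =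
      ∫⁻ t in Set.Ioi (0:ℝ), ((l.countP (fun x => decide (t < x)) : ℕ) : ℝ≥0∞) := by
  induction l with
  | nil => simp
  | cons a l ih =>
    have ha : 0 ≤ a := hl a (by simp)
    have hl' : ∀ x ∈ l, 0 ≤ x := fun x hx => hl x (by simp [hx])
    rw [List.sum_cons, ENNReal.ofReal_add ha (List.sum_nonneg hl'), ih hl']
    have e : ∀ t : ℝ, (((a :: l).countP (fun x => decide (t < x)) : ℕ) : ℝ≥0∞) =
        (Set.Iio a).indicator 1 t + ((l.countP (fun x => decide (t < x)) : ℕ) : ℝ≥0∞) := by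
      intro t
      rw [List.countP_cons]
      by_cases h : t < a <;> simp [h, add_comm]
    simp_rw [e]
    rw [lintegral_add_left (measurable_one.indicator measurableSet_Iio)]
    congr 1
    rw [lintegral_indicator_one measurableSet_Iio, Measure.restrict_apply measurableSet_Iio,
      Set.inter_comm, Set.Ioi_inter_Iio, Real.volume_Ioo]
    simp

/-- number of exceedances of level `t` along the orbit at times `s + r i`, `i < m` -/
noncomputable def cnt {Ω : Type*} (T : Ω → Ω) (χ : Ω → ℝ) (t : ℝ) (r s m : ℕ) (ω : Ω) : ℕ :=
  ∑ i ∈ Finset.range m, if t < χ (T^[s + r * i] ω) then 1 else 0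

lemma cnt_le {Ω : Type*} (T : Ω → Ω) (χ : Ω → ℝ) (t : ℝ) (r s m : ℕ) (ω : Ω) :
    cnt T χ t r s m ω ≤ m := by
  unfold cnt
  calc _ ≤ ∑ i ∈ Finset.range m, 1 := Finset.sum_le_sum (fun i _ => by split_ifs <;> simp)
    _ = m := by simp

lemma list_countP_map_range {Ω : Type*} (T : Ω → Ω) (χ : Ω → ℝ) (t : ℝ) (n : ℕ) (ω : Ω) :
    (((List.range n).map fun k => χ (T^[k] ω)).countP (fun x => decide (t < x))) =
      cnt T χ t 1 0 n ω := by
  induction n with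
  | zero => simp [cnt]
  | succ n ih =>
    rw [List.range_succ, List.map_append, List.countP_append, ih]
    unfold cnt
    rw [Finset.sum_range_succ]
    by_cases h : t < χ (T^[n] ω) <;> simp [h]

lemma trimmed_ofReal {Ω : Type*} (T : Ω → Ω) (χ : Ω → ℝ) (hχ : ∀ ω, 0 ≤ χ ω) (n b : ℕ) (ω : Ω) :
    0 ≤ trimmedSumN T χ n b ω ∧ ENNReal.ofReal (trimmedSumN T χ n b ω) =
      ∫⁻ t in Set.Ioi (0:ℝ), ((cnt T χ t 1 0 n ω - b : ℕ) : ℝ≥0∞) := by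
  unfold trimmedSumN
  set l0 := (List.range n).map fun k => χ (T^[k] ω) with hl0
  set l := l0.mergeSort (fun a b => a ≤ b) with hl
  have hp : l.Perm l0 := List.mergeSort_perm _ _
  have hs : l.Pairwise (· ≤ ·) := by
    have := List.pairwise_mergeSort (le := fun a b : ℝ => decide (a ≤ b))
      (by intro a b c; simp; exact le_trans) (by intro a b; simp; exact le_total a b) l0
    simpa using this
  have hlen : l.length = n := by rw [hp.length_eq]; simp [hl0]
  have hnn : ∀ x ∈ l.take (n - b), 0 ≤ x := by
    intro x hx
    have := hp.subset (List.mem_of_mem_take hx)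
    simp only [hl0, List.mem_map] at this
    obtain ⟨k, _, rfl⟩ := this
    exact hχ _
  refine ⟨List.sum_nonneg hnn, ?_⟩
  rw [list_ofReal_sum _ hnn]
  refine lintegral_congr fun t => ?_
  congr 1
  rw [← list_countP_map_range, ← hl0, ← hp.countP_eq, ← list_take_countP l hs, hlen]

lemma cnt_measurable_prod {Ω : Type*} [MeasurableSpace Ω] (T : Ω → Ω) (χ : Ω → ℝ)
    (hT : Measurable T) (hχ : Measurable χ) (r s m : ℕ) :
    Measurable (fun z : Ω × ℝ => cnt T χ z.2 r s m z.1) := by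
  unfold cnt
  refine Finset.measurable_sum _ fun i _ => ?_
  refine Measurable.ite ?_ measurable_const measurable_const
  exact measurableSet_lt measurable_snd ((hχ.comp (hT.iterate _)).comp measurable_fst)

lemma cnt_measurable {Ω : Type*} [MeasurableSpace Ω] (T : Ω → Ω) (χ : Ω → ℝ)
    (hT : Measurable T) (hχ : Measurable χ) (t : ℝ) (r s m : ℕ) :
    Measurable (fun ω => cnt T χ t r s m ω) :=
  (cnt_measurable_prod T χ hT hχ r s m).comp (measurable_id.prodMk measurable_const)

lemma integrable_of_nat_bdd {Ω : Type*} [MeasurableSpace Ω] (μ : Measure Ω) [IsFiniteMeasure μ]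
    (f : Ω → ℕ) (hf : Measurable f) (m : ℕ) (hm : ∀ ω, f ω ≤ m) (u : ℕ → ℝ) :
    Integrable (fun ω => u (f ω)) μ := by
  refine Integrable.of_bound ((measurable_from_top (f := u)).comp hf).aestronglyMeasurable
    (∑ a ∈ Finset.range (m+1), |u a|) (Eventually.of_forall fun ω => ?_)
  rw [Real.norm_eq_abs]
  exact Finset.single_le_sum (f := fun a => |u a|) (fun _ _ => abs_nonneg _)
    (Finset.mem_range.2 (Nat.lt_succ_of_le (hm ω)))

lemma trimmed_integral {Ω : Type*} [MeasurableSpace Ω] (T : Ω → Ω) (χ : Ω → ℝ) (μ : Measure Ω)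
    [IsProbabilityMeasure μ]
    (hT : Measurable T) (hχ : Measurable χ) (hχ0 : ∀ ω, 0 ≤ χ ω) (n b : ℕ) :
    Measurable (fun t => ∫ ω, ((cnt T χ t 1 0 n ω - b : ℕ) : ℝ) ∂μ) ∧
    ∫ ω, trimmedSumN T χ n b ω ∂μ =
      ∫ t in Set.Ioi (0:ℝ), (∫ ω, ((cnt T χ t 1 0 n ω - b : ℕ) : ℝ) ∂μ) := by
  have hm : Measurable (fun z : Ω × ℝ => ((cnt T χ z.2 1 0 n z.1 - b : ℕ) : ℝ≥0∞)) :=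
    (measurable_from_top (f := fun k : ℕ => ((k - b : ℕ) : ℝ≥0∞))).comp
      (cnt_measurable_prod T χ hT hχ 1 0 n)
  have hmr : Measurable (fun z : Ω × ℝ => ((cnt T χ z.2 1 0 n z.1 - b : ℕ) : ℝ)) :=
    (measurable_from_top (f := fun k : ℕ => ((k - b : ℕ) : ℝ))).comp
      (cnt_measurable_prod T χ hT hχ 1 0 n)
  have hE : Measurable (fun t => ∫ ω, ((cnt T χ t 1 0 n ω - b : ℕ) : ℝ) ∂μ) :=
    (hmr.stronglyMeasurable.integral_prod_left (μ := μ)).measurable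
  refine ⟨hE, ?_⟩
  have hmeas : Measurable (fun ω => trimmedSumN T χ n b ω) := by
    have : (fun ω => trimmedSumN T χ n b ω) = fun ω =>
        (∫⁻ t in Set.Ioi (0:ℝ), ((cnt T χ t 1 0 n ω - b : ℕ) : ℝ≥0∞)).toReal := by
      funext ω
      obtain ⟨h1, h2⟩ := trimmed_ofReal T χ hχ0 n b ω
      rw [← h2, ENNReal.toReal_ofReal h1]
    rw [this]
    exact (Measurable.lintegral_prod_right hm).ennreal_toReal
  rw [integral_eq_lintegral_of_nonneg_ae
    (Eventually.of_forall fun ω => (trimmed_ofReal T χ hχ0 n b ω).1) hmeas.aestronglyMeasurable,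
    integral_eq_lintegral_of_nonneg_ae
    (Eventually.of_forall fun t => integral_nonneg fun ω => by positivity) hE.aestronglyMeasurable]
  congr 1
  simp_rw [fun ω => (trimmed_ofReal T χ hχ0 n b ω).2]
  rw [lintegral_lintegral_swap hm.aemeasurable]
  refine lintegral_congr fun t => ?_
  rw [ofReal_integral_eq_lintegral_ofReal]
  · simp
  · exact integrable_of_nat_bdd μ _ (cnt_measurable T χ hT hχ t 1 0 n) n
      (fun ω => cnt_le _ _ _ _ _ _ _) (fun k => ((k - b : ℕ) : ℝ))
  · exact Eventually.of_forall fun ω => by positivity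

lemma psi_bound {Ω : Type*} [MeasurableSpace Ω] (μ : Measure Ω) [IsProbabilityMeasure μ]
    (T : Ω → Ω) (χ : Ω → ℝ) (r : ℕ) (h : psiCoeff μ T χ r < 1) :
    ∃ ρ : ℝ, 0 ≤ ρ ∧ ρ < 1 ∧ ∀ k : ℕ, 1 ≤ k → ∀ B C : Set Ω,
      MeasurableSet[sigmaIcc T χ 1 k] B → MeasurableSet[sigmaIci T χ (k + r)] C →
      |μ.real (B ∩ C) - μ.real B * μ.real C| ≤ ρ * (μ.real B * μ.real C) := by
  refine ⟨(psiCoeff μ T χ r).toReal, ENNReal.toReal_nonneg, ?_, ?_⟩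
  · have := (ENNReal.toReal_lt_toReal h.ne_top ENNReal.one_ne_top).2 h
    simpa using this
  intro k hk B C hB hC
  rcases eq_or_ne (μ B) 0 with h0 | h0
  · have : μ (B ∩ C) = 0 := measure_mono_null Set.inter_subset_left h0
    simp [Measure.real, h0, this]
  rcases eq_or_ne (μ C) 0 with h1 | h1
  · have : μ (B ∩ C) = 0 := measure_mono_null Set.inter_subset_right h1
    simp [Measure.real, h1, this]
  have hle : ENNReal.ofReal |(μ (B ∩ C)).toReal / ((μ B).toReal * (μ C).toReal) - 1| ≤
      psiCoeff μ T χ r := by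
    refine le_trans ?_ (le_iSup₂ (f := fun (k : ℕ) (_ : 1 ≤ k) =>
      psiDep μ (sigmaIcc T χ 1 k) (sigmaIci T χ (k + r))) k hk)
    unfold psiDep
    refine le_iSup_of_le B (le_iSup_of_le C (le_iSup_of_le hB (le_iSup_of_le hC
      (le_iSup_of_le (pos_iff_ne_zero.2 h0) (le_iSup_of_le (pos_iff_ne_zero.2 h1) le_rfl)))))
  have h2 := (ENNReal.ofReal_le_iff_le_toReal h.ne_top).1 hle
  have pB : 0 < μ.real B := ENNReal.toReal_pos h0 (measure_ne_top _ _)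
  have pC : 0 < μ.real C := ENNReal.toReal_pos h1 (measure_ne_top _ _)
  have e : μ.real (B ∩ C) - μ.real B * μ.real C =
      (μ.real (B ∩ C) / (μ.real B * μ.real C) - 1) * (μ.real B * μ.real C) := by
    field_simp
  rw [e, abs_mul, abs_of_pos (mul_pos pB pC)]
  exact mul_le_mul_of_nonneg_right h2 (mul_pos pB pC).le

lemma sum_expand {Ω : Type*} [MeasurableSpace Ω] (μ : Measure Ω) [IsProbabilityMeasure μ]
    (f g : Ω → ℕ) (hf : Measurable f) (hg : Measurable g) (m m' : ℕ)
    (hfm : ∀ ω, f ω ≤ m) (hgm : ∀ ω, g ω ≤ m') (w : ℕ → ℕ → ℝ) :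
    ∫ ω, w (f ω) (g ω) ∂μ = ∑ a ∈ Finset.range (m+1), ∑ c ∈ Finset.range (m'+1),
      w a c * μ.real ({ω | f ω = a} ∩ {ω | g ω = c}) := by
  have hS : ∀ a c, MeasurableSet ({ω | f ω = a} ∩ {ω | g ω = c}) := fun a c =>
    (hf (measurableSet_singleton a)).inter (hg (measurableSet_singleton c))
  have : ∀ ω, w (f ω) (g ω) = ∑ a ∈ Finset.range (m+1), ∑ c ∈ Finset.range (m'+1),
      ({ω | f ω = a} ∩ {ω | g ω = c}).indicator (fun _ => w a c) ω := by
    intro ω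
    rw [Finset.sum_eq_single (f ω), Finset.sum_eq_single (g ω)]
    · simp
    · intro c _ hc; rw [Set.indicator_of_notMem]; simp; exact fun h => hc h.symm
    · intro h; exact absurd (Finset.mem_range.2 (Nat.lt_succ_of_le (hgm ω))) h
    · intro a _ ha
      refine Finset.sum_eq_zero fun c _ => ?_
      rw [Set.indicator_of_notMem]; simp; exact fun h => absurd h.symm ha
    · intro h; exact absurd (Finset.mem_range.2 (Nat.lt_succ_of_le (hfm ω))) h
  simp_rw [this]
  have hi : ∀ a c, Integrable (({ω | f ω = a} ∩ {ω | g ω = c}).indicator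
      (fun _ => w a c)) μ := fun a c => (integrable_const _).indicator (hS a c)
  rw [integral_finsetSum _ fun a _ => integrable_finsetSum _ fun c _ => hi a c]
  refine Finset.sum_congr rfl fun a _ => ?_
  rw [integral_finsetSum _ fun c _ => hi a c]
  refine Finset.sum_congr rfl fun c _ => ?_
  rw [integral_indicator_const _ (hS a c), smul_eq_mul, mul_comm]

lemma sum_expand1 {Ω : Type*} [MeasurableSpace Ω] (μ : Measure Ω) [IsProbabilityMeasure μ]
    (f : Ω → ℕ) (hf : Measurable f) (m : ℕ)
    (hfm : ∀ ω, f ω ≤ m) (w : ℕ → ℝ) :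
    ∫ ω, w (f ω) ∂μ = ∑ a ∈ Finset.range (m+1), w a * μ.real {ω | f ω = a} := by
  have := sum_expand μ f (fun _ => 0) hf measurable_const m 0 hfm (by simp) (fun a _ => w a)
  simpa using this

lemma cov_bound {Ω : Type*} [MeasurableSpace Ω] (μ : Measure Ω) [IsProbabilityMeasure μ]
    (f g : Ω → ℕ) (hf : Measurable f) (hg : Measurable g) (m m' : ℕ)
    (hfm : ∀ ω, f ω ≤ m) (hgm : ∀ ω, g ω ≤ m') (ρ : ℝ)
    (h : ∀ a c, |μ.real ({ω | f ω = a} ∩ {ω | g ω = c}) -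
      μ.real {ω | f ω = a} * μ.real {ω | g ω = c}| ≤
      ρ * (μ.real {ω | f ω = a} * μ.real {ω | g ω = c})) (u v : ℕ → ℝ) :
    |∫ ω, u (f ω) * v (g ω) ∂μ - (∫ ω, u (f ω) ∂μ) * (∫ ω, v (g ω) ∂μ)| ≤
      ρ * ((∫ ω, |u (f ω)| ∂μ) * (∫ ω, |v (g ω)| ∂μ)) := by
  rw [sum_expand μ f g hf hg m m' hfm hgm (fun a c => u a * v c),
    sum_expand1 μ f hf m hfm u, sum_expand1 μ g hg m' hgm v,
    sum_expand1 μ f hf m hfm (fun a => |u a|), sum_expand1 μ g hg m' hgm (fun a => |v a|),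
    Finset.sum_mul_sum, Finset.sum_mul_sum, ← Finset.sum_sub_distrib, Finset.mul_sum]
  refine (Finset.abs_sum_le_sum_abs _ _).trans (Finset.sum_le_sum fun a _ => ?_)
  rw [← Finset.sum_sub_distrib, Finset.mul_sum]
  refine (Finset.abs_sum_le_sum_abs _ _).trans (Finset.sum_le_sum fun c _ => ?_)
  have e : u a * v c * μ.real ({ω | f ω = a} ∩ {ω | g ω = c}) -
      u a * μ.real {ω | f ω = a} * (v c * μ.real {ω | g ω = c}) =
      (u a * v c) * (μ.real ({ω | f ω = a} ∩ {ω | g ω = c}) -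
      μ.real {ω | f ω = a} * μ.real {ω | g ω = c}) := by ring
  rw [e, abs_mul, abs_mul]
  calc _ ≤ |u a| * |v c| * (ρ * (μ.real {ω | f ω = a} * μ.real {ω | g ω = c})) :=
        mul_le_mul_of_nonneg_left (h a c) (by positivity)
    _ = _ := by ring

lemma cnt_eq_comp {Ω : Type*} (T : Ω → Ω) (χ : Ω → ℝ) (t : ℝ) (r s m : ℕ) (ω : Ω) :
    cnt T χ t r s m ω = cnt T χ t r 0 m (T^[s] ω) := by
  unfold cnt
  refine Finset.sum_congr rfl fun i _ => ?_
  rw [← Function.iterate_add_apply, zero_add, add_comm]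

lemma cnt_add {Ω : Type*} (T : Ω → Ω) (χ : Ω → ℝ) (t : ℝ) (r s m m' : ℕ) (ω : Ω) :
    cnt T χ t r s (m + m') ω = cnt T χ t r s m ω + cnt T χ t r (s + r * m) m' ω := by
  unfold cnt
  rw [Finset.sum_range_add]
  congr 1
  refine Finset.sum_congr rfl fun i _ => ?_
  congr 4; ring

lemma cnt_meas_gen {Ω : Type*} [m0 : MeasurableSpace Ω] (T : Ω → Ω) (χ : Ω → ℝ) (t : ℝ)
    (r s m : ℕ) (h : ∀ i < m, MeasurableSet {ω | t < χ (T^[s + r * i] ω)}) :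
    Measurable (cnt T χ t r s m) := by
  unfold cnt
  refine Finset.measurable_sum _ fun i hi => ?_
  exact Measurable.ite (h i (Finset.mem_range.1 hi)) measurable_const measurable_const

lemma cnt_meas_past {Ω : Type*} [MeasurableSpace Ω] (T : Ω → Ω) (χ : Ω → ℝ) (t : ℝ)
    (r m a : ℕ) (hm : 1 ≤ m) :
    MeasurableSet[sigmaIcc T χ 1 (r * (m - 1) + 1)] {ω | cnt T χ t r 0 m ω = a} := by
  have : @Measurable _ _ (sigmaIcc T χ 1 (r * (m - 1) + 1)) _ (cnt T χ t r 0 m) := by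
    refine cnt_meas_gen (m0 := sigmaIcc T χ 1 (r * (m - 1) + 1)) T χ t r _ m fun i hi => ?_
    have hle : MeasurableSpace.comap (fun ω => χ (T^[(r * i + 1) - 1] ω)) inferInstance ≤
        sigmaIcc T χ 1 (r * (m - 1) + 1) := by
      unfold sigmaIcc
      refine le_iSup₂ (f := fun (k : ℕ) (_ : k ∈ Set.Icc 1 (r * (m - 1) + 1)) =>
        MeasurableSpace.comap (fun ω => χ (T^[k - 1] ω)) inferInstance) (r * i + 1) ?_
      have : i ≤ m - 1 := by omega
      exact ⟨by omega, by gcongr⟩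
    refine hle _ ⟨Set.Ioi t, measurableSet_Ioi, ?_⟩
    ext ω; simp
  exact this (measurableSet_singleton a)

lemma cnt_meas_future {Ω : Type*} [MeasurableSpace Ω] (T : Ω → Ω) (χ : Ω → ℝ) (t : ℝ)
    (r s m a : ℕ) :
    MeasurableSet[sigmaIci T χ (s + 1)] {ω | cnt T χ t r s m ω = a} := by
  have : @Measurable _ _ (sigmaIci T χ (s + 1)) _ (cnt T χ t r s m) := by
    refine cnt_meas_gen (m0 := sigmaIci T χ (s + 1)) T χ t r _ m fun i hi => ?_
    have hle : MeasurableSpace.comap (fun ω => χ (T^[(s + r * i + 1) - 1] ω)) inferInstance ≤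
        sigmaIci T χ (s + 1) := by
      unfold sigmaIci
      refine le_iSup₂ (f := fun (k : ℕ) (_ : k ∈ Set.Ici (s + 1)) =>
        MeasurableSpace.comap (fun ω => χ (T^[k - 1] ω)) inferInstance) (s + r * i + 1) ?_
      exact Set.mem_Ici.2 (by omega)
    refine hle _ ⟨Set.Ioi t, measurableSet_Ioi, ?_⟩
    ext ω; simp
  exact this (measurableSet_singleton a)

/-- Standing assumptions extracted from the hypotheses. -/
structure Setup {Ω : Type*} [MeasurableSpace Ω] (T : Ω → Ω) (μ : Measure Ω) (χ : Ω → ℝ)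
    (r : ℕ) (ρ : ℝ) : Prop where
  mp : MeasurePreserving T μ μ
  meas : Measurable χ
  r1 : 1 ≤ r
  ρ0 : 0 ≤ ρ
  ρ1 : ρ < 1
  mix : ∀ (t : ℝ) (m m' a c : ℕ), |μ.real ({ω | cnt T χ t r 0 m ω = a} ∩
      {ω | cnt T χ t r (r * m) m' ω = c}) -
      μ.real {ω | cnt T χ t r 0 m ω = a} * μ.real {ω | cnt T χ t r (r * m) m' ω = c}| ≤
      ρ * (μ.real {ω | cnt T χ t r 0 m ω = a} * μ.real {ω | cnt T χ t r (r * m) m' ω = c})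

lemma setup_of {Ω : Type*} [MeasurableSpace Ω] (T : Ω → Ω) (μ : Measure Ω)
    [IsProbabilityMeasure μ] (χ : Ω → ℝ) (hT : MeasurePreserving T μ μ) (hχ : Measurable χ)
    (r : ℕ) (hr : 1 ≤ r) (h : psiCoeff μ T χ r < 1) : ∃ ρ, Setup T μ χ r ρ := by
  obtain ⟨ρ, h0, h1, h2⟩ := psi_bound μ T χ r h
  refine ⟨ρ, hT, hχ, hr, h0, h1, ?_⟩
  intro t m m' a c
  rcases Nat.eq_zero_or_pos m with rfl | hm
  · by_cases ha : a = 0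
    · subst ha
      simp only [cnt, Finset.range_zero, Finset.sum_empty, Set.ofPred_true, Set.univ_inter,
        probReal_univ, one_mul, sub_self, abs_zero]
      positivity
    · have : ∀ ω, ¬ (cnt T χ t r 0 0 ω = a) := by
        intro ω; simp [cnt]; exact fun h => ha h.symm
      simp [this]
  · refine h2 (r * (m - 1) + 1) (by omega) _ _ (cnt_meas_past T χ t r m a hm) ?_
    have := cnt_meas_future T χ t r (r * m) m' c
    have e : r * (m - 1) + 1 + r = r * m + 1 := by
      obtain ⟨k, rfl⟩ : ∃ k, m = k + 1 := ⟨m - 1, by omega⟩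
      simp; ring
    rwa [e]

section moments
variable {Ω : Type*} [MeasurableSpace Ω] {T : Ω → Ω} {μ : Measure Ω} [IsProbabilityMeasure μ]
  {χ : Ω → ℝ} {r : ℕ} {ρ : ℝ}

lemma cnt_int_shift (hT : MeasurePreserving T μ μ) (hχ : Measurable χ) (t : ℝ) (r s m : ℕ)
    (u : ℕ → ℝ) :
    ∫ ω, u (cnt T χ t r s m ω) ∂μ = ∫ ω, u (cnt T χ t r 0 m ω) ∂μ := by
  simp_rw [fun ω => cnt_eq_comp T χ t r s m ω]
  have h := hT.iterate s
  conv_rhs => rw [← h.map_eq]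
  rw [integral_map h.measurable.aemeasurable]
  exact ((measurable_from_top (f := u)).comp
    (cnt_measurable T χ hT.measurable hχ t r 0 m)).aestronglyMeasurable

lemma cnt_integrable (hT : MeasurePreserving T μ μ) (hχ : Measurable χ) (t : ℝ) (r s m : ℕ)
    (u : ℕ → ℝ) : Integrable (fun ω => u (cnt T χ t r s m ω)) μ :=
  integrable_of_nat_bdd μ _ (cnt_measurable T χ hT.measurable hχ t r s m) m
    (fun ω => cnt_le _ _ _ _ _ _ _) u

lemma cnt_mean (hT : MeasurePreserving T μ μ) (hχ : Measurable χ) (t : ℝ) (r s m : ℕ) :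
    ∫ ω, (cnt T χ t r s m ω : ℝ) ∂μ = m * μ.real {ω | t < χ ω} := by
  induction m with
  | zero => simp [cnt]
  | succ m ih =>
    have h1 : ∫ ω, (cnt T χ t r (s + r * m) 1 ω : ℝ) ∂μ = μ.real {ω | t < χ ω} := by
      rw [cnt_int_shift hT hχ t r (s + r * m) 1 (fun k => (k : ℝ))]
      have : ∀ ω, (cnt T χ t r 0 1 ω : ℝ) = ({ω | t < χ ω} : Set Ω).indicator 1 ω := by
        intro ω
        by_cases h : t < χ ω
        · simp only [cnt, Finset.sum_range_one]; simp [h]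
        · simp only [cnt, Finset.sum_range_one]; simp [h]
      simp_rw [this]
      rw [integral_indicator_one (measurableSet_lt measurable_const hχ)]
    simp_rw [fun ω => cnt_add T χ t r s m 1 ω]
    push_cast
    rw [integral_add (cnt_integrable hT hχ t r s m (fun k => (k : ℝ)))
      (cnt_integrable hT hχ t r _ 1 (fun k => (k : ℝ))), ih, h1]
    ring

lemma cnt_choose (hS : Setup T μ χ r ρ) (t : ℝ) (k m : ℕ) :
    ∫ ω, ((cnt T χ t r 0 m ω).choose k : ℝ) ∂μ ≤ (2 * (m * μ.real {ω | t < χ ω})) ^ k := by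
  set p := μ.real {ω | t < χ ω} with hp
  have hp0 : 0 ≤ p := measureReal_nonneg
  induction k generalizing m with
  | zero => simp
  | succ k ihk =>
    suffices h : ∫ ω, ((cnt T χ t r 0 m ω).choose (k + 1) : ℝ) ∂μ ≤
        ∑ i ∈ Finset.range m, 2 * p * (2 * (i * p)) ^ k by
      refine h.trans ?_
      calc _ ≤ ∑ i ∈ Finset.range m, 2 * p * (2 * (m * p)) ^ k := by
            refine Finset.sum_le_sum fun i hi => ?_
            have : (i : ℝ) ≤ m := by exact_mod_cast (Finset.mem_range.1 hi).le
            gcongr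
        _ = _ := by simp; ring
    induction m with
    | zero => simp [cnt]
    | succ m ihm =>
      rw [Finset.sum_range_succ]
      have hle1 : ∀ ω, cnt T χ t r (r * m) 1 ω ≤ 1 := fun ω => cnt_le _ _ _ _ _ _ _
      have e : ∀ ω, ((cnt T χ t r 0 (m + 1) ω).choose (k + 1) : ℝ) =
          ((cnt T χ t r 0 m ω).choose (k + 1) : ℝ) +
          ((cnt T χ t r 0 m ω).choose k : ℝ) * (cnt T χ t r (r * m) 1 ω : ℝ) := by
        intro ω
        rw [cnt_add, zero_add]
        rcases Nat.le_one_iff_eq_zero_or_eq_one.1 (hle1 ω) with h | h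
        · rw [h]; simp
        · rw [h, Nat.choose_succ_succ]; push_cast; ring
      simp_rw [e]
      have hb := cov_bound μ _ _ (cnt_measurable T χ hS.mp.measurable hS.meas t r 0 m)
        (cnt_measurable T χ hS.mp.measurable hS.meas t r (r * m) 1) m 1
        (fun ω => cnt_le _ _ _ _ _ _ _) (fun ω => cnt_le _ _ _ _ _ _ _) ρ
        (fun a c => hS.mix t m 1 a c) (fun a => (a.choose k : ℝ)) (fun a => (a : ℝ))
      simp only [Nat.abs_cast] at hb
      rw [cnt_mean hS.mp hS.meas, ← hp] at hb
      have hI : Integrable (fun ω => ((cnt T χ t r 0 m ω).choose k : ℝ) *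
          (cnt T χ t r (r * m) 1 ω : ℝ)) μ := by
        have := (cnt_integrable hS.mp hS.meas t r 0 (m + 1) (fun a => (a.choose (k+1) : ℝ))).sub
          (cnt_integrable hS.mp hS.meas t r 0 m (fun a => (a.choose (k+1) : ℝ)))
        refine this.congr (Eventually.of_forall fun ω => ?_)
        simp only [Pi.sub_apply]
        rw [e]; ring
      rw [integral_add (cnt_integrable hS.mp hS.meas t r 0 m (fun a => (a.choose (k+1) : ℝ))) hI]
      refine add_le_add ihm ?_
      have h0 : 0 ≤ ∫ ω, ((cnt T χ t r 0 m ω).choose k : ℝ) ∂μ :=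
        integral_nonneg fun ω => by positivity
      have h2 := (abs_le.1 hb).2
      have h3 := ihk m
      have h4 : (∫ ω, ((cnt T χ t r 0 m ω).choose k : ℝ) ∂μ) * p * ρ ≤
        (∫ ω, ((cnt T χ t r 0 m ω).choose k : ℝ) ∂μ) * p * 1 :=
          mul_le_mul_of_nonneg_left hS.ρ1.le (by positivity)
      have h5 := mul_le_mul_of_nonneg_left h3 hp0
      push_cast at h2
      nlinarith

/-- the variance of the counts -/
noncomputable def VV (T : Ω → Ω) (μ : Measure Ω) (χ : Ω → ℝ) (r : ℕ) (t : ℝ) (m : ℕ) : ℝ :=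
  ∫ ω, ((cnt T χ t r 0 m ω : ℝ) - m * μ.real {ω | t < χ ω}) ^ 2 ∂μ

lemma VV_nonneg (t : ℝ) (m : ℕ) : 0 ≤ VV T μ χ r t m := integral_nonneg fun ω => by positivity

lemma abs_le_sqrt_VV (hS : Setup T μ χ r ρ) (t : ℝ) (s m : ℕ) :
    (∫ ω, |(cnt T χ t r s m ω : ℝ) - m * μ.real {ω | t < χ ω}| ∂μ) ^ 2 ≤ VV T μ χ r t m := by
  unfold VV
  set p := μ.real {ω | t < χ ω} with hp
  rw [cnt_int_shift hS.mp hS.meas t r s m (fun k => |(k : ℝ) - m * p|)]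
  set c := ∫ ω, |(cnt T χ t r 0 m ω : ℝ) - m * p| ∂μ with hc
  have h : 0 ≤ ∫ ω, (|(cnt T χ t r 0 m ω : ℝ) - m * p| - c) ^ 2 ∂μ :=
    integral_nonneg fun ω => by positivity
  have e : ∀ ω, (|(cnt T χ t r 0 m ω : ℝ) - m * p| - c) ^ 2 =
      ((cnt T χ t r 0 m ω : ℝ) - m * p) ^ 2 -
        ((2 * c) * |(cnt T χ t r 0 m ω : ℝ) - m * p| - c ^ 2) := by
    intro ω
    rw [← sq_abs ((cnt T χ t r 0 m ω : ℝ) - m * p)]; ring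
  simp_rw [e] at h
  have i1 := cnt_integrable (μ := μ) hS.mp hS.meas t r 0 m (fun k => |(k : ℝ) - m * p|)
  rw [integral_sub (cnt_integrable hS.mp hS.meas t r 0 m (fun k => ((k : ℝ) - m * p) ^ 2))
    (cnt_integrable hS.mp hS.meas t r 0 m (fun k => 2 * c * |(k : ℝ) - m * p| - c ^ 2)),
    integral_sub (i1.const_mul _) (integrable_const _),
    integral_const_mul, ← hc] at h
  simp at h
  nlinarith

lemma VV_add (hS : Setup T μ χ r ρ) (t : ℝ) (m m' : ℕ) :
    VV T μ χ r t (m + m') ≤ (1 + ρ) * (VV T μ χ r t m + VV T μ χ r t m') := by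
  set p := μ.real {ω | t < χ ω} with hp
  have hb := cov_bound μ _ _ (cnt_measurable T χ hS.mp.measurable hS.meas t r 0 m)
        (cnt_measurable T χ hS.mp.measurable hS.meas t r (r * m) m') m m'
        (fun ω => cnt_le _ _ _ _ _ _ _) (fun ω => cnt_le _ _ _ _ _ _ _) ρ
        (fun a c => hS.mix t m m' a c) (fun a => (a : ℝ) - m * p) (fun a => (a : ℝ) - m' * p)
  have z : ∫ ω, ((cnt T χ t r 0 m ω : ℝ) - m * p) ∂μ = 0 := by
    rw [integral_sub (cnt_integrable hS.mp hS.meas t r 0 m (fun k => (k : ℝ)))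
      (integrable_const _), cnt_mean hS.mp hS.meas]
    simp [hp]
  rw [z, zero_mul, sub_zero] at hb
  have a1 := abs_le_sqrt_VV hS t 0 m
  have a2 := abs_le_sqrt_VV hS t (r * m) m'
  rw [← hp] at a1 a2
  set x := ∫ ω, |(cnt T χ t r 0 m ω : ℝ) - m * p| ∂μ
  set y := ∫ ω, |(cnt T χ t r (r * m) m' ω : ℝ) - m' * p| ∂μ
  set w := ∫ ω, ((cnt T χ t r 0 m ω : ℝ) - m * p) * ((cnt T χ t r (r * m) m' ω : ℝ) - m' * p) ∂μ
  have hsh : ∫ ω, ((cnt T χ t r (r * m) m' ω : ℝ) - m' * p) ^ 2 ∂μ = VV T μ χ r t m' := by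
    unfold VV
    rw [cnt_int_shift hS.mp hS.meas t r (r * m) m' (fun k => ((k : ℝ) - m' * p) ^ 2)]
  have i1 := cnt_integrable (μ := μ) hS.mp hS.meas t r 0 m (fun k => ((k : ℝ) - m * p) ^ 2)
  have i2 := cnt_integrable (μ := μ) hS.mp hS.meas t r (r * m) m'
    (fun k => ((k : ℝ) - m' * p) ^ 2)
  have i3 := cnt_integrable (μ := μ) hS.mp hS.meas t r 0 (m + m')
    (fun k => ((k : ℝ) - ((m + m' : ℕ) : ℝ) * p) ^ 2)
  have e : ∀ ω, ((cnt T χ t r 0 m ω : ℝ) - m * p) * ((cnt T χ t r (r * m) m' ω : ℝ) - m' * p) =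
      (1 / 2) * ((((cnt T χ t r 0 (m + m') ω : ℝ) - ((m + m' : ℕ) : ℝ) * p) ^ 2 -
      ((cnt T χ t r 0 m ω : ℝ) - m * p) ^ 2) - ((cnt T χ t r (r * m) m' ω : ℝ) - m' * p) ^ 2) := by
    intro ω
    rw [cnt_add, zero_add]; push_cast; ring
  have hw : w = (1 / 2) * (VV T μ χ r t (m + m') - VV T μ χ r t m - VV T μ χ r t m') := by
    have : w = ∫ ω, (1 / 2) * ((((cnt T χ t r 0 (m + m') ω : ℝ) - ((m + m' : ℕ) : ℝ) * p) ^ 2 -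
      ((cnt T χ t r 0 m ω : ℝ) - m * p) ^ 2) -
      ((cnt T χ t r (r * m) m' ω : ℝ) - m' * p) ^ 2) ∂μ := integral_congr_ae
        (Eventually.of_forall e)
    have i4 : Integrable (fun ω => ((cnt T χ t r 0 (m + m') ω : ℝ) - ((m + m' : ℕ) : ℝ) * p) ^ 2 -
      ((cnt T χ t r 0 m ω : ℝ) - m * p) ^ 2) μ := i3.sub i1
    rw [this, integral_const_mul, integral_sub i4 i2, integral_sub i3 i1, hsh]
    rfl
  have h2 := (abs_le.1 hb).2
  have h3 : x * y ≤ (VV T μ χ r t m + VV T μ χ r t m') / 2 := by nlinarith [sq_nonneg (x - y)]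
  have h4 := mul_le_mul_of_nonneg_left h3 hS.ρ0
  rw [hw] at h2
  linarith

lemma VV_crude (hS : Setup T μ χ r ρ) (t : ℝ) (m : ℕ) :
    VV T μ χ r t m ≤ m * μ.real {ω | t < χ ω} + 8 * (m * μ.real {ω | t < χ ω}) ^ 2 := by
  have hc := cnt_choose hS t 2 m
  have hm := cnt_mean (μ := μ) hS.mp hS.meas t r 0 m
  unfold VV
  set p := μ.real {ω | t < χ ω} with hp
  have i1 := cnt_integrable (μ := μ) hS.mp hS.meas t r 0 m (fun k => (k.choose 2 : ℝ))
  have i2 := cnt_integrable (μ := μ) hS.mp hS.meas t r 0 m (fun k => (k : ℝ))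
  have e : ∀ ω, ((cnt T χ t r 0 m ω : ℝ) - m * p) ^ 2 =
      (2 * ((cnt T χ t r 0 m ω).choose 2 : ℝ) + (1 - 2 * (m * p)) * (cnt T χ t r 0 m ω : ℝ)) +
        (m * p) ^ 2 := by
    intro ω
    rw [Nat.cast_choose_two]; ring
  simp_rw [e]
  have i4 := cnt_integrable (μ := μ) hS.mp hS.meas t r 0 m
    (fun k => 2 * (k.choose 2 : ℝ) + (1 - 2 * (m * p)) * (k : ℝ))
  rw [integral_add i4 (integrable_const _),
    integral_add (i1.const_mul _) (i2.const_mul _), integral_const_mul, integral_const_mul, hm]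
  simp
  nlinarith [sq_nonneg (m * p)]

lemma VV_dyadic (hS : Setup T μ χ r ρ) (t : ℝ) (J q : ℕ) :
    VV T μ χ r t (2 ^ J * q) ≤ (2 * (1 + ρ)) ^ J * VV T μ χ r t q := by
  induction J with
  | zero => simp
  | succ J ih =>
    have e : 2 ^ (J + 1) * q = 2 ^ J * q + 2 ^ J * q := by ring
    rw [e]
    refine (VV_add hS t _ _).trans ?_
    have := hS.ρ0
    calc _ = 2 * (1 + ρ) * VV T μ χ r t (2 ^ J * q) := by ring
      _ ≤ 2 * (1 + ρ) * ((2 * (1 + ρ)) ^ J * VV T μ χ r t q) := by gcongr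
      _ = _ := by ring

lemma VV_bound (hS : Setup T μ χ r ρ) (t : ℝ) (J m : ℕ) :
    VV T μ χ r t m ≤ 16 * ((1 + ρ) / 2) ^ J * (m * μ.real {ω | t < χ ω}) ^ 2 +
      2 * 4 ^ J * (m * μ.real {ω | t < χ ω}) + 18 * 4 ^ J := by
  set p := μ.real {ω | t < χ ω} with hp
  have hp0 : 0 ≤ p := measureReal_nonneg
  have hp1 : p ≤ 1 := measureReal_le_one
  have hρ := hS.ρ0
  have hρ1 := hS.ρ1
  obtain ⟨q, s, hs, hm⟩ : ∃ q s : ℕ, s < 2 ^ J ∧ m = 2 ^ J * q + s :=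
    ⟨m / 2 ^ J, m % 2 ^ J, Nat.mod_lt _ (by positivity), (Nat.div_add_mod _ _).symm⟩
  have h1 : VV T μ χ r t m ≤ 2 * (VV T μ χ r t (2 ^ J * q) + VV T μ χ r t s) := by
    rw [hm]
    refine (VV_add hS t _ _).trans ?_
    have := VV_nonneg (T := T) (μ := μ) (χ := χ) (r := r) t (2 ^ J * q)
    have := VV_nonneg (T := T) (μ := μ) (χ := χ) (r := r) t s
    gcongr; linarith
  have h2 := VV_dyadic hS t J q
  have h3 := VV_crude hS t q
  have h4 := VV_crude hS t s
  rw [← hp] at h3 h4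
  have hs' : (s : ℝ) ≤ 2 ^ J := by exact_mod_cast hs.le
  have hq' : (2 : ℝ) ^ J * q ≤ m := by
    have : 2 ^ J * q ≤ m := by omega
    exact_mod_cast this
  have hsp : s * p ≤ 2 ^ J := by
    calc s * p ≤ 2 ^ J * 1 := by gcongr
      _ = _ := by ring
  have hsp0 : 0 ≤ s * p := by positivity
  have h24 : (2 : ℝ) ^ J ≤ 4 ^ J := by gcongr; norm_num
  have e4 : (4 : ℝ) ^ J = 2 ^ J * 2 ^ J := by rw [← mul_pow]; norm_num
  have h5 : VV T μ χ r t s ≤ 9 * 4 ^ J := by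
    have : (s * p) ^ 2 ≤ (2 ^ J) ^ 2 := by gcongr
    nlinarith
  have ea : (2 * (1 + ρ)) ^ J = ((1 + ρ) / 2) ^ J * 4 ^ J := by
    rw [← mul_pow]; congr 1; ring
  have h6 : (2 * (1 + ρ)) ^ J * VV T μ χ r t q ≤
      4 ^ J * (m * p) + 8 * ((1 + ρ) / 2) ^ J * (m * p) ^ 2 := by
    have hq0 : (q : ℝ) ≤ m := by
      refine le_trans ?_ hq'
      have : (1 : ℝ) ≤ 2 ^ J := one_le_pow₀ (by norm_num)
      nlinarith [Nat.cast_nonneg (α := ℝ) q]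
    calc _ ≤ (2 * (1 + ρ)) ^ J * (q * p + 8 * (q * p) ^ 2) := by gcongr
      _ = (2 * (1 + ρ)) ^ J * (q * p) + 8 * ((1 + ρ) / 2) ^ J * ((2 ^ J * q) * p) ^ 2 := by
          rw [ea, e4]; ring
      _ ≤ 4 ^ J * (m * p) + 8 * ((1 + ρ) / 2) ^ J * (m * p) ^ 2 := by
          gcongr; linarith
  linarith

end moments

lemma cnt_split {Ω : Type*} (T : Ω → Ω) (χ : Ω → ℝ) (t : ℝ) (r q : ℕ) (ω : Ω) :
    cnt T χ t 1 0 (r * q) ω = ∑ j ∈ Finset.range r, cnt T χ t r j q ω := by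
  induction q with
  | zero => simp [cnt]
  | succ q ih =>
    rw [Nat.mul_succ, cnt_add, ih]
    simp_rw [fun j => cnt_add T χ t r j q 1 ω]
    rw [Finset.sum_add_distrib]
    congr 1
    unfold cnt
    refine Finset.sum_congr rfl fun j _ => ?_
    rw [Finset.sum_range_one]
    congr 4
    ring

lemma cnt_mono {Ω : Type*} (T : Ω → Ω) (χ : Ω → ℝ) (t : ℝ) (r s m m' : ℕ) (h : m ≤ m') (ω : Ω) :
    cnt T χ t r s m ω ≤ cnt T χ t r s m' ω := by
  obtain ⟨d, rfl⟩ := Nat.exists_eq_add_of_le h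
  rw [cnt_add]; omega

lemma cast_tsub_eq_max (a b : ℕ) : ((a - b : ℕ) : ℝ) = max ((a : ℝ) - b) 0 := by
  rcases le_total b a with h | h
  · rw [Nat.cast_sub h, max_eq_left]; simpa using h
  · rw [Nat.sub_eq_zero_of_le h, max_eq_right] <;> simp [h]

lemma tsub_le_choose (x k : ℕ) (hk : 1 ≤ k) (c : ℝ) (hc : 2 * k ≤ c) :
    max ((x : ℝ) - c) 0 ≤ 2 ^ k * k.factorial / c ^ (k - 1) * (x.choose k : ℝ) := by
  have hk' : (1 : ℝ) ≤ k := by exact_mod_cast hk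
  have hc0 : 0 < c := by linarith
  refine max_le ?_ (by positivity)
  rcases le_total (x : ℝ) c with h | h
  · have : 0 ≤ 2 ^ k * k.factorial / c ^ (k - 1) * (x.choose k : ℝ) := by positivity
    linarith
  have hx : 2 * k ≤ x := by exact_mod_cast hc.trans h
  have h1 : ((x + 1 - k : ℕ) : ℝ) ^ k ≤ k.factorial * (x.choose k : ℝ) := by
    have := Nat.pow_sub_le_descFactorial x k
    rw [Nat.descFactorial_eq_factorial_mul_choose] at this
    exact_mod_cast this
  have h2 : (x : ℝ) / 2 ≤ ((x + 1 - k : ℕ) : ℝ) := by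
    rw [Nat.cast_sub (by omega)]
    have : (2 * k : ℝ) ≤ x := by exact_mod_cast hx
    push_cast; linarith
  have h3 : ((x : ℝ) / 2) ^ k ≤ k.factorial * (x.choose k : ℝ) :=
    le_trans (by gcongr) h1
  have h4 : (x : ℝ) * c ^ (k - 1) ≤ (x : ℝ) ^ k := by
    calc (x : ℝ) * c ^ (k - 1) ≤ x * (x : ℝ) ^ (k - 1) := by gcongr
      _ = _ := by rw [← pow_succ']; congr 1; omega
  have h5 : (x : ℝ) ^ k ≤ 2 ^ k * (k.factorial * (x.choose k : ℝ)) := by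
    rw [div_pow, div_le_iff₀ (by positivity)] at h3
    linarith
  rw [div_mul_eq_mul_div, le_div_iff₀ (by positivity)]
  have : 0 ≤ c * c ^ (k - 1) := by positivity
  nlinarith

section total
variable {Ω : Type*} [MeasurableSpace Ω] {T : Ω → Ω} {μ : Measure Ω} [IsProbabilityMeasure μ]
  {χ : Ω → ℝ} {r : ℕ} {ρ : ℝ}

/-- expected overshoot -/
noncomputable def ee (T : Ω → Ω) (μ : Measure Ω) (χ : Ω → ℝ) (n b : ℕ) (t : ℝ) : ℝ :=
  ∫ ω, ((cnt T χ t 1 0 n ω - b : ℕ) : ℝ) ∂μ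

lemma ee_nonneg (n b : ℕ) (t : ℝ) : 0 ≤ ee T μ χ n b t :=
  integral_nonneg fun ω => by positivity

lemma ee_le_mean (hS : Setup T μ χ r ρ) (n b : ℕ) (t : ℝ) :
    ee T μ χ n b t ≤ n * μ.real {ω | t < χ ω} := by
  rw [← cnt_mean hS.mp hS.meas t 1 0 n]
  refine integral_mono (cnt_integrable hS.mp hS.meas t 1 0 n (fun k => ((k - b : ℕ) : ℝ)))
    (cnt_integrable hS.mp hS.meas t 1 0 n (fun k => (k : ℝ))) fun ω => ?_
  simp only
  exact_mod_cast Nat.sub_le _ _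

lemma cnt_lln (hS : Setup T μ χ r ρ) (n : ℕ) (t : ℝ) :
    ∫ ω, |(cnt T χ t 1 0 n ω : ℝ) - n * μ.real {ω | t < χ ω}| ∂μ ≤
      r * √(VV T μ χ r t (n / r)) + r := by
  set p := μ.real {ω | t < χ ω} with hp
  have hp0 : 0 ≤ p := measureReal_nonneg
  have hp1 : p ≤ 1 := measureReal_le_one
  set q := n / r
  set s := n % r with hs
  have hsr : s < r := Nat.mod_lt _ hS.r1
  have hn : n = r * q + s := (Nat.div_add_mod n r).symm
  have hsr' : (s : ℝ) ≤ r := by exact_mod_cast hsr.le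
  have hi : ∀ j, Integrable (fun ω => |(cnt T χ t r j q ω : ℝ) - q * p|) μ := fun j =>
    cnt_integrable hS.mp hS.meas t r j q (fun k => |(k : ℝ) - q * p|)
  have hpt : ∀ ω, |(cnt T χ t 1 0 n ω : ℝ) - n * p| ≤
      (∑ j ∈ Finset.range r, |(cnt T χ t r j q ω : ℝ) - q * p|) + r := by
    intro ω
    have e : (cnt T χ t 1 0 n ω : ℝ) - n * p =
        (∑ j ∈ Finset.range r, ((cnt T χ t r j q ω : ℝ) - q * p)) +
        ((cnt T χ t 1 (r * q) s ω : ℝ) - s * p) := by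
      have e1 : cnt T χ t 1 0 n ω = cnt T χ t 1 0 (r * q) ω + cnt T χ t 1 (r * q) s ω := by
        conv_lhs => rw [hn]
        rw [cnt_add]; simp
      have e2 : (n : ℝ) = r * q + s := by exact_mod_cast hn
      rw [e1, cnt_split, e2]
      push_cast
      rw [Finset.sum_sub_distrib]
      simp; ring
    rw [e]
    refine (abs_add_le _ _).trans (add_le_add (Finset.abs_sum_le_sum_abs _ _) ?_)
    have h1 : (cnt T χ t 1 (r * q) s ω : ℝ) ≤ s := by exact_mod_cast cnt_le T χ t 1 (r * q) s ω
    have h2 : (0 : ℝ) ≤ cnt T χ t 1 (r * q) s ω := by positivity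
    have h3 : s * p ≤ s := mul_le_of_le_one_right (by positivity) hp1
    have h4 : 0 ≤ s * p := by positivity
    rw [abs_le]; constructor <;> linarith
  calc _ ≤ ∫ ω, ((∑ j ∈ Finset.range r, |(cnt T χ t r j q ω : ℝ) - q * p|) + r) ∂μ :=
        integral_mono (cnt_integrable hS.mp hS.meas t 1 0 n (fun k => |(k : ℝ) - n * p|))
          ((integrable_finsetSum _ fun j _ => hi j).add (integrable_const _)) hpt
    _ = (∑ j ∈ Finset.range r, ∫ ω, |(cnt T χ t r j q ω : ℝ) - q * p| ∂μ) + r := by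
        rw [integral_add (integrable_finsetSum _ fun j _ => hi j) (integrable_const _),
          integral_finsetSum _ fun j _ => hi j]
        simp
    _ ≤ (∑ j ∈ Finset.range r, √(VV T μ χ r t q)) + r := by
        gcongr with j _
        exact Real.le_sqrt_of_sq_le (abs_le_sqrt_VV hS t j q)
    _ = _ := by simp

lemma ee_near (hS : Setup T μ χ r ρ) (n b : ℕ) (t : ℝ) :
    |ee T μ χ n b t - max (n * μ.real {ω | t < χ ω} - b) 0| ≤
      r * √(VV T μ χ r t (n / r)) + r := by
  refine le_trans ?_ (cnt_lln hS n t)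
  set p := μ.real {ω | t < χ ω} with hp
  have i1 := cnt_integrable (μ := μ) hS.mp hS.meas t 1 0 n (fun k => ((k - b : ℕ) : ℝ))
  have e : ee T μ χ n b t - max (n * p - b) 0 =
      ∫ ω, (((cnt T χ t 1 0 n ω - b : ℕ) : ℝ) - max (n * p - b) 0) ∂μ := by
    rw [integral_sub i1 (integrable_const _)]; simp [ee]
  rw [e]
  refine (abs_integral_le_integral_abs).trans ?_
  refine integral_mono (i1.sub (integrable_const _)).abs
    (cnt_integrable hS.mp hS.meas t 1 0 n (fun k => |(k : ℝ) - n * p|)) fun ω => ?_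
  simp only
  rw [cast_tsub_eq_max]
  refine (abs_max_sub_max_le_abs _ _ _).trans (le_of_eq ?_)
  congr 1; ring

lemma ee_tail (hS : Setup T μ χ r ρ) (n b k : ℕ) (t : ℝ) (hn : 1 ≤ n) (hk : 1 ≤ k)
    (hb : 2 * k * r ≤ b) :
    ee T μ χ n b t ≤ r * (2 ^ k * k.factorial / ((b : ℝ) / r) ^ (k - 1) *
      (4 * (n * μ.real {ω | t < χ ω})) ^ k) := by
  set p := μ.real {ω | t < χ ω} with hp
  have hp0 : 0 ≤ p := measureReal_nonneg
  have hr : (0 : ℝ) < r := by exact_mod_cast hS.r1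
  set m := n / r + 1 with hm
  have hnm : n ≤ r * m := by
    have := Nat.div_add_mod n r
    have h2 : n % r < r := Nat.mod_lt _ hS.r1
    rw [hm, Nat.mul_succ]; omega
  have hm2 : (m : ℝ) ≤ 2 * n := by
    have : n / r ≤ n := Nat.div_le_self _ _
    have : m ≤ 2 * n := by omega
    exact_mod_cast this
  set c := (b : ℝ) / r with hc
  have hck : 2 * (k : ℝ) ≤ c := by
    rw [hc, le_div_iff₀ hr]; exact_mod_cast hb
  have hc0 : 0 < c := by
    have : (1 : ℝ) ≤ k := by exact_mod_cast hk
    linarith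
  set D := 2 ^ k * k.factorial / c ^ (k - 1) with hD
  have hD0 : 0 ≤ D := by positivity
  have hi : ∀ j, Integrable (fun ω => D * ((cnt T χ t r j m ω).choose k : ℝ)) μ := fun j =>
    cnt_integrable hS.mp hS.meas t r j m (fun x => D * (x.choose k : ℝ))
  have hpt : ∀ ω, ((cnt T χ t 1 0 n ω - b : ℕ) : ℝ) ≤
      ∑ j ∈ Finset.range r, D * ((cnt T χ t r j m ω).choose k : ℝ) := by
    intro ω
    rw [cast_tsub_eq_max]
    refine max_le ?_ (Finset.sum_nonneg fun j _ => by positivity)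
    have h1 : (cnt T χ t 1 0 n ω : ℝ) ≤ ∑ j ∈ Finset.range r, (cnt T χ t r j m ω : ℝ) := by
      have := cnt_mono T χ t 1 0 n (r * m) hnm ω
      rw [cnt_split] at this
      exact_mod_cast this
    have h2 : (b : ℝ) = ∑ j ∈ Finset.range r, c := by
      simp [hc]; field_simp
    calc (cnt T χ t 1 0 n ω : ℝ) - b ≤ ∑ j ∈ Finset.range r, ((cnt T χ t r j m ω : ℝ) - c) := by
          rw [Finset.sum_sub_distrib, ← h2]; linarith
      _ ≤ _ := Finset.sum_le_sum fun j _ =>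
        (le_max_left _ _).trans (tsub_le_choose (cnt T χ t r j m ω) k hk c hck)
  calc ee T μ χ n b t ≤ ∫ ω, ∑ j ∈ Finset.range r, D * ((cnt T χ t r j m ω).choose k : ℝ) ∂μ :=
        integral_mono (cnt_integrable hS.mp hS.meas t 1 0 n (fun k => ((k - b : ℕ) : ℝ)))
          (integrable_finsetSum _ fun j _ => hi j) hpt
    _ = ∑ j ∈ Finset.range r, D * ∫ ω, ((cnt T χ t r 0 m ω).choose k : ℝ) ∂μ := by
        rw [integral_finsetSum _ fun j _ => hi j]
        refine Finset.sum_congr rfl fun j _ => ?_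
        rw [integral_const_mul, cnt_int_shift hS.mp hS.meas t r j m (fun x => (x.choose k : ℝ))]
    _ ≤ ∑ j ∈ Finset.range r, D * (4 * (n * p)) ^ k := by
        gcongr with j _
        refine (cnt_choose hS t k m).trans ?_
        rw [← hp]
        gcongr ?_ ^ k
        nlinarith
    _ = _ := by simp

lemma ee_pointwise (hS : Setup T μ χ r ρ) (b : ℕ → ℕ) (hb : Tendsto b atTop atTop)
    (t : ℕ → ℝ) (l : ℝ)
    (h : Tendsto (fun n : ℕ => (n : ℝ) * μ.real {ω | t n < χ ω} / b n) atTop (𝓝 l)) :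
    Tendsto (fun n => ee T μ χ n (b n) (t n) / b n) atTop (𝓝 (max (l - 1) 0)) := by
  set x : ℕ → ℝ := fun n => (n : ℝ) * μ.real {ω | t n < χ ω} / b n with hx
  have hbr : Tendsto (fun n => (b n : ℝ)) atTop atTop := tendsto_natCast_atTop_atTop.comp hb
  have hbinv : Tendsto (fun n => (b n : ℝ)⁻¹) atTop (𝓝 0) := tendsto_inv_atTop_zero.comp hbr
  have hbpos : ∀ᶠ n in atTop, (0 : ℝ) < b n := hbr.eventually_gt_atTop 0
  have hx0 : ∀ n, 0 ≤ x n := fun n => by positivity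
  -- the normalized variance tends to zero
  have hV : Tendsto (fun n => VV T μ χ r (t n) (n / r) / (b n) ^ 2) atTop (𝓝 0) := by
    rw [tendsto_order]
    constructor
    · intro a ha
      exact Eventually.of_forall fun n => ha.trans_le
        (div_nonneg (VV_nonneg _ _) (by positivity))
    · intro ε hε
      have hθ : Tendsto (fun J : ℕ => 16 * ((1 + ρ) / 2) ^ J * l ^ 2) atTop (𝓝 (16 * 0 * l ^ 2)) :=
        ((_root_.tendsto_pow_atTop_nhds_zero_of_lt_one (by linarith [hS.ρ0])
          (by linarith [hS.ρ1])).const_mul _).mul_const _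
      rw [mul_zero, zero_mul] at hθ
      obtain ⟨J, hJ⟩ := ((tendsto_order.1 hθ).2 ε hε).exists
      have hlim : Tendsto (fun n => 16 * ((1 + ρ) / 2) ^ J * (x n) ^ 2 +
          2 * 4 ^ J * (x n) * (b n : ℝ)⁻¹ + 18 * 4 ^ J * ((b n : ℝ)⁻¹) ^ 2) atTop
          (𝓝 (16 * ((1 + ρ) / 2) ^ J * l ^ 2 + 2 * 4 ^ J * l * 0 + 18 * 4 ^ J * 0 ^ 2)) :=
        (((h.pow 2).const_mul _).add ((h.const_mul _).mul hbinv)).add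
          ((hbinv.pow 2).const_mul _)
      have hlt : 16 * ((1 + ρ) / 2) ^ J * l ^ 2 + 2 * 4 ^ J * l * 0 + 18 * 4 ^ J * 0 ^ 2 < ε := by
        simpa using hJ
      filter_upwards [(tendsto_order.1 hlim).2 ε hlt, hbpos] with n h1 h2
      refine lt_of_le_of_lt ?_ h1
      have hv := VV_bound hS (t n) J (n / r)
      set p := μ.real {ω | t n < χ ω} with hp
      have hp0 : 0 ≤ p := measureReal_nonneg
      have hqn : ((n / r : ℕ) : ℝ) * p ≤ n * p := by
        gcongr; exact Nat.div_le_self _ _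
      have hxn : x n * b n = n * p := by simp only [hx]; exact div_mul_cancel₀ _ h2.ne'
      have hρ0 := hS.ρ0
      rw [div_le_iff₀ (by positivity)]
      have e : (16 * ((1 + ρ) / 2) ^ J * (x n) ^ 2 +
          2 * 4 ^ J * (x n) * (b n : ℝ)⁻¹ + 18 * 4 ^ J * ((b n : ℝ)⁻¹) ^ 2) * (b n : ℝ) ^ 2 =
          16 * ((1 + ρ) / 2) ^ J * (x n * b n) ^ 2 + 2 * 4 ^ J * (x n * b n) + 18 * 4 ^ J := by
        field_simp
      rw [e, hxn]
      refine hv.trans ?_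
      gcongr
  have hsq : Tendsto (fun n => r * √(VV T μ χ r (t n) (n / r) / (b n) ^ 2) + r * (b n : ℝ)⁻¹)
      atTop (𝓝 0) := by
    have := ((hV.sqrt).const_mul (r : ℝ)).add (hbinv.const_mul (r : ℝ))
    simpa using this
  have hmax : Tendsto (fun n => max (x n - 1) 0) atTop (𝓝 (max (l - 1) 0)) :=
    (h.sub_const 1).max tendsto_const_nhds
  have hdiff : Tendsto (fun n => ee T μ χ n (b n) (t n) / b n - max (x n - 1) 0) atTop (𝓝 0) := by
    refine squeeze_zero_norm' ?_ hsq
    filter_upwards [hbpos] with n hn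
    have h1 := ee_near hS n (b n) (t n)
    set p := μ.real {ω | t n < χ ω} with hp
    have e : ee T μ χ n (b n) (t n) / b n - max (x n - 1) 0 =
        (ee T μ χ n (b n) (t n) - max (n * p - b n) 0) / b n := by
      have : max (n * p - b n) 0 = max (x n - 1) 0 * b n := by
        rw [max_mul_of_nonneg _ _ hn.le]
        simp only [hx, ← hp]
        congr 1
        · field_simp
        · ring
      rw [this]; field_simp
    rw [e, Real.norm_eq_abs, abs_div, abs_of_pos hn, Real.sqrt_div' _ (by positivity),
      Real.sqrt_sq hn.le, div_le_iff₀ hn]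
    refine h1.trans (le_of_eq ?_)
    field_simp
  simpa using hdiff.add hmax

end total

lemma potter_upper (G : ℝ → ℝ) (hG : Antitone G) (hpos : ∀ x, 0 < x → 0 < G x) (β x0 : ℝ)
    (hβ : 0 < β) (hx0 : 0 < x0) (h : ∀ x, x0 ≤ x → G (2 * x) ≤ 2 ^ (-β) * G x)
    (x s : ℝ) (hx : x0 ≤ x) (hs : 1 ≤ s) : G (x * s) ≤ 2 ^ β * s ^ (-β) * G x := by
  obtain ⟨j, hj1, hj2⟩ := exists_nat_pow_near hs (by norm_num : (1 : ℝ) < 2)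
  have hxp : 0 < x := hx0.trans_le hx
  have it : ∀ j : ℕ, G (2 ^ j * x) ≤ ((2 : ℝ) ^ j) ^ (-β) * G x := by
    intro j
    induction j with
    | zero => simp
    | succ j ih =>
      have h1 : x0 ≤ 2 ^ j * x := by
        have : (1 : ℝ) ≤ 2 ^ j := one_le_pow₀ (by norm_num)
        nlinarith
      have h2 := h _ h1
      rw [← mul_assoc, ← pow_succ'] at h2
      refine h2.trans ?_
      rw [pow_succ' (2 : ℝ) j, Real.mul_rpow (by norm_num) (by positivity), mul_assoc]
      gcongr
  have hs0 : 0 < s := by linarith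
  calc G (x * s) ≤ G (2 ^ j * x) := hG (by nlinarith)
    _ ≤ ((2 : ℝ) ^ j) ^ (-β) * G x := it j
    _ ≤ (s / 2) ^ (-β) * G x := by
        have := (hpos x hxp).le
        refine mul_le_mul_of_nonneg_right ?_ this
        refine Real.rpow_le_rpow_of_nonpos (by positivity) ?_ (by linarith)
        rw [pow_succ] at hj2; linarith
    _ = _ := by
        rw [Real.div_rpow hs0.le (by norm_num), Real.rpow_neg (by norm_num : (0:ℝ) ≤ 2) β]
        field_simp

lemma potter_lower (G : ℝ → ℝ) (hG : Antitone G) (hpos : ∀ x, 0 < x → 0 < G x) (γ x0 : ℝ)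
    (hγ : 0 < γ) (hx0 : 0 < x0) (h : ∀ x, x0 ≤ x → G x ≤ 2 ^ γ * G (2 * x))
    (x s : ℝ) (hx : x0 ≤ x) (hs : 1 ≤ s) : G x ≤ 2 ^ γ * s ^ γ * G (x * s) := by
  obtain ⟨j, hj1, hj2⟩ := exists_nat_pow_near hs (by norm_num : (1 : ℝ) < 2)
  have hxp : 0 < x := hx0.trans_le hx
  have it : ∀ j : ℕ, G x ≤ ((2 : ℝ) ^ j) ^ γ * G (2 ^ j * x) := by
    intro j
    induction j with
    | zero => simp
    | succ j ih =>
      have h1 : x0 ≤ 2 ^ j * x := by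
        have : (1 : ℝ) ≤ 2 ^ j := one_le_pow₀ (by norm_num)
        nlinarith
      have h2 := h _ h1
      rw [← mul_assoc, ← pow_succ'] at h2
      refine ih.trans ?_
      rw [pow_succ (2 : ℝ) j, Real.mul_rpow (by positivity) (by norm_num), mul_assoc]
      rw [pow_succ] at h2
      gcongr
  have hs0 : 0 < s := by linarith
  calc G x ≤ ((2 : ℝ) ^ (j + 1)) ^ γ * G (2 ^ (j + 1) * x) := it (j + 1)
    _ ≤ (2 * s) ^ γ * G (x * s) := by
        have h1 : G (2 ^ (j + 1) * x) ≤ G (x * s) := hG (by nlinarith)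
        have h2 : (2 : ℝ) ^ (j + 1) ≤ 2 * s := by rw [pow_succ]; linarith
        have := (hpos (2 ^ (j + 1) * x) (by positivity)).le
        gcongr
    _ = _ := by rw [Real.mul_rpow (by norm_num) hs0.le]

lemma sv_pos (ls : ℝ → ℝ) (h : SlowlyVarying ls) (hf : ∃ᶠ x in atTop, 0 < ls x) :
    ∀ᶠ x in atTop, 0 < ls x := by
  have key : ∀ c : ℝ, 0 < c → ∀ᶠ x in atTop, (0 < ls (c * x) ↔ 0 < ls x) := by
    intro c hc
    filter_upwards [(tendsto_order.1 (h c hc)).1 0 one_pos] with x hx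
    rcases div_pos_iff.1 hx with h | h
    · exact ⟨fun _ => h.2, fun _ => h.1⟩
    · exact ⟨fun h' => absurd h' (not_lt.2 h.1.le), fun h' => absurd h' (not_lt.2 h.2.le)⟩
  obtain ⟨M, hM⟩ := eventually_atTop.1 ((key 2 two_pos).and (eventually_gt_atTop 0))
  have it : ∀ j : ℕ, ∀ x, M ≤ x → (0 < ls (2 ^ j * x) ↔ 0 < ls x) := by
    intro j x hx
    have hx0 := (hM x hx).2
    induction j with
    | zero => simp
    | succ j ih =>
      have h1 : M ≤ 2 ^ j * x := by
        have : (1 : ℝ) ≤ 2 ^ j := one_le_pow₀ (by norm_num)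
        nlinarith
      have := (hM _ h1).1
      rw [← mul_assoc, ← pow_succ'] at this
      exact this.trans ih
  obtain ⟨x1, hx1, hx1M⟩ := (hf.and_eventually (eventually_ge_atTop M)).exists
  filter_upwards [eventually_ge_atTop M] with x2 hx2
  have p1 := (hM x1 hx1M).2
  have p2 := (hM x2 hx2).2
  have hc : 0 < x2 / x1 := by positivity
  have ht : Tendsto (fun j : ℕ => (2 : ℝ) ^ j * x1) atTop atTop :=
    (tendsto_pow_atTop_atTop_of_one_lt (by norm_num)).atTop_mul_const p1
  obtain ⟨j, hj⟩ := (ht.eventually (key _ hc)).exists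
  have e : x2 / x1 * (2 ^ j * x1) = 2 ^ j * x2 := by field_simp
  rw [e, it j x1 hx1M, it j x2 hx2] at hj
  exact hj.2 hx1

section rv
variable {G L ls : ℝ → ℝ} {α : ℝ}

lemma G_ratio (hL : SlowlyVarying L) (hα0 : 0 < α)
    (hG : ∀ x, 0 < x → G x = L x / x ^ α) (c : ℝ) (hc : 0 < c) :
    Tendsto (fun x => G (c * x) / G x) atTop (𝓝 (c ^ (-α))) := by
  have := (hL c hc).mul_const (c ^ (-α))
  rw [one_mul] at this
  refine this.congr' ?_
  filter_upwards [eventually_gt_atTop 0] with x hx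
  rw [hG x hx, hG (c * x) (by positivity), Real.mul_rpow hc.le hx.le, Real.rpow_neg hc.le]
  have : x ^ α ≠ 0 := by positivity
  have : c ^ α ≠ 0 := by positivity
  by_cases hL0 : L x = 0
  · simp [hL0]
  field_simp

lemma G_potter (hL : SlowlyVarying L) (hα0 : 0 < α) (hanti : Antitone G)
    (hpos : ∀ x, 0 < x → 0 < G x)
    (hG : ∀ x, 0 < x → G x = L x / x ^ α) (β γ : ℝ) (hβ : 0 < β) (hβα : β < α) (hγ : α < γ) :
    ∃ x0 : ℝ, 0 < x0 ∧ (∀ x s, x0 ≤ x → 1 ≤ s → G (x * s) ≤ 2 ^ β * s ^ (-β) * G x) ∧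
      (∀ x s, x0 ≤ x → 1 ≤ s → G x ≤ 2 ^ γ * s ^ γ * G (x * s)) := by
  have h2 := G_ratio hL hα0 hG 2 two_pos
  have l1 : (2 : ℝ) ^ (-α) < 2 ^ (-β) := Real.rpow_lt_rpow_of_exponent_lt (by norm_num) (by linarith)
  have l2 : (2 : ℝ) ^ (-γ) < 2 ^ (-α) := Real.rpow_lt_rpow_of_exponent_lt (by norm_num) (by linarith)
  obtain ⟨x0, hx0⟩ := eventually_atTop.1 (((tendsto_order.1 h2).2 _ l1).and
    ((tendsto_order.1 h2).1 _ l2))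
  have hm : 0 < max x0 1 := lt_max_of_lt_right one_pos
  refine ⟨max x0 1, hm, fun x s hx hs => ?_, fun x s hx hs => ?_⟩
  · refine potter_upper G hanti hpos β (max x0 1) hβ hm (fun y hy => ?_) x s hx hs
    have := (hx0 y ((le_max_left _ _).trans hy)).1
    rw [div_lt_iff₀ (hpos y (hm.trans_le hy))] at this
    exact this.le
  · refine potter_lower G hanti hpos γ (max x0 1) (by linarith) hm (fun y hy => ?_) x s hx hs
    have := (hx0 y ((le_max_left _ _).trans hy)).2
    rw [lt_div_iff₀ (hpos y (hm.trans_le hy)), Real.rpow_neg (by norm_num)] at this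
    have h3 : (0 : ℝ) < 2 ^ γ := by positivity
    rw [inv_mul_lt_iff₀ h3] at this
    exact this.le

lemma G_zero (hL : SlowlyVarying L) (hα0 : 0 < α) (hanti : Antitone G)
    (hpos : ∀ x, 0 < x → 0 < G x)
    (hG : ∀ x, 0 < x → G x = L x / x ^ α) : Tendsto G atTop (𝓝 0) := by
  obtain ⟨x0, hx0, h1, -⟩ := G_potter hL hα0 hanti hpos hG (α / 2) (α + 1) (by linarith)
    (by linarith) (by linarith)
  have ht : Tendsto (fun y : ℝ => 2 ^ (α / 2) * (y / x0) ^ (-(α / 2)) * G x0) atTop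
      (𝓝 (2 ^ (α / 2) * 0 * G x0)) :=
    (((tendsto_rpow_neg_atTop (by linarith : 0 < α / 2)).comp
      (tendsto_id.atTop_div_const hx0)).const_mul _).mul_const _
  rw [mul_zero, zero_mul] at ht
  refine squeeze_zero' ?_ ?_ ht
  · filter_upwards [eventually_gt_atTop 0] with y hy using (hpos y hy).le
  · filter_upwards [eventually_ge_atTop x0] with y hy
    have := h1 x0 (y / x0) le_rfl (by rwa [le_div_iff₀ hx0, one_mul])
    rwa [mul_div_cancel₀ _ hx0.ne'] at this

lemma G_rpow (hLpos : ∀ x, 0 < x → 0 < L x) (hα0 : 0 < α)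
    (hG : ∀ x, 0 < x → G x = L x / x ^ α) (x : ℝ) (hx : 0 < x) :
    G x ^ (-(1 / α)) = x * L x ^ (-(1 / α)) := by
  rw [hG x hx, Real.div_rpow (hLpos x hx).le (by positivity), ← Real.rpow_mul hx.le]
  have : α * -(1 / α) = -1 := by field_simp
  rw [this, Real.rpow_neg_one]
  field_simp

lemma ls_pos (hL : SlowlyVarying L) (hLpos : ∀ x, 0 < x → 0 < L x) (hα0 : 0 < α)
    (hanti : Antitone G) (hpos : ∀ x, 0 < x → 0 < G x)
    (hG : ∀ x, 0 < x → G x = L x / x ^ α)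
    (hls : IsDeBruijnConjugate (fun x => L x ^ (-(1 / α))) ls) :
    ∀ᶠ x in atTop, 0 < ls x := by
  refine sv_pos ls hls.1 ?_
  have h0 := G_zero hL hα0 hanti hpos hG
  have ht : Tendsto (fun x => x * L x ^ (-(1 / α))) atTop atTop := by
    have h1 : Tendsto G atTop (𝓝[>] 0) := tendsto_nhdsWithin_iff.2 ⟨h0, by
      filter_upwards [eventually_gt_atTop 0] with y hy using hpos y hy⟩
    have h2 : Tendsto (fun x => ((G x)⁻¹) ^ (1 / α)) atTop atTop :=
      (tendsto_rpow_atTop (by positivity)).comp (tendsto_inv_nhdsGT_zero.comp h1)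
    refine h2.congr' ?_
    filter_upwards [eventually_gt_atTop 0] with x hx
    rw [← G_rpow hLpos hα0 hG x hx, Real.inv_rpow (hpos x hx).le, Real.rpow_neg (hpos x hx).le]
  have h3 : ∀ᶠ x in atTop, 0 < ls (x * L x ^ (-(1 / α))) := by
    filter_upwards [(tendsto_order.1 hls.2.1).1 0 one_pos, eventually_gt_atTop 0] with x h1 h2
    exact (mul_pos_iff_of_pos_left (Real.rpow_pos_of_pos (hLpos x h2) _)).1 h1
  exact ht.frequently h3.frequently

lemma quantile (hL : SlowlyVarying L) (hLpos : ∀ x, 0 < x → 0 < L x) (hα0 : 0 < α)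
    (hanti : Antitone G) (hpos : ∀ x, 0 < x → 0 < G x)
    (hG : ∀ x, 0 < x → G x = L x / x ^ α)
    (hls : IsDeBruijnConjugate (fun x => L x ^ (-(1 / α))) ls) :
    Tendsto (fun z => z ^ α * G (z * ls z)) atTop (𝓝 1) ∧
      Tendsto (fun z => z * ls z) atTop atTop := by
  have hp := ls_pos hL hLpos hα0 hanti hpos hG hls
  have h1 : Tendsto (fun z => z ^ α * G (z * ls z)) atTop (𝓝 1) := by
    have h2 := (hls.2.2.rpow_const (p := -α) (Or.inl one_ne_zero))
    rw [Real.one_rpow] at h2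
    refine h2.congr' ?_
    filter_upwards [hp, eventually_gt_atTop 0] with z hz hz0
    have hf : 0 < z * ls z := by positivity
    have hGf := hpos _ hf
    have e := G_rpow hLpos hα0 hG _ hf
    have e2 : ls z * L (z * ls z) ^ (-(1 / α)) = z⁻¹ * G (z * ls z) ^ (-(1 / α)) := by
      rw [e]; field_simp
    rw [e2, Real.mul_rpow (by positivity) (by positivity), ← Real.rpow_mul hGf.le,
      Real.inv_rpow hz0.le, Real.rpow_neg hz0.le, inv_inv]
    have : -(1 / α) * -α = 1 := by field_simp
    rw [this, Real.rpow_one]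
  refine ⟨h1, ?_⟩
  have h3 : Tendsto (fun z => G (z * ls z)) atTop (𝓝 0) := by
    have := h1.mul (tendsto_rpow_neg_atTop hα0)
    rw [mul_zero] at this
    refine this.congr' ?_
    filter_upwards [eventually_gt_atTop 0] with z hz
    rw [Real.rpow_neg hz.le]
    have : z ^ α ≠ 0 := by positivity
    field_simp
  rw [tendsto_atTop]
  intro M
  have hM : 0 < G (max M 1) := hpos _ (lt_max_of_lt_right one_pos)
  filter_upwards [(tendsto_order.1 h3).2 _ hM] with z hz
  by_contra hlt
  push Not at hlt
  exact absurd (hanti (hlt.le.trans (le_max_left M 1))) (not_le.2 hz)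

end rv

lemma limit_integral (α : ℝ) (hα0 : 0 < α) (hα1 : α < 1) :
    ∫ s in Set.Ioi (0:ℝ), max (s ^ (-α) - 1) 0 = α / (1 - α) := by
  have h1 : ∫ s in Set.Ioi (0:ℝ), max (s ^ (-α) - 1) 0 =
      ∫ s in Set.Ioc (0:ℝ) 1, max (s ^ (-α) - 1) 0 := by
    refine setIntegral_eq_of_subset_of_forall_diff_eq_zero measurableSet_Ioi
      Set.Ioc_subset_Ioi_self ?_
    intro s hs
    have hs1 : 1 < s := by
      by_contra h
      exact hs.2 ⟨hs.1, not_lt.1 h⟩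
    refine max_eq_right ?_
    have := Real.rpow_le_one_of_one_le_of_nonpos hs1.le (by linarith : -α ≤ 0)
    linarith
  have h2 : ∫ s in Set.Ioc (0:ℝ) 1, max (s ^ (-α) - 1) 0 =
      ∫ s in Set.Ioc (0:ℝ) 1, (s ^ (-α) - 1) := by
    refine setIntegral_congr_fun measurableSet_Ioc fun s hs => ?_
    refine max_eq_left ?_
    have := Real.one_le_rpow_of_pos_of_le_one_of_nonpos hs.1 hs.2 (by linarith : -α ≤ 0)
    linarith
  rw [h1, h2, ← intervalIntegral.integral_of_le zero_le_one, intervalIntegral.integral_sub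
    (intervalIntegral.intervalIntegrable_rpow' (by linarith)) (by simp), integral_rpow
    (Or.inl (by linarith))]
  have : -α + 1 ≠ 0 := by linarith
  have : 1 - α ≠ 0 := by linarith
  rw [Real.zero_rpow (by linarith)]
  simp
  field_simp
  ring

lemma bound_integrable (γ κ C1 C2 : ℝ) (hγ : γ < 1) (hκ : 1 < κ) :
    Integrable (fun s : ℝ => if s ≤ 1 then C1 * s ^ (-γ) else C2 * s ^ (-κ))
      (volume.restrict (Set.Ioi (0:ℝ))) := by
  have h : IntegrableOn (fun s : ℝ => if s ≤ 1 then C1 * s ^ (-γ) else C2 * s ^ (-κ))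
      (Set.Ioc 0 1 ∪ Set.Ioi 1) := by
    refine IntegrableOn.union ?_ ?_
    · have := (intervalIntegral.intervalIntegrable_rpow' (a := 0) (b := 1)
        (by linarith : -1 < -γ)).const_mul C1
      rw [intervalIntegrable_iff_integrableOn_Ioc_of_le zero_le_one] at this
      refine this.congr_fun (fun s hs => ?_) measurableSet_Ioc
      simp [hs.2]
    · have := (integrableOn_Ioi_rpow_of_lt (by linarith : -κ < -1) one_pos).const_mul C2
      refine IntegrableOn.congr_fun this (fun s hs => ?_) measurableSet_Ioi
      simp [not_le.2 (Set.mem_Ioi.1 hs)]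
  rwa [Set.Ioc_union_Ioi_eq_Ioi zero_le_one] at h

section mainproof
variable {Ω : Type*} [MeasurableSpace Ω] {T : Ω → Ω} {μ : Measure Ω} [IsProbabilityMeasure μ]
  {χ : Ω → ℝ} {r : ℕ} {ρ : ℝ}

lemma G_small {G : ℝ → ℝ} {γ x0 : ℝ} (hγ : 0 < γ) (hanti : Antitone G)
    (hpos : ∀ x, 0 < x → 0 < G x) (h1 : ∀ x, G x ≤ 1) (hx0 : 0 < x0)
    (h : ∀ x s, x0 ≤ x → 1 ≤ s → G x ≤ 2 ^ γ * s ^ γ * G (x * s))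
    (x s : ℝ) (hx : x0 ≤ x) (hs0 : 0 < s) (hs1 : s ≤ 1) :
    G (x * s) ≤ 2 ^ γ / G x0 * s ^ (-γ) * G x := by
  have g0 := hpos x0 hx0
  have gx := hpos x (hx0.trans_le hx)
  have hxp : 0 < x := hx0.trans_le hx
  have hA : 0 ≤ 2 ^ γ * s ^ (-γ) * G x := by positivity
  have hinv : (1 / s) ^ γ = s ^ (-γ) := by
    rw [one_div, Real.inv_rpow hs0.le, Real.rpow_neg hs0.le]
  have hr : 2 ^ γ / G x0 * s ^ (-γ) * G x = (2 ^ γ * s ^ (-γ) * G x) / G x0 := by ring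
  rw [hr, le_div_iff₀ g0]
  rcases le_total x0 (x * s) with hc | hc
  · have := h (x * s) (1 / s) hc (by rw [le_div_iff₀ hs0]; linarith)
    rw [hinv, show x * s * (1 / s) = x by field_simp] at this
    have g2 := hpos (x * s) (by positivity)
    nlinarith [h1 x0]
  · have h2 : 1 ≤ x / x0 := by rw [le_div_iff₀ hx0]; linarith
    have := h x0 (x / x0) le_rfl h2
    rw [show x0 * (x / x0) = x by field_simp] at this
    have h3 : (x / x0) ^ γ ≤ s ^ (-γ) := by
      rw [← hinv]
      refine Real.rpow_le_rpow (by positivity) ?_ hγ.le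
      rw [div_le_div_iff₀ hx0 hs0]; linarith
    have h4 : 2 ^ γ * (x / x0) ^ γ * G x ≤ 2 ^ γ * s ^ (-γ) * G x := by gcongr
    have g2 := hpos (x * s) (by positivity)
    nlinarith [h1 (x * s)]

lemma ee_tail' (hS : Setup T μ χ r ρ) (n b k : ℕ) (t : ℝ) (hn : 1 ≤ n) (hk : 1 ≤ k)
    (hb : 2 * k * r ≤ b) :
    ee T μ χ n b t / b ≤ (r * 2 ^ k * k.factorial * (r : ℝ) ^ (k - 1) * 4 ^ k) *
      (n * μ.real {ω | t < χ ω} / b) ^ k := by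
  have h := ee_tail hS n b k t hn hk hb
  have hr : (0 : ℝ) < r := by exact_mod_cast hS.r1
  have hb0 : (0 : ℝ) < b := by
    have : 0 < 2 * k * r := by have := hS.r1; positivity
    exact_mod_cast lt_of_lt_of_le this hb
  rw [div_le_iff₀ hb0]
  refine h.trans (le_of_eq ?_)
  obtain ⟨j, rfl⟩ : ∃ j, k = j + 1 := ⟨k - 1, by omega⟩
  simp only [Nat.add_sub_cancel, div_pow, mul_pow]
  field_simp
  try ring

lemma main_limit (hS : Setup T μ χ r ρ) {L : ℝ → ℝ} (hL : SlowlyVarying L)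
    {α : ℝ} (hα0 : 0 < α) (hα1 : α < 1)
    (hanti : Antitone (fun x => μ.real {ω | x < χ ω}))
    (hpos : ∀ x : ℝ, 0 < x → 0 < μ.real {ω | x < χ ω})
    (hG : ∀ x : ℝ, 0 < x → μ.real {ω | x < χ ω} = L x / x ^ α)
    (hm : ∀ n b, Measurable (fun t => ee T μ χ n b t))
    (b : ℕ → ℕ) (hb : Tendsto b atTop atTop) (f : ℕ → ℝ) (hf : Tendsto f atTop atTop)
    (hq : Tendsto (fun n : ℕ => (n : ℝ) * μ.real {ω | f n < χ ω} / b n) atTop (𝓝 1)) :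
    Tendsto (fun n : ℕ => ∫ s in Set.Ioi (0:ℝ), ee T μ χ n (b n) (f n * s) / b n) atTop
      (𝓝 (α / (1 - α))) := by
  set G : ℝ → ℝ := fun x => μ.real {ω | x < χ ω} with hGdef
  have h1 : ∀ x, G x ≤ 1 := fun x => measureReal_le_one
  obtain ⟨x0, hx0, hU, hLw⟩ := G_potter (G := G) hL hα0 hanti hpos hG (α / 2) ((1 + α) / 2)
    (by linarith) (by linarith) (by linarith)
  obtain ⟨k, hk⟩ := exists_nat_gt (2 / α)
  have hk0 : (0:ℝ) < k := lt_trans (by positivity) hk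
  have hk1 : 1 ≤ k := by exact_mod_cast hk0
  set D : ℝ := r * 2 ^ k * k.factorial * (r : ℝ) ^ (k - 1) * 4 ^ k with hD
  have hD0 : 0 ≤ D := by positivity
  rw [← limit_integral α hα0 hα1]
  have g0 := hpos x0 hx0
  refine tendsto_integral_filter_of_dominated_convergence
    (fun s => if s ≤ 1 then (2 * (2 ^ ((1 + α) / 2) / G x0)) * s ^ (-((1 + α) / 2))
      else (D * (2 * 2 ^ (α / 2)) ^ k) * s ^ (-(α / 2 * k))) ?_ ?_ ?_ ?_
  · refine Eventually.of_forall fun n => ?_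
    exact (((hm n (b n)).comp (measurable_const_mul (f n))).div_const _).aestronglyMeasurable
  · filter_upwards [(tendsto_order.1 hq).2 2 (by norm_num), hf.eventually_ge_atTop x0,
      hb.eventually_ge_atTop (2 * k * r), eventually_ge_atTop 1,
      hb.eventually_ge_atTop 1] with n e1 e2 e3 e4 e5
    have hbn : (0:ℝ) < b n := by exact_mod_cast e5
    have hnn : (0:ℝ) < n := by exact_mod_cast e4
    refine (ae_restrict_iff' measurableSet_Ioi).2 (Eventually.of_forall fun s hs => ?_)
    have hs : 0 < s := hs
    rw [Real.norm_of_nonneg (div_nonneg (ee_nonneg _ _ _) hbn.le)]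
    have gf := hpos (f n) (hx0.trans_le e2)
    split_ifs with hs1
    · have a1 : ee T μ χ n (b n) (f n * s) / b n ≤ n * G (f n * s) / b n := by
        gcongr; exact ee_le_mean hS _ _ _
      have a2 := G_small (G := G) (by linarith : 0 < (1 + α) / 2) hanti hpos h1 hx0 hLw (f n) s e2 hs hs1
      calc _ ≤ n * G (f n * s) / b n := a1
        _ ≤ n * (2 ^ ((1 + α) / 2) / G x0 * s ^ (-((1 + α) / 2)) * G (f n)) / b n := by gcongr
        _ = (2 ^ ((1 + α) / 2) / G x0 * s ^ (-((1 + α) / 2))) * (n * G (f n) / b n) := by ring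
        _ ≤ (2 ^ ((1 + α) / 2) / G x0 * s ^ (-((1 + α) / 2))) * 2 := by
          have : 0 ≤ 2 ^ ((1 + α) / 2) / G x0 * s ^ (-((1 + α) / 2)) := by positivity
          gcongr
        _ = _ := by ring
    · push Not at hs1
      have a1 := ee_tail' hS n (b n) k (f n * s) e4 hk1 e3
      have a2 := hU (f n) s e2 hs1.le
      have gfs := hpos (f n * s) (mul_pos (hx0.trans_le e2) hs)
      have a3 : n * G (f n * s) / b n ≤ 2 * 2 ^ (α / 2) * s ^ (-(α / 2)) := by
        calc n * G (f n * s) / b n ≤ n * (2 ^ (α / 2) * s ^ (-(α / 2)) * G (f n)) / b n := by gcongr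
          _ = (2 ^ (α / 2) * s ^ (-(α / 2))) * (n * G (f n) / b n) := by ring
          _ ≤ (2 ^ (α / 2) * s ^ (-(α / 2))) * 2 := by gcongr
          _ = _ := by ring
      have a4 : (0:ℝ) ≤ n * G (f n * s) / b n := by
        have : 0 ≤ G (f n * s) := gfs.le
        positivity
      calc _ ≤ D * (n * G (f n * s) / b n) ^ k := a1
        _ ≤ D * (2 * 2 ^ (α / 2) * s ^ (-(α / 2))) ^ k := by gcongr
        _ = _ := by
          rw [mul_pow, ← Real.rpow_natCast (s ^ (-(α / 2))) k, ← Real.rpow_mul hs.le, neg_mul]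
          ring
  · refine bound_integrable _ _ _ _ (by linarith) ?_
    rw [div_lt_iff₀ hα0] at hk
    linarith
  · refine (ae_restrict_iff' measurableSet_Ioi).2 (Eventually.of_forall fun s hs => ?_)
    have hs : 0 < s := hs
    refine ee_pointwise hS b hb (fun n => f n * s) (s ^ (-α)) ?_
    have t1 := ((G_ratio (G := G) hL hα0 hG s hs).comp hf).mul hq
    rw [mul_one] at t1
    refine t1.congr' ?_
    filter_upwards [hf.eventually_gt_atTop 0] with n hn
    have gf := hpos (f n) hn
    simp only [Function.comp, hGdef] at gf ⊢
    rw [mul_comm s (f n)]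
    field_simp

end mainproof

theorem trimmed_sum_integral_asymptotic
    {Ω : Type*} [MeasurableSpace Ω] (T : Ω → Ω) (μ : Measure Ω)
    {F : Type*} [NormedRing F] [NormedAlgebra ℝ F] [CompleteSpace F]
    (ι : F →ₐ[ℝ] Ω → ℝ) (χ : Ω → ℝ)
    (hD : PropertyD T μ ι χ)
    (L : ℝ → ℝ) (hL : SlowlyVarying L) (hLpos : ∀ x : ℝ, 0 < x → 0 < L x)
    {α : ℝ} (hα0 : 0 < α) (hα1 : α < 1)
    (htail : ∀ x : ℝ, 0 < x → (μ {ω | x < χ ω}).toReal = L x / x ^ α)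
    (b : ℕ → ℕ) (hb : Tendsto b atTop atTop)
    (hbo : Tendsto (fun n => (b n : ℝ) / (n : ℝ)) atTop (𝓝 0))
    (hmix : ∃ r : ℕ, 1 ≤ r ∧ psiCoeff μ T χ r < 1)
    (ls : ℝ → ℝ) (hls : IsDeBruijnConjugate (fun x => L x ^ (-(1 / α))) ls)
    :
    Tendsto (fun n => (∫ ω, trimmedSumN T χ n (b n) ω ∂μ) / dSeq α ls b n)
      atTop (𝓝 1) := by
  haveI := hD.prob
  obtain ⟨r, hr, hpsi⟩ := hmix
  obtain ⟨ρ, hS⟩ := setup_of T μ χ hD.invariant hD.chi_meas r hr hpsi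
  have hG : ∀ x : ℝ, 0 < x → μ.real {ω | x < χ ω} = L x / x ^ α := htail
  have hpos : ∀ x : ℝ, 0 < x → 0 < μ.real {ω | x < χ ω} := by
    intro x hx
    rw [hG x hx]
    have := hLpos x hx
    positivity
  have hanti : Antitone (fun x => μ.real {ω | x < χ ω}) := by
    intro x y hxy
    exact measureReal_mono (fun ω (h : y < χ ω) => lt_of_le_of_lt hxy h)
  have hTI := fun n b => trimmed_integral T χ μ hD.invariant.measurable hD.chi_meas
    hD.chi_nonneg n b
  obtain ⟨q1, q2⟩ := quantile (G := fun x => μ.real {ω | x < χ ω}) hL hLpos hα0 hanti hpos hG hls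
  set y : ℕ → ℝ := fun n => ((n : ℝ) / (b n : ℝ)) ^ (1 / α) with hy
  have hbpos : ∀ᶠ n in atTop, (0:ℝ) < b n := by
    filter_upwards [hb.eventually_ge_atTop 1] with n hn
    exact_mod_cast hn
  have hnpos : ∀ᶠ n : ℕ in atTop, (0:ℝ) < n := by
    filter_upwards [eventually_ge_atTop 1] with n hn
    exact_mod_cast hn
  have hratio : Tendsto (fun n : ℕ => (n : ℝ) / (b n : ℝ)) atTop atTop := by
    have h0 : Tendsto (fun n => (b n : ℝ) / (n : ℝ)) atTop (𝓝[>] 0) := by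
      refine tendsto_nhdsWithin_iff.2 ⟨hbo, ?_⟩
      filter_upwards [hbpos, hnpos] with n h1 h2
      exact div_pos h1 h2
    refine (tendsto_inv_nhdsGT_zero.comp h0).congr fun n => ?_
    simp
  have hyt : Tendsto y atTop atTop := (tendsto_rpow_atTop (by positivity)).comp hratio
  set f : ℕ → ℝ := fun n => y n * ls (y n) with hf
  have hft : Tendsto f atTop atTop := q2.comp hyt
  have hq : Tendsto (fun n : ℕ => (n : ℝ) * μ.real {ω | f n < χ ω} / b n) atTop (𝓝 1) := by
    refine (q1.comp hyt).congr' ?_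
    filter_upwards [hbpos, hnpos] with n h1 h2
    have e : y n ^ α = n / b n := by
      simp only [hy]
      rw [← Real.rpow_mul (by positivity), one_div_mul_cancel hα0.ne', Real.rpow_one]
    simp only [Function.comp]
    rw [e]
    ring
  have hlim := main_limit hS hL hα0 hα1 hanti hpos hG (fun n b => (hTI n b).1) b hb f hft hq
  have hc : 0 < α / (1 - α) := div_pos hα0 (by linarith)
  have hlim2 := hlim.div_const (α / (1 - α))
  rw [div_self hc.ne'] at hlim2
  refine hlim2.congr' ?_
  filter_upwards [hbpos, hnpos, hft.eventually_gt_atTop 0] with n h1 h2 h3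
  have e1 : ∫ ω, trimmedSumN T χ n (b n) ω ∂μ =
      f n * ∫ s in Set.Ioi (0:ℝ), ee T μ χ n (b n) (f n * s) := by
    rw [(hTI n (b n)).2, integral_comp_mul_left_Ioi _ _ h3]
    simp only [mul_zero, smul_eq_mul]
    rw [← mul_assoc, mul_inv_cancel₀ h3.ne', one_mul]
    rfl
  have e2 : dSeq α ls b n = α / (1 - α) * (b n * f n) := by
    have e3 : y n = (n : ℝ) ^ (1 / α) / (b n : ℝ) ^ (1 / α) :=
      Real.div_rpow h2.le h1.le _
    have e4 : dSeq α ls b n = α / (1 - α) * (n : ℝ) ^ (1 / α) * (b n : ℝ) ^ (1 - 1 / α) *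
      ls (y n) := rfl
    rw [e4, Real.rpow_sub h1, Real.rpow_one]
    simp only [hf]
    rw [show y n * ls (y n) = (n : ℝ) ^ (1 / α) / (b n : ℝ) ^ (1 / α) * ls (y n) by rw [← e3]]
    ring
  rw [e1, e2, integral_div]
  field_simp
end
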